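/- Let X ⊆ ℝ² be a path-connected subset with empty interior (hence a one-dimensional separable metric space), with basepoint x₀ ∈ X, and let U ⊆ X. Let α : ([a,b],{a,b}) → (X,x₀) be a loop with 1 ≠ [α] ∈ π₁(X,x₀). If α has a cancellation relative to U and β is a reduced loop based at x₀ that is path-homotopic to α, then β has a cancellation relative to U. -/

import Mathlib

open scoped unitInterval

noncomputable section

/-- The affine subpath of `α : C([a,b], X)` from `s` to `t`, as a `Path`. -/
def subPath {X : Type*} [TopologicalSpace X] {a b : ℝ} (α : C(Set.Icc a b, X))
    (s t : Set.Icc a b) (hst : (s : ℝ) ≤ (t : ℝ)) : Path (α s) (α t) where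
  toFun u := α ⟨(1 - (u : ℝ)) * (s : ℝ) + (u : ℝ) * (t : ℝ),
    ⟨le_trans s.2.1 (by nlinarith [u.2.1, u.2.2]),
     le_trans (by nlinarith [u.2.1, u.2.2]) t.2.2⟩⟩
  continuous_toFun := by
    apply α.continuous.comp; apply Continuous.subtype_mk; fun_prop
  source' := by apply congrArg α; apply Subtype.ext; simp
  target' := by apply congrArg α; apply Subtype.ext; simp

/-- A path `α : [a,b] → X` is *reduced* if it is constant or if for all `s < t` with
`α(s) = α(t)`, the loop `α|_{[s,t]}` is not null-homotopic. -/
def IsReducedOn {X : Type*} [TopologicalSpace X] {a b : ℝ} (α : C(Set.Icc a b, X)) : Prop :=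
  (∃ c, ∀ u, α u = c) ∨
  ∀ (s t : Set.Icc a b) (hst : (s : ℝ) < (t : ℝ)) (he : α s = α t),
    ¬ ((subPath α s t hst.le).cast rfl he).Homotopic (Path.refl (α s))

/-- Equivalence (`≡`) of paths on intervals: equality up to an increasing homeomorphism of
the parameter intervals. -/
def PathEquivOn {X : Type*} [TopologicalSpace X] {a b c d : ℝ}
    (α : C(Set.Icc a b, X)) (β : C(Set.Icc c d, X)) : Prop :=
  ∃ γ : Set.Icc a b ≃ₜ Set.Icc c d, StrictMono (fun u => γ u) ∧ ∀ u, α u = β (γ u)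

/-- Restriction of `α : C([a,b], X)` to the subinterval `[c,d]` (via clamping; for
`[c,d] ⊆ [a,b]` this is the restriction `α|_{[c,d]}`). -/
def resIcc {X : Type*} [TopologicalSpace X] {a b : ℝ} (α : C(Set.Icc a b, X)) (hab : a ≤ b)
    (c d : ℝ) : C(Set.Icc c d, X) :=
  α.comp ⟨fun u => Set.projIcc a b hab (u : ℝ), continuous_projIcc.comp continuous_subtype_val⟩

/-- The reverse of a path on `[c,d]`. -/
def reverseIcc {X : Type*} [TopologicalSpace X] {c d : ℝ} (β : C(Set.Icc c d, X)) :
    C(Set.Icc c d, X) :=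
  ⟨fun u => β ⟨c + d - (u : ℝ), ⟨by linarith [u.2.1, u.2.2], by linarith [u.2.1, u.2.2]⟩⟩,
    β.continuous.comp (by apply Continuous.subtype_mk; fun_prop)⟩

/-- The path `α : [a,b] → X` reparametrized affinely as a `Path` on `[0,1]`. -/
def toPathIcc {X : Type*} [TopologicalSpace X] {a b : ℝ} (hab : a ≤ b)
    (α : C(Set.Icc a b, X)) :
    Path (α ⟨a, Set.left_mem_Icc.mpr hab⟩) (α ⟨b, Set.right_mem_Icc.mpr hab⟩) :=
  subPath α _ _ hab

/-- `S` is an arc in the plane with endpoints `x` and `y`. -/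
def IsArcWithEnds (S : Set (ℝ × ℝ)) (x y : ℝ × ℝ) : Prop :=
  ∃ p : Path x y, Function.Injective p ∧ S = Set.range p

/-- A *cancellation* of the path `α : C([a,b],X)` relative to `U ⊆ X`: a subdivision
`a = t₀ < ⋯ < tₙ = b`, a partition of the indices into `C ∪ C̄ ∪ R`, a bijection
`φ : C → C̄`, and pairwise disjoint arcs `Sᵢ` (`i ∈ C`) in the closed upper half-plane with
endpoint set `Sᵢ ∩ (ℝ×{0})`, one endpoint in `(t_{i-1},t_i)×{0}` and one in
`(t_{φ(i)-1},t_{φ(i)})×{0}`, such that each `αᵢ = α|_{[t_{i-1},t_i]}` is reduced,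
`Im(αᵢ) ⊆ U` for `i ∈ R`, and `αᵢ ≡ α_{φ(i)}⁻` for `i ∈ C`. -/
def HasCancellation {X : Type*} [TopologicalSpace X] {a b : ℝ} (hab : a ≤ b)
    (α : C(Set.Icc a b, X)) (U : Set X) : Prop :=
  ∃ (n : ℕ) (t : ℕ → ℝ) (C Cb R : Set (Fin n)) (φ : Fin n → Fin n)
      (S : Fin n → Set (ℝ × ℝ)) (ep : Fin n → (ℝ × ℝ) × (ℝ × ℝ)),
    t 0 = a ∧ t n = b ∧ (∀ i, i < n → t i < t (i + 1)) ∧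
    C ∪ Cb ∪ R = Set.univ ∧ Disjoint C Cb ∧ Disjoint C R ∧ Disjoint Cb R ∧
    Set.BijOn φ C Cb ∧
    (∀ i ∈ C,
      IsArcWithEnds (S i) (ep i).1 (ep i).2 ∧
      (∀ q ∈ S i, 0 ≤ q.2) ∧
      S i ∩ {q : ℝ × ℝ | q.2 = 0} = {(ep i).1, (ep i).2} ∧
      (ep i).1 ∈ Set.Ioo (t i.1) (t (i.1 + 1)) ×ˢ ({0} : Set ℝ) ∧
      (ep i).2 ∈ Set.Ioo (t (φ i).1) (t ((φ i).1 + 1)) ×ˢ ({0} : Set ℝ)) ∧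
    (∀ i : Fin n, IsReducedOn (resIcc α hab (t i.1) (t (i.1 + 1)))) ∧
    (∀ i ∈ R, ∀ u, resIcc α hab (t i.1) (t (i.1 + 1)) u ∈ U) ∧
    (∀ i ∈ C, PathEquivOn (resIcc α hab (t i.1) (t (i.1 + 1)))
        (reverseIcc (resIcc α hab (t (φ i).1) (t ((φ i).1 + 1))))) ∧
    (∀ i ∈ C, ∀ j ∈ C, i ≠ j → Disjoint (S i) (S j))

noncomputable section

/-- every nowhere vanishing function on the plane has a logarithm -/
theorem exists_log_plane (g : C(ℝ × ℝ, ℂ)) (hg : ∀ x, g x ≠ 0) :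
    ∃ L : C(ℝ × ℝ, ℂ), ∀ x, Complex.exp (L x) = g x := by
  have h := Complex.isCoveringMapOn_exp.existsUnique_continuousMap_lifts g
    (a₀ := ((0, 0) : ℝ × ℝ)) (e₀ := Complex.log (g (0, 0))) (by simp [Complex.exp_log (hg _)])
    (by simpa using hg)
  obtain ⟨L, ⟨_, hL⟩, _⟩ := h
  exact ⟨L, fun x => congrFun hL x⟩

theorem log_edge_aux (c : ℂ) (hc : c ≠ 0) (L z : ℝ → ℂ) (hL : Continuous L) (hz : Continuous z)
    (he : ∀ s, Complex.exp (L s) = z s) (hs : ∀ s, c * z s ∈ Complex.slitPlane) :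
    (L 1).im - (L 0).im = (c * z 1).arg - (c * z 0).arg := by
  have h0 : ∀ s, c * z s ≠ 0 := fun s => Complex.slitPlane_ne_zero (hs s)
  let L2 : ℝ → ℂ := fun s => Complex.log (c * z s) + (L 0 - Complex.log (c * z 0))
  have hL2 : Continuous L2 := by
    have : Continuous fun s => Complex.log (c * z s) :=
      Continuous.clog (by fun_prop) hs
    fun_prop
  have hz0 : ∀ s, z s ≠ 0 := fun s h => h0 s (by simp [h])
  have e2 : ∀ s, Complex.exp (L2 s) = z s := by
    intro s
    simp only [L2, Complex.exp_add, Complex.exp_sub, Complex.exp_log (h0 _), he]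
    field_simp [hz0 0]
  have key : L = L2 := by
    have := Complex.isCoveringMap_exp.eq_of_comp_eq (A := ℝ) (g₁ := L) (g₂ := L2) hL hL2
      (by funext s; apply Subtype.ext; simp [he, e2]) 0 (by simp [L2])
    exact this
  rw [key]
  simp [L2, Complex.log_im]
  ring

theorem log_edge_up (L z : ℝ → ℂ) (hL : Continuous L) (hz : Continuous z)
    (he : ∀ s, Complex.exp (L s) = z s) (hs : ∀ s, 0 ≤ (z s).im) :
    (L 1).im - (L 0).im = (-Complex.I * z 1).arg - (-Complex.I * z 0).arg := by
  refine log_edge_aux _ (by simp) L z hL hz he fun s => ?_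
  have h0 : z s ≠ 0 := he s ▸ Complex.exp_ne_zero _
  rw [Complex.mem_slitPlane_iff]
  simp
  rcases (hs s).lt_or_eq with h | h
  · exact Or.inl h
  · right; intro h'; exact h0 (Complex.ext h' h.symm)

theorem log_edge_down (L z : ℝ → ℂ) (hL : Continuous L) (hz : Continuous z)
    (he : ∀ s, Complex.exp (L s) = z s) (hs : ∀ s, (z s).im ≤ 0) :
    (L 1).im - (L 0).im = (Complex.I * z 1).arg - (Complex.I * z 0).arg := by
  refine log_edge_aux _ (by simp) L z hL hz he fun s => ?_
  have h0 : z s ≠ 0 := he s ▸ Complex.exp_ne_zero _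
  rw [Complex.mem_slitPlane_iff]
  simp
  rcases (hs s).lt_or_eq with h | h
  · exact Or.inl h
  · right; intro h'; exact h0 (Complex.ext h' h)

theorem arg_I_pos (x : ℝ) (hx : 0 < x) : (Complex.I * (x : ℂ)).arg = Real.pi / 2 := by
  rw [mul_comm, Complex.arg_real_mul _ hx, Complex.arg_I]

theorem arg_I_neg (x : ℝ) (hx : x < 0) : (Complex.I * (x : ℂ)).arg = -(Real.pi / 2) := by
  have : Complex.I * (x : ℂ) = ((-x : ℝ) : ℂ) * (-Complex.I) := by push_cast; ring
  rw [this, Complex.arg_real_mul _ (by linarith), Complex.arg_neg_I]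

/-- crossing lemma for two paths in the upper half plane -/
theorem crossing_paths (p q : ℝ → ℝ × ℝ) (hp : Continuous p) (hq : Continuous q)
    (hp0 : ∀ s, 0 ≤ (p s).2) (hq0 : ∀ s, 0 ≤ (q s).2) {a b c d : ℝ}
    (pa : p 0 = (a, 0)) (pc : p 1 = (c, 0)) (qb : q 0 = (b, 0)) (qd : q 1 = (d, 0))
    (hab : a < b) (hbc : b < c) (hcd : c < d) (hne : ∀ s t, p s ≠ q t) : False := by
  let g : C(ℝ × ℝ, ℂ) := ⟨fun x => ⟨(p x.1).1 - (q x.2).1, (p x.1).2 - (q x.2).2⟩, by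
    have : (fun x : ℝ × ℝ => (⟨(p x.1).1 - (q x.2).1, (p x.1).2 - (q x.2).2⟩ : ℂ)) =
      fun x => (((p x.1).1 - (q x.2).1 : ℝ) : ℂ) + (((p x.1).2 - (q x.2).2 : ℝ) : ℂ) * Complex.I := by
      funext x; apply Complex.ext <;> simp
    rw [this]; fun_prop⟩
  have hg : ∀ x, g x ≠ 0 := by
    intro x h
    apply hne x.1 x.2
    have h1 := congrArg Complex.re h
    have h2 := congrArg Complex.im h
    simp [g] at h1 h2
    exact Prod.ext (by linarith) (by linarith)
  obtain ⟨L, hL⟩ := exists_log_plane g hg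
  have g1 : ∀ s, (g (s, 0)) = ⟨(p s).1 - b, (p s).2⟩ := fun s => by simp [g, qb]
  have g2 : ∀ s, (g (s, 1)) = ⟨(p s).1 - d, (p s).2⟩ := fun s => by simp [g, qd]
  have g3 : ∀ s, (g (0, s)) = ⟨a - (q s).1, -(q s).2⟩ := fun s => by simp [g, pa]
  have g4 : ∀ s, (g (1, s)) = ⟨c - (q s).1, -(q s).2⟩ := fun s => by simp [g, pc]
  have e1 := log_edge_up (fun s => L (s, 0)) (fun s => g (s, 0)) (by fun_prop) (by fun_prop)
    (fun s => hL _) (fun s => by rw [g1]; exact hp0 s)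
  have e2 := log_edge_up (fun s => L (s, 1)) (fun s => g (s, 1)) (by fun_prop) (by fun_prop)
    (fun s => hL _) (fun s => by rw [g2]; exact hp0 s)
  have e3 := log_edge_down (fun s => L (0, s)) (fun s => g (0, s)) (by fun_prop) (by fun_prop)
    (fun s => hL _) (fun s => by rw [g3]; simpa using hq0 s)
  have e4 := log_edge_down (fun s => L (1, s)) (fun s => g (1, s)) (by fun_prop) (by fun_prop)
    (fun s => hL _) (fun s => by rw [g4]; simpa using hq0 s)
  have v00 : g (0, 0) = ((a - b : ℝ) : ℂ) := by apply Complex.ext <;> simp [g, pa, qb]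
  have v10 : g (1, 0) = ((c - b : ℝ) : ℂ) := by apply Complex.ext <;> simp [g, pc, qb]
  have v01 : g (0, 1) = ((a - d : ℝ) : ℂ) := by apply Complex.ext <;> simp [g, pa, qd]
  have v11 : g (1, 1) = ((c - d : ℝ) : ℂ) := by apply Complex.ext <;> simp [g, pc, qd]
  have m : ∀ x : ℝ, -Complex.I * (x : ℂ) = Complex.I * ((-x : ℝ) : ℂ) := by
    intro x; push_cast; ring
  simp only [v00, v10, m] at e1
  simp only [v01, v11, m] at e2
  simp only [v00, v01] at e3
  simp only [v10, v11] at e4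
  rw [arg_I_neg _ (by linarith), arg_I_pos _ (by linarith)] at e1
  rw [arg_I_pos _ (by linarith), arg_I_pos _ (by linarith)] at e2
  rw [arg_I_neg _ (by linarith), arg_I_neg _ (by linarith)] at e3
  rw [arg_I_neg _ (by linarith), arg_I_pos _ (by linarith)] at e4
  have := Real.pi_pos
  linarith

def cj (z : ℝ × ℝ) : ℝ × ℝ := (z.1, -z.2)

theorem continuous_cj : Continuous cj := by unfold cj; fun_prop

theorem cj_cj (z : ℝ × ℝ) : cj (cj z) = z := by simp [cj]

/-- In a neighbourhood of a connected set missing `K`, replace by a folded path. -/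
theorem folded_path (K1 K2 : Set (ℝ × ℝ)) (h1 : IsPreconnected K1) (c2 : IsClosed K2)
    (up1 : ∀ z ∈ K1, 0 ≤ z.2) (up2 : ∀ z ∈ K2, 0 ≤ z.2) (hd : Disjoint K1 K2) {x x' : ℝ}
    (hx : (x, 0) ∈ K1) (hx' : (x', 0) ∈ K1) :
    ∃ p : ℝ → ℝ × ℝ, Continuous p ∧ (∀ s, 0 ≤ (p s).2) ∧ p 0 = (x, 0) ∧ p 1 = (x', 0) ∧
      (∀ s, p s ∉ K2) ∧ IsCompact (Set.range p) ∧ IsPreconnected (Set.range p) := by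
  let O : Set (ℝ × ℝ) := (K2 ∪ cj ⁻¹' K2)ᶜ
  have hO : IsOpen O := (c2.union (c2.preimage continuous_cj)).isOpen_compl
  have hK : K1 ⊆ O := by
    rintro z hz (h | h)
    · exact Set.disjoint_left.1 hd hz h
    · have a1 := up1 z hz
      have a2 := up2 _ h
      have : z.2 = 0 := by simp [cj] at a2; linarith
      have : cj z = z := by apply Prod.ext <;> simp [cj, this]
      rw [Set.mem_preimage, this] at h
      exact Set.disjoint_left.1 hd hz h
  have hsub : K1 ⊆ connectedComponentIn O (x, 0) := h1.subset_connectedComponentIn hx hK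
  have hpc : IsPathConnected (connectedComponentIn O (x, 0)) := by
    rw [← (hO.connectedComponentIn).isConnected_iff_isPathConnected]
    exact isConnected_connectedComponentIn_iff.2 (hK hx)
  obtain ⟨γ, hγ⟩ := hpc.joinedIn _ (hsub hx) _ (hsub hx')
  have hc : Continuous fun s : ℝ => ((γ.extend s).1, |(γ.extend s).2|) := by
    have := γ.continuous_extend
    fun_prop
  have hr : Set.range (fun s : ℝ => ((γ.extend s).1, |(γ.extend s).2|)) =
      (fun z : ℝ × ℝ => (z.1, |z.2|)) '' Set.range γ := by
    rw [← γ.extend_range, ← Set.range_comp]; rfl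
  refine ⟨fun s => ((γ.extend s).1, |(γ.extend s).2|), hc, fun s => abs_nonneg _, by simp,
    by simp, ?_, ?_, isPreconnected_range hc⟩
  · intro s hs
    have : γ.extend s ∈ O := by
      have : γ.extend s ∈ Set.range γ := by rw [← γ.extend_range]; exact ⟨s, rfl⟩
      obtain ⟨u, hu⟩ := this
      rw [← hu]; exact connectedComponentIn_subset _ _ (hγ u)
    apply this
    rcases abs_choice (γ.extend s).2 with h | h
    · left; simp only [h] at hs; exact hs
    · right; simp only [h] at hs; exact hs
  · rw [hr]
    exact (isCompact_range γ.continuous).image (by fun_prop)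

theorem crossing_lt (K1 K2 : Set (ℝ × ℝ)) (h1 : IsPreconnected K1) (h2 : IsPreconnected K2)
    (c2 : IsClosed K2) (up1 : ∀ z ∈ K1, 0 ≤ z.2) (up2 : ∀ z ∈ K2, 0 ≤ z.2)
    (hd : Disjoint K1 K2) {x x' y y' : ℝ} (hx : (x, 0) ∈ K1) (hx' : (x', 0) ∈ K1)
    (hy : (y, 0) ∈ K2) (hy' : (y', 0) ∈ K2) (l1 : x < y) (l2 : y < x') (l3 : x' < y') : False := by
  obtain ⟨p, pc, pu, p0, p1, pn, pk, pp⟩ := folded_path K1 K2 h1 c2 up1 up2 hd hx hx'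
  obtain ⟨q, qc, qu, q0, q1, qn, -, -⟩ := folded_path K2 (Set.range p) h2 pk.isClosed up2
    (by rintro _ ⟨s, rfl⟩; exact pu s)
    (Set.disjoint_right.2 (by rintro _ ⟨s, rfl⟩; exact pn s)) hy hy'
  exact crossing_paths p q pc qc pu qu p0 p1 q0 q1 l1 l2 l3 fun s t h => qn t ⟨s, h⟩

/-- general crossing lemma -/
theorem crossing (K1 K2 : Set (ℝ × ℝ)) (h1 : IsPreconnected K1) (h2 : IsPreconnected K2)
    (c1 : IsClosed K1)
    (c2 : IsClosed K2) (up1 : ∀ z ∈ K1, 0 ≤ z.2) (up2 : ∀ z ∈ K2, 0 ≤ z.2)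
    (hd : Disjoint K1 K2) {x x' y y' : ℝ} (hx : (x, 0) ∈ K1) (hx' : (x', 0) ∈ K1)
    (hy : (y, 0) ∈ K2) (hy' : (y', 0) ∈ K2) :
    0 ≤ (x - y) * (x - y') * (x' - y) * (x' - y') := by
  by_contra hneg
  push Not at hneg
  have A := fun {x x' y y' : ℝ} (hx : (x, 0) ∈ K1) (hx' : (x', 0) ∈ K1)
    (hy : (y, 0) ∈ K2) (hy' : (y', 0) ∈ K2) =>
    crossing_lt K1 K2 h1 h2 c2 up1 up2 hd hx hx' hy hy'
  have B := fun {x x' y y' : ℝ} (hx : (x, 0) ∈ K1) (hx' : (x', 0) ∈ K1)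
    (hy : (y, 0) ∈ K2) (hy' : (y', 0) ∈ K2) =>
    crossing_lt K2 K1 h2 h1 c1 up2 up1 hd.symm hy hy' hx hx'
  simp only [mul_neg_iff, mul_pos_iff, sub_pos, sub_neg] at hneg
  rcases lt_or_ge x x' with o1 | o1 <;> rcases lt_or_ge y y' with o2 | o2 <;>
  rcases hneg with ⟨(⟨(⟨h, h'⟩ | ⟨h, h'⟩), h''⟩ | ⟨(⟨h, h'⟩ | ⟨h, h'⟩), h''⟩), h'''⟩ | ⟨(⟨(⟨h, h'⟩ | ⟨h, h'⟩), h''⟩ | ⟨(⟨h, h'⟩ | ⟨h, h'⟩), h''⟩), h'''⟩ <;>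
  first
  | linarith
  | exact A hx hx' hy hy' (by linarith) (by linarith) (by linarith)
  | exact A hx hx' hy' hy (by linarith) (by linarith) (by linarith)
  | exact A hx' hx hy hy' (by linarith) (by linarith) (by linarith)
  | exact A hx' hx hy' hy (by linarith) (by linarith) (by linarith)
  | exact B hx hx' hy hy' (by linarith) (by linarith) (by linarith)
  | exact B hx hx' hy' hy (by linarith) (by linarith) (by linarith)
  | exact B hx' hx hy hy' (by linarith) (by linarith) (by linarith)
  | exact B hx' hx hy' hy (by linarith) (by linarith) (by linarith)

end

noncomputable section

open BoundedContinuousFunction in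
theorem sep_step (X : Set (ℝ × ℝ)) (hX : interior X = ∅) (a b δ : ℝ) (hδ : 0 < δ)
    (s : (ℝ →ᵇ ℝ) × Finset ℝ) : ∃ s' : (ℝ →ᵇ ℝ) × Finset ℝ,
    s.2 ⊆ s'.2 ∧ (∀ θ ∈ s.2, s'.1 θ = s.1 θ) ∧ dist s.1 s'.1 ≤ δ ∧
    (a < b → ∃ θ ∈ s'.2, θ ∈ Set.Ioo a b ∧ (θ, s'.1 θ) ∉ X) := by
  by_cases hab : a < b
  swap
  · exact ⟨s, subset_rfl, fun _ _ => rfl, by simp [hδ.le], fun h => absurd h hab⟩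
  obtain ⟨F, T⟩ := s
  let O : Set (ℝ × ℝ) := {z | z.1 ∈ Set.Ioo a b ∧ z.1 ∉ T ∧ |z.2 - F z.1| < δ}
  have hO : IsOpen O := by
    have h1 : IsOpen {z : ℝ × ℝ | z.1 ∈ Set.Ioo a b} := isOpen_Ioo.preimage continuous_fst
    have h2 : IsOpen {z : ℝ × ℝ | z.1 ∉ T} := T.finite_toSet.isClosed.isOpen_compl.preimage continuous_fst
    have h3 : IsOpen {z : ℝ × ℝ | |z.2 - F z.1| < δ} :=
      isOpen_lt (by fun_prop) continuous_const
    exact h1.inter (h2.inter h3)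
  obtain ⟨θ0, h0, h0'⟩ := (Set.Ioo_infinite hab).exists_notMem_finset T
  have hn : ¬ O ⊆ X := by
    intro h
    have : (θ0, F θ0) ∈ interior X := (interior_maximal h hO) ⟨h0, h0', by simpa using hδ⟩
    rw [hX] at this; exact this
  obtain ⟨⟨θ, y⟩, ⟨hθ, hT, hy⟩, hXn⟩ := Set.not_subset.1 hn
  obtain ⟨g, g0, g1, gI⟩ := exists_continuous_zero_one_of_isClosed
    (s := (T : Set ℝ)) (t := {θ}) T.finite_toSet.isClosed isClosed_singleton
    (by simpa using hT)
  let G : ℝ →ᵇ ℝ := BoundedContinuousFunction.ofNormedAddCommGroup g g.continuous 1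
    (fun x => by rw [Real.norm_eq_abs, abs_of_nonneg (gI x).1]; exact (gI x).2)
  have hG : ∀ x, G x = g x := fun x => rfl
  refine ⟨⟨F + (y - F θ) • G, insert θ T⟩, Finset.subset_insert _ _, ?_, ?_, fun _ => ⟨θ, by simp, hθ, ?_⟩⟩
  · intro x hx
    simp [hG, g0 hx]
  · rw [BoundedContinuousFunction.dist_le hδ.le]
    intro x
    simp only [BoundedContinuousFunction.coe_add, BoundedContinuousFunction.coe_smul, Pi.add_apply,
      smul_eq_mul, hG, dist_self_add_right, Real.norm_eq_abs, abs_mul, abs_of_nonneg (gI x).1]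
    have := abs_nonneg (y - F θ)
    have := (gI x).1
    have := (gI x).2
    simp only at hy
    nlinarith
  · have : g θ = 1 := g1 (by simp)
    simpa [hG, this] using hXn

open BoundedContinuousFunction in
theorem exists_sep_graph (X : Set (ℝ × ℝ)) (hX : interior X = ∅) (m ε : ℝ) (hε : 0 < ε) :
    ∃ F : ℝ → ℝ, Continuous F ∧ (∀ θ, |F θ - m| ≤ ε) ∧
      ∀ a b, a < b → ∃ θ ∈ Set.Ioo a b, (θ, F θ) ∉ X := by
  obtain ⟨e, he⟩ := exists_surjective_nat (ℚ × ℚ)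
  choose nx h1 h2 h3 h4 using fun (n : ℕ) => sep_step X hX (e n).1 (e n).2 (ε / 2 / 2 ^ n) (by positivity)
  let st : ℕ → (ℝ →ᵇ ℝ) × Finset ℝ := fun n => Nat.rec (BoundedContinuousFunction.const ℝ m, ∅) (fun n s => nx n s) n
  have hst : ∀ n, st (n+1) = nx n (st n) := fun n => rfl
  have hd : ∀ n, dist (st n).1 (st (n+1)).1 ≤ ε / 2 / 2 ^ n := fun n => by rw [hst]; exact h3 n _
  obtain ⟨F, hF⟩ := cauchySeq_tendsto_of_complete (cauchySeq_of_le_geometric_two hd)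
  have hd0 := dist_le_of_le_geometric_two_of_tendsto₀ hd hF
  have hT : ∀ n θ, θ ∈ (st n).2 → ∀ k, θ ∈ (st (n+k)).2 ∧ (st (n+k)).1 θ = (st n).1 θ := by
    intro n θ hθ k
    induction k with
    | zero => exact ⟨hθ, rfl⟩
    | succ k ih =>
      rw [← add_assoc, hst]
      exact ⟨h1 _ _ ih.1, by rw [h2 _ _ _ ih.1, ih.2]⟩
  have hpt : ∀ θ, Filter.Tendsto (fun n => (st n).1 θ) Filter.atTop (nhds (F θ)) := fun θ =>
    ((BoundedContinuousFunction.lipschitz_eval_const θ).continuous.tendsto F).comp hF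
  refine ⟨F, F.continuous, fun θ => ?_, fun a b hab => ?_⟩
  · have := (BoundedContinuousFunction.dist_coe_le_dist (f := (st 0).1) (g := F) θ).trans hd0
    rw [dist_comm, Real.dist_eq] at this
    exact this
  · obtain ⟨a', ha1, ha2⟩ := exists_rat_btwn hab
    obtain ⟨b', hb1, hb2⟩ := exists_rat_btwn ha2
    obtain ⟨n, hn⟩ := he (a', b')
    obtain ⟨θ, hθ, hI, hnX⟩ := h4 n (st n) (by rw [hn]; exact_mod_cast hb1)
    rw [hn] at hI
    simp only [Set.mem_Ioo] at hI
    refine ⟨θ, ⟨by linarith [hI.1], by linarith [hI.2]⟩, ?_⟩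
    rw [← hst] at hθ hnX
    have : F θ = (st (n+1)).1 θ := by
      refine tendsto_nhds_unique (hpt θ) ?_
      refine tendsto_const_nhds.congr' ?_
      filter_upwards [Filter.eventually_ge_atTop (n+1)] with k hk
      obtain ⟨j, rfl⟩ := Nat.exists_eq_add_of_le hk
      exact (hT (n+1) θ hθ j).2.symm
    rwa [this]

theorem sep_graph_aux (X : Set (ℝ × ℝ)) (F : ℝ → ℝ)
    (hF : ∀ a b, a < b → ∃ θ ∈ Set.Ioo a b, (θ, F θ) ∉ X) (S : Set (ℝ × ℝ)) (hS : S ⊆ X)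
    (hz : ∀ z ∈ S, z.2 = F z.1) (hc : IsPreconnected S) : S.Subsingleton := by
  have hp : (Prod.fst '' S).OrdConnected := (hc.image _ continuous_fst.continuousOn).ordConnected
  have key : ∀ z ∈ S, ∀ w ∈ S, ¬ z.1 < w.1 := by
    intro z hz' w hw h
    obtain ⟨θ, hθ, hn⟩ := hF _ _ h
    obtain ⟨v, hv, rfl⟩ := hp.out ⟨z, hz', rfl⟩ ⟨w, hw, rfl⟩ ⟨hθ.1.le, hθ.2.le⟩
    apply hn; rw [← hz v hv]; exact hS hv
  intro z hz' w hw
  have : z.1 = w.1 := le_antisymm (not_lt.1 (key w hw z hz')) (not_lt.1 (key z hz' w hw))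
  exact Prod.ext this (by rw [hz z hz', hz w hw, this])

theorem exists_sep_aux (X : Set (ℝ × ℝ)) (hX : interior X = ∅) (u v : ℝ × ℝ) (huv : u.2 ≠ v.2) :
    ∃ h : ℝ × ℝ → ℝ, Continuous h ∧ h u < 0 ∧ 0 < h v ∧ ∀ S ⊆ X, (∀ z ∈ S, h z = 0) →
      IsPreconnected S → S.Subsingleton := by
  have hpos : 0 < |v.2 - u.2| := abs_pos.2 (sub_ne_zero.2 huv.symm)
  obtain ⟨F, hc, hb, hd⟩ := exists_sep_graph X hX ((u.2 + v.2) / 2) (|v.2 - u.2| / 4) (by positivity)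
  refine ⟨fun z => (v.2 - u.2) * (z.2 - F z.1), by fun_prop, ?_, ?_, ?_⟩
  · have := abs_le.1 (hb u.1)
    rcases lt_or_gt_of_ne huv with h | h
    · rw [abs_of_pos (by linarith)] at this; simp only
      nlinarith
    · rw [abs_of_neg (by linarith)] at this; simp only
      nlinarith
  · have := abs_le.1 (hb v.1)
    rcases lt_or_gt_of_ne huv with h | h
    · rw [abs_of_pos (by linarith)] at this; simp only
      nlinarith
    · rw [abs_of_neg (by linarith)] at this; simp only
      nlinarith
  · intro S hS hz hcS
    refine sep_graph_aux X F hd S hS (fun z hz' => ?_) hcS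
    have := hz z hz'
    rcases mul_eq_zero.1 this with h | h
    · exact absurd (by linarith) huv
    · linarith

theorem exists_sep (X : Set (ℝ × ℝ)) (hX : interior X = ∅) (u v : ℝ × ℝ) (huv : u ≠ v) :
    ∃ h : ℝ × ℝ → ℝ, Continuous h ∧ h u < 0 ∧ 0 < h v ∧ ∀ S ⊆ X, (∀ z ∈ S, h z = 0) →
      IsPreconnected S → S.Subsingleton := by
  by_cases h2 : u.2 = v.2
  swap
  · exact exists_sep_aux X hX u v h2
  have h1 : u.1 ≠ v.1 := fun h => huv (Prod.ext h h2)
  obtain ⟨h, hc, hu, hv, hS⟩ := exists_sep_aux (Prod.swap ⁻¹' X) (by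
    have := (Homeomorph.prodComm ℝ ℝ).preimage_interior X
    rw [hX] at this
    simpa using this.symm) u.swap v.swap h1
  refine ⟨fun z => h z.swap, by fun_prop, hu, hv, fun S hSX hz hcS => ?_⟩
  have := hS (Prod.swap '' S) (by rintro _ ⟨z, hz, rfl⟩; simpa using hSX hz)
    (by rintro _ ⟨z, hz', rfl⟩; exact hz z hz') (hcS.image _ continuous_swap.continuousOn)
  intro z hz w hw
  exact Prod.swap_injective (this ⟨z, hz, rfl⟩ ⟨w, hw, rfl⟩)

end

noncomputable section

section classes
variable {Y : Type*} [TopologicalSpace Y] [PathConnectedSpace Y]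

/-- base point -/
def bpt (Y : Type*) [TopologicalSpace Y] [PathConnectedSpace Y] : Y :=
  Classical.choice PathConnectedSpace.nonempty

/-- the group in which we record classes of paths -/
abbrev Gp (Y : Type*) [TopologicalSpace Y] [PathConnectedSpace Y] : Type _ :=
  (FundamentalGroup Y (bpt Y))ᵐᵒᵖ

def wq (y : Y) : Path.Homotopic.Quotient (bpt Y) y :=
  .mk (PathConnectedSpace.somePath (bpt Y) y)

/-- class of a path -/
def kl {x y : Y} (γ : Path x y) : Gp Y :=
  MulOpposite.op (((wq x).trans (.mk γ)).trans (wq y).symm)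

open Path.Homotopic.Quotient in
theorem kl_trans {x y z : Y} (γ : Path x y) (δ : Path y z) : kl (γ.trans δ) = kl γ * kl δ := by
  unfold kl
  rw [← MulOpposite.op_mul, FundamentalGroup.mul_def]
  congr 1
  have : ((wq y).symm.trans (((wq y).trans (mk δ)).trans (wq z).symm)) =
    ((mk δ).trans (wq z).symm) := by
    rw [trans_assoc, ← trans_assoc, symm_trans, refl_trans]
  rw [trans_assoc _ _ (((wq y).trans (mk δ)).trans (wq z).symm), this]
  rw [mk_trans]
  simp only [trans_assoc]

open Path.Homotopic.Quotient in
theorem kl_refl (x : Y) : kl (Path.refl x) = 1 := by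
  unfold kl
  rw [mk_refl, trans_refl, trans_symm]; rfl

open Path.Homotopic.Quotient in
theorem kl_eq_iff {x y : Y} (γ δ : Path x y) : kl γ = kl δ ↔ γ.Homotopic δ := by
  rw [← Path.Homotopic.Quotient.eq]
  constructor
  · intro h
    have h := MulOpposite.op_injective h
    have h2 := congrArg (fun q => ((wq x).symm.trans q).trans (wq y)) h
    simp only at h2
    have aux : ∀ q : Path.Homotopic.Quotient x y,
        (((wq x).symm.trans (((wq x).trans q).trans (wq y).symm)).trans (wq y)) = q := by
      intro q
      rw [trans_assoc, trans_assoc, trans_assoc, symm_trans, trans_refl, ← trans_assoc,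
        symm_trans, refl_trans]
    rwa [aux, aux] at h2
  · intro h; unfold kl; rw [h]

theorem kl_congr {x y x' y' : Y} (γ : Path x y) (δ : Path x' y') (h : ∀ u, γ u = δ u) :
    kl γ = kl δ := by
  have h0 : x = x' := by rw [← γ.source, ← δ.source]; exact h 0
  have h1 : y = y' := by rw [← γ.target, ← δ.target]; exact h 1
  subst h0; subst h1
  congr 1; exact Path.ext (funext h)

theorem kl_const {x y : Y} (γ : Path x y) (h : ∀ u, γ u = x) : kl γ = 1 := by
  rw [kl_congr γ (Path.refl x) (by simpa using h), kl_refl]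

theorem kl_map_eq {Z : Type*} [TopologicalSpace Z] [SimplyConnectedSpace Z] (H : C(Z, Y)) {a b : Z}
    (π π₂ : Path a b) : kl (π.map H.continuous) = kl (π₂.map H.continuous) := by
  rw [kl_eq_iff]
  exact (SimplyConnectedSpace.paths_homotopic π π₂).map H

/-- linear path in the line -/
def lin (p q : ℝ) : Path p q where
  toFun u := p + u * (q - p)
  continuous_toFun := by fun_prop
  source' := by simp
  target' := by simp

theorem lin_apply (p q : ℝ) (u : I) : lin p q u = p + u * (q - p) := rfl

theorem lin_mem (p q : ℝ) (u : I) : lin p q u ∈ Set.uIcc p q := by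
  rw [lin_apply]
  have h0 := u.2.1
  have h1 := u.2.2
  rcases le_total p q with h | h
  · rw [Set.uIcc_of_le h]; constructor <;> nlinarith
  · rw [Set.uIcc_of_ge h]; constructor <;> nlinarith

/-- class of `f` restricted to `[p,q]` -/
def cl (f : C(ℝ, Y)) (p q : ℝ) : Gp Y := kl ((lin p q).map f.continuous)

theorem kl_map (f : C(ℝ, Y)) {p q : ℝ} (π : Path p q) : kl (π.map f.continuous) = cl f p q :=
  kl_map_eq f _ _

theorem cl_mul (f : C(ℝ, Y)) (p q r : ℝ) : cl f p q * cl f q r = cl f p r := by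
  rw [← kl_map f ((lin p q).trans (lin q r)), Path.map_trans, kl_trans]; rfl

theorem cl_self (f : C(ℝ, Y)) (p : ℝ) : cl f p p = 1 := by
  have := cl_mul f p p p
  simpa using this

theorem cl_inv (f : C(ℝ, Y)) (p q : ℝ) : cl f q p = (cl f p q)⁻¹ := by
  rw [eq_inv_iff_mul_eq_one, cl_mul, cl_self]

theorem cl_reparam (f g : C(ℝ, Y)) (e : ℝ → ℝ) (p q : ℝ) (he : ContinuousOn e (Set.uIcc p q))
    (h : ∀ x ∈ Set.uIcc p q, f x = g (e x)) : cl f p q = cl g (e p) (e q) := by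
  let π : Path (e p) (e q) :=
    { toFun := fun u => e (lin p q u)
      continuous_toFun := he.comp_continuous (lin p q).continuous (lin_mem p q)
      source' := by simp
      target' := by simp }
  rw [← kl_map g π]
  apply kl_congr
  intro u
  simp only [Path.map_coe, Function.comp]
  exact h _ (lin_mem p q u)

theorem cl_congr (f g : C(ℝ, Y)) (p q : ℝ) (h : ∀ x ∈ Set.uIcc p q, f x = g x) :
    cl f p q = cl g p q := cl_reparam f g id p q continuousOn_id h

theorem cl_const (f : C(ℝ, Y)) (p q : ℝ) (h : ∀ x ∈ Set.uIcc p q, f x = f p) : cl f p q = 1 := by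
  rw [cl_reparam f f (fun _ => p) p q continuousOn_const h, cl_self]

def Red (f : C(ℝ, Y)) (p q : ℝ) : Prop :=
  ∀ s t, p ≤ s → s < t → t ≤ q → f s = f t → cl f s t ≠ 1

theorem Red.mono {f : C(ℝ, Y)} {p q p' q' : ℝ} (h : Red f p q) (hp : p ≤ p') (hq : q' ≤ q) :
    Red f p' q' := fun s t hs hst ht => h s t (hp.trans hs) hst (ht.trans hq)

/-- null homotopies -/
theorem exists_nullhomotopy (f : C(ℝ, Y)) (p q : ℝ) (hpq : p ≤ q) (he : f p = f q)
    (h1 : cl f p q = 1) : ∃ H : C(ℝ × ℝ, Y), (∀ x ∈ Set.Icc p q, H (x, 0) = f x) ∧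
      (∀ z, z.1 ≤ p ∨ q ≤ z.1 ∨ 1 ≤ z.2 → H z = f p) ∧ ∀ z, H (cj z) = H z := by
  rcases hpq.eq_or_lt with rfl | hlt
  · refine ⟨ContinuousMap.const _ (f p), fun x hx => ?_, fun _ _ => rfl, fun _ => rfl⟩
    have : x = p := le_antisymm hx.2 hx.1
    simp [this]
  have : (((lin p q).map f.continuous).cast rfl he).Homotopic (Path.refl (f p)) := by
    rw [← kl_eq_iff, kl_refl, ← h1]
    exact kl_congr _ _ (fun u => rfl)
  obtain ⟨F⟩ := this
  let H : C(ℝ × ℝ, Y) := ⟨fun z => F (Set.projIcc 0 1 zero_le_one |z.2|,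
    Set.projIcc 0 1 zero_le_one ((z.1 - p) / (q - p))), by
      apply F.continuous.comp
      refine Continuous.prodMk (continuous_projIcc.comp (by fun_prop)) (continuous_projIcc.comp (by fun_prop))⟩
  have hH : ∀ z, H z = F (Set.projIcc 0 1 zero_le_one |z.2|,
    Set.projIcc 0 1 zero_le_one ((z.1 - p) / (q - p))) := fun _ => rfl
  have hq : 0 < q - p := by linarith
  refine ⟨H, fun x hx => ?_, ?_, fun z => ?_⟩
  · rw [hH]
    simp only [abs_zero]
    have : (x - p) / (q - p) ∈ Set.Icc (0:ℝ) 1 :=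
      ⟨div_nonneg (by linarith [hx.1]) hq.le, (div_le_one hq).2 (by linarith [hx.2])⟩
    rw [Set.projIcc_left, Set.projIcc_of_mem _ this]
    erw [F.apply_zero]
    simp only [Path.coe_toContinuousMap, Path.cast_coe, Path.map_coe, Function.comp, lin_apply]
    congr 1
    field_simp; ring
  · rintro z (h | h | h)
    · rw [hH, Set.projIcc_of_le_left (x := (z.1 - p) / (q - p)) _ (div_nonpos_of_nonpos_of_nonneg (by linarith) hq.le)]
      exact F.source _
    · rw [hH, Set.projIcc_of_right_le (x := (z.1 - p) / (q - p)) _ ((one_le_div hq).2 (by linarith))]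
      exact F.target _
    · rw [hH, Set.projIcc_of_right_le (x := |z.2|) _ (h.trans (le_abs_self _))]
      erw [F.apply_one]; rfl
  · rw [hH, hH]; simp [cj]

theorem cl_eq_one_of_box (f : C(ℝ, Y)) (H : C(ℝ × ℝ, Y)) (p q T : ℝ) (z : Y) (hpq : p ≤ q)
    (hT : 0 ≤ T) (h0 : ∀ x ∈ Set.Icc p q, H (x, 0) = f x)
    (hl : ∀ y ∈ Set.Icc 0 T, H (p, y) = z) (hr : ∀ y ∈ Set.Icc 0 T, H (q, y) = z)
    (ht : ∀ x ∈ Set.Icc p q, H (x, T) = z) : cl f p q = 1 := by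
  let bot : Path ((p, 0) : ℝ × ℝ) (q, 0) := (lin p q).prod (Path.refl 0)
  let L : Path ((p, 0) : ℝ × ℝ) (p, T) := (Path.refl p).prod (lin 0 T)
  let Tp : Path ((p, T) : ℝ × ℝ) (q, T) := (lin p q).prod (Path.refl T)
  let R : Path ((q, T) : ℝ × ℝ) (q, 0) := (Path.refl q).prod (lin T 0)
  have e1 : kl (bot.map H.continuous) = cl f p q := by
    refine kl_congr _ _ fun u => ?_
    have := lin_mem p q u
    rw [Set.uIcc_of_le hpq] at this
    exact h0 _ this
  have e2 := kl_map_eq H bot ((L.trans Tp).trans R)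
  rw [← e1, e2, Path.map_trans, Path.map_trans, kl_trans, kl_trans]
  have key : ∀ {a b : ℝ × ℝ} (π : Path a b), (∀ u, H (π u) = z) → kl (π.map H.continuous) = 1 := by
    intro a b π h
    apply kl_const
    intro u
    have h0 := h 0
    rw [π.source] at h0
    simp [h, h0]
  rw [key, key, key]
  · simp
  · intro u
    have := lin_mem T 0 u
    rw [Set.uIcc_of_ge hT] at this
    exact hr _ this
  · intro u
    have := lin_mem p q u
    rw [Set.uIcc_of_le hpq] at this
    exact ht _ this
  · intro u
    have := lin_mem 0 T u
    rw [Set.uIcc_of_le hT] at this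
    exact hl _ this

end classes
end

noncomputable section

theorem lift_const (S : Set (ℝ × ℝ)) (hS : IsPreconnected S) (L : C(ℝ × ℝ, ℂ)) (M : S → ℂ)
    (hM : Continuous M) (h : ∀ z : S, Complex.exp (M z) = Complex.exp (L z)) (a b : S) :
    L b - L a = M b - M a := by
  have : PreconnectedSpace S := Subtype.preconnectedSpace hS
  have key := Complex.isCoveringMap_exp.eq_of_comp_eq (A := S) (g₁ := fun z : S => L z)
    (g₂ := fun z => M z + (L a - M a)) (by fun_prop) (by fun_prop)
    (by
      funext z; apply Subtype.ext
      simp [Complex.exp_add, Complex.exp_sub, h]) a (by simp)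
  have := congrFun key b
  rw [this]; ring

theorem clopen_sep {Z : Type*} [TopologicalSpace Z] [CompactSpace Z] [T2Space Z] (A B : Set Z)
    (hA : IsClosed A) (hB : IsClosed B)
    (h : ∀ a ∈ A, ∀ b ∈ B, b ∉ connectedComponent a) :
    ∃ W : Set Z, IsClopen W ∧ A ⊆ W ∧ Disjoint W B := by
  have h1 : ∀ a ∈ A, ∃ W : Set Z, IsClopen W ∧ a ∈ W ∧ Disjoint W B := by
    intro a ha
    refine hB.isCompact.induction_on (p := fun S => ∃ W : Set Z, IsClopen W ∧ a ∈ W ∧ Disjoint W S)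
      ⟨Set.univ, isClopen_univ, trivial, by simp⟩ ?_ ?_ ?_
    · rintro s t hst ⟨W, h1, h2, h3⟩
      exact ⟨W, h1, h2, h3.mono_right hst⟩
    · rintro s t ⟨W, h1, h2, h3⟩ ⟨W', h1', h2', h3'⟩
      exact ⟨W ∩ W', h1.inter h1', ⟨h2, h2'⟩, Set.disjoint_union_right.2
        ⟨h3.mono_left Set.inter_subset_left, h3'.mono_left Set.inter_subset_right⟩⟩
    · intro b hb
      have := h a ha b hb
      rw [connectedComponent_eq_iInter_isClopen, Set.mem_iInter] at this
      push Not at this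
      obtain ⟨⟨W, hW, haW⟩, hbW⟩ := this
      exact ⟨Wᶜ, mem_nhdsWithin_of_mem_nhds (hW.compl.isOpen.mem_nhds hbW), W, hW, haW,
        disjoint_compl_right⟩
  refine hA.isCompact.induction_on (p := fun S => ∃ W : Set Z, IsClopen W ∧ S ⊆ W ∧ Disjoint W B)
    ⟨∅, isClopen_empty, by simp, by simp⟩ ?_ ?_ ?_
  · rintro s t hst ⟨W, h1, h2, h3⟩
    exact ⟨W, h1, hst.trans h2, h3⟩
  · rintro s t ⟨W, h1, h2, h3⟩ ⟨W', h1', h2', h3'⟩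
    exact ⟨W ∪ W', h1.union h1', Set.union_subset_union h2 h2', Set.disjoint_union_left.2 ⟨h3, h3'⟩⟩
  · intro a ha
    obtain ⟨W, h1, h2, h3⟩ := h1 a ha
    exact ⟨W, mem_nhdsWithin_of_mem_nhds (h1.isOpen.mem_nhds h2), W, h1, subset_rfl, h3⟩

theorem compact_sep (Z A B : Set (ℝ × ℝ)) (hZ : IsCompact Z) (hA : IsClosed A) (hB : IsClosed B)
    (h : ∀ K ⊆ Z, IsCompact K → IsPreconnected K → (K ∩ A).Nonempty → (K ∩ B).Nonempty → False) :
    ∃ A' B' : Set (ℝ × ℝ), IsClosed A' ∧ IsClosed B' ∧ Disjoint A' B' ∧ Z ⊆ A' ∪ B' ∧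
      Z ∩ A ⊆ A' ∧ Z ∩ B ⊆ B' := by
  have : CompactSpace Z := isCompact_iff_compactSpace.1 hZ
  obtain ⟨W, hW, hAW, hWB⟩ := clopen_sep (Z := Z) (Subtype.val ⁻¹' A) (Subtype.val ⁻¹' B)
    (hA.preimage continuous_subtype_val) (hB.preimage continuous_subtype_val) (by
      intro a ha b hb hab
      refine h (Subtype.val '' connectedComponent a) (by rintro _ ⟨z, _, rfl⟩; exact z.2)
        (isClosed_connectedComponent.isCompact.image continuous_subtype_val)
        (isPreconnected_connectedComponent.image _ continuous_subtype_val.continuousOn)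
        ⟨a, ⟨a, mem_connectedComponent, rfl⟩, ha⟩ ⟨b, ⟨b, hab, rfl⟩, hb⟩)
  have hce : Topology.IsClosedEmbedding (Subtype.val : Z → ℝ × ℝ) := hZ.isClosed.isClosedEmbedding_subtypeVal
  refine ⟨Subtype.val '' W, Subtype.val '' Wᶜ, hce.isClosedMap _ hW.isClosed,
    hce.isClosedMap _ hW.compl.isClosed, ?_, ?_, ?_, ?_⟩
  · exact (Set.disjoint_image_iff Subtype.val_injective).2 disjoint_compl_right
  · intro z hz
    by_cases hz' : (⟨z, hz⟩ : Z) ∈ W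
    · exact Or.inl ⟨_, hz', rfl⟩
    · exact Or.inr ⟨_, hz', rfl⟩
  · rintro z ⟨hz, hzA⟩
    exact ⟨⟨z, hz⟩, hAW hzA, rfl⟩
  · rintro z ⟨hz, hzB⟩
    exact ⟨⟨z, hz⟩, fun hw => Set.disjoint_left.1 hWB hw hzB, rfl⟩

def BoxS (p q : ℝ) : Set (ℝ × ℝ) := Set.Icc p q ×ˢ Set.Icc 0 1

def J2S (p q x1 x2 : ℝ) : Set (ℝ × ℝ) :=
  ((((Set.Icc p x1 ×ˢ {0}) ∪ ({p} ×ˢ Set.Icc 0 1)) ∪ (Set.Icc p q ×ˢ {1})) ∪ ({q} ×ˢ Set.Icc 0 1)) ∪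
    (Set.Icc x2 q ×ˢ {0})

theorem J2S_preconn {p q x1 x2 : ℝ} (h1 : p ≤ x1) (h2 : x2 ≤ q) (hpq : p ≤ q) :
    IsPreconnected (J2S p q x1 x2) := by
  have s0 : IsPreconnected ({0} : Set ℝ) := isPreconnected_singleton
  have s1 : IsPreconnected ({1} : Set ℝ) := isPreconnected_singleton
  have sp : IsPreconnected ({p} : Set ℝ) := isPreconnected_singleton
  have sq : IsPreconnected ({q} : Set ℝ) := isPreconnected_singleton
  refine IsPreconnected.union (q, 0) ?_ ?_ (IsPreconnected.union (q, 1) ?_ ?_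
    (IsPreconnected.union (p, 1) ?_ ?_ (IsPreconnected.union (p, 0) ?_ ?_
      (isPreconnected_Icc.prod s0) (sp.prod isPreconnected_Icc)) (isPreconnected_Icc.prod s1))
      (sq.prod isPreconnected_Icc)) (isPreconnected_Icc.prod s0) <;> simp [h1, h2, hpq]

theorem J2S_subset {p q x1 x2 : ℝ} (h1 : p ≤ x1) (h2 : x2 ≤ q) (hx : x1 ≤ x2) :
    J2S p q x1 x2 ⊆ BoxS p q := by
  rintro ⟨x, y⟩ h
  simp only [J2S, Set.mem_union, Set.mem_prod, Set.mem_Icc, Set.mem_singleton_iff] at h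
  simp only [BoxS, Set.mem_prod, Set.mem_Icc]
  rcases h with (((⟨⟨h, h'⟩, h''⟩ | ⟨h, h', h''⟩) | ⟨⟨h, h'⟩, h''⟩) | ⟨h, h', h''⟩) | ⟨⟨h, h'⟩, h''⟩ <;>
  subst_vars <;> refine ⟨⟨?_, ?_⟩, ?_, ?_⟩ <;> linarith

theorem J2S_closed {p q x1 x2 : ℝ} : IsClosed (J2S p q x1 x2) := by
  refine ((((?_ : IsClosed _).union ?_).union ?_).union ?_).union ?_ <;>
  apply IsClosed.prod <;> first | exact isClosed_Icc | exact isClosed_singleton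

theorem lemmaJ (k : C(ℝ × ℝ, ℝ)) {p q x1 x2 : ℝ} (h1 : p ≤ x1) (h12 : x1 ≤ x2) (h2 : x2 ≤ q)
    (k1 : k (x1, 0) < 0) (k2 : 0 < k (x2, 0)) :
    ∃ K ⊆ BoxS p q, IsCompact K ∧ IsPreconnected K ∧ (∀ z ∈ K, k z = 0) ∧
      (∃ x ∈ Set.Icc x1 x2, (x, 0) ∈ K) ∧ (K ∩ J2S p q x1 x2).Nonempty := by
  by_contra hcon
  have hBc : IsCompact (BoxS p q) := isCompact_Icc.prod isCompact_Icc
  let Z : Set (ℝ × ℝ) := BoxS p q ∩ {z | k z = 0}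
  have hZ : IsCompact Z := hBc.inter_right (isClosed_eq k.continuous continuous_const)
  let J1 : Set (ℝ × ℝ) := Set.Icc x1 x2 ×ˢ {0}
  have hJ1c : IsClosed J1 := isClosed_Icc.prod isClosed_singleton
  have hJ1p : IsPreconnected J1 := isPreconnected_Icc.prod isPreconnected_singleton
  obtain ⟨A, B, hA, hB, hAB, hZAB, hZA, hZB⟩ := compact_sep Z J1 (J2S p q x1 x2) hZ hJ1c J2S_closed (by
    rintro K hK hKc hKp ⟨⟨x, y⟩, hz, hx, hy⟩ hb
    refine hcon ⟨K, fun z hz => (hK hz).1, hKc, hKp, fun z hz => (hK hz).2, ⟨x, hx, ?_⟩, hb⟩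
    simp only [Set.mem_singleton_iff] at hy
    rwa [hy] at hz)
  obtain ⟨φ, φA, φB, -⟩ := exists_continuous_zero_one_of_isClosed hA hB hAB
  let c : C(ℝ × ℝ, ℝ × ℝ) := ⟨fun z => (max p (min q z.1), max 0 (min 1 z.2)), by fun_prop⟩
  have hpq : p ≤ q := by linarith
  have hcB : ∀ z, c z ∈ BoxS p q := fun z =>
    ⟨⟨le_max_left _ _, max_le hpq (min_le_left _ _)⟩, le_max_left _ _, max_le zero_le_one (min_le_left _ _)⟩
  have hcI : ∀ z ∈ BoxS p q, c z = z := by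
    rintro ⟨x, y⟩ ⟨⟨a1, a2⟩, a3, a4⟩
    simp only at a1 a2 a3 a4
    simp [c, a1, a2, a3, a4]
  let F : C(ℝ × ℝ, ℂ) := ⟨fun z => if 0 ≤ k (c z) then Complex.exp (2 * Real.pi * Complex.I * φ (c z)) else 1, by
    refine Continuous.if_le (by fun_prop) (by fun_prop) continuous_const (by fun_prop) ?_
    intro z hz
    rcases hZAB ⟨hcB z, hz.symm⟩ with h | h
    · rw [φA h]; simp
    · rw [φB h]; simp [Complex.exp_two_pi_mul_I]⟩
  have hF : ∀ z, F z = if 0 ≤ k (c z) then Complex.exp (2 * Real.pi * Complex.I * φ (c z)) else 1 :=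
    fun _ => rfl
  obtain ⟨L, hL⟩ := exists_log_plane F (by
    intro z; rw [hF]; split_ifs
    · exact Complex.exp_ne_zero _
    · exact one_ne_zero)
  have hJ1B : J1 ⊆ BoxS p q := by
    rintro ⟨x, y⟩ ⟨hx, hy⟩
    simp only [Set.mem_singleton_iff] at hy
    subst hy
    exact ⟨⟨h1.trans hx.1, hx.2.trans h2⟩, by simp, by simp⟩
  have e1 := lift_const J1 hJ1p L
    (fun z => if 0 ≤ k z then 2 * Real.pi * Complex.I * φ z else 0) (by
      refine Continuous.if_le (by fun_prop) (by fun_prop) continuous_const (by fun_prop) ?_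
      intro z hz
      rw [φA (hZA ⟨⟨hJ1B z.2, hz.symm⟩, z.2⟩)]; simp) (by
      intro z
      rw [hL, hF, hcI z (hJ1B z.2)]
      split_ifs <;> simp) ⟨(x1, 0), ⟨⟨le_rfl, h12⟩, rfl⟩⟩ ⟨(x2, 0), ⟨⟨h12, le_rfl⟩, rfl⟩⟩
  have e2 := lift_const (J2S p q x1 x2) (J2S_preconn h1 h2 hpq) L
    (fun z => if 0 ≤ k z then 2 * Real.pi * Complex.I * φ z - 2 * Real.pi * Complex.I else 0) (by
      refine Continuous.if_le (by fun_prop) (by fun_prop) continuous_const (by fun_prop) ?_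
      intro z hz
      rw [φB (hZB ⟨⟨J2S_subset h1 h2 h12 z.2, hz.symm⟩, z.2⟩)]; simp) (by
      intro z
      rw [hL, hF, hcI z (J2S_subset h1 h2 h12 z.2)]
      split_ifs
      · rw [Complex.exp_sub, Complex.exp_two_pi_mul_I, div_one]
      · simp) ⟨(x1, 0), by simp [J2S, h1]⟩ ⟨(x2, 0), by simp [J2S, h2]⟩
  simp only [k2.le, not_le.2 k1, if_true, if_false] at e1 e2
  rw [e1] at e2
  have : (2 * Real.pi * Complex.I : ℂ) = 0 := by linear_combination e2
  exact Complex.two_pi_I_ne_zero this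

end

noncomputable section

section lemC
variable {Y : Type*} [TopologicalSpace Y] [PathConnectedSpace Y]

theorem fold_preconn_avoid (C K : Set (ℝ × ℝ)) (hC : IsPreconnected C) (hK : IsClosed K)
    (hKu : ∀ z ∈ K, 0 ≤ z.2) (hKp : IsPreconnected K)
    (hd : ∀ z ∈ C, z ∉ K ∧ cj z ∉ K) {x τ s t : ℝ} (hx : (x, 0) ∈ C) (hτ : (τ, 0) ∈ C)
    (hs : (s, 0) ∈ K) (ht : (t, 0) ∈ K) : 0 ≤ (x - s) * (x - t) * (τ - s) * (τ - t) := by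
  have hfc : Continuous (fun z : ℝ × ℝ => (z.1, |z.2|)) := by fun_prop
  obtain ⟨γ, h1, h2, h3, h4, h5, h6, h7⟩ := folded_path ((fun z : ℝ × ℝ => (z.1, |z.2|)) '' C) K
    (hC.image _ hfc.continuousOn) hK (by rintro _ ⟨z, _, rfl⟩; exact abs_nonneg _) hKu
    (by
      rw [Set.disjoint_left]
      rintro _ ⟨z, hz, rfl⟩ hzK
      rcases abs_choice z.2 with h | h
      · simp only [h] at hzK; exact (hd z hz).1 hzK
      · simp only [h] at hzK; exact (hd z hz).2 hzK) (x := x) (x' := τ)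
      ⟨_, hx, by simp⟩ ⟨_, hτ, by simp⟩
  exact crossing (Set.range γ) K h7 hKp h6.isClosed hK (by rintro _ ⟨u, rfl⟩; exact h2 u) hKu
    (Set.disjoint_left.2 (by rintro _ ⟨u, rfl⟩; exact h5 u)) ⟨0, h3⟩ ⟨1, h4⟩ hs ht

theorem lemmaC (f : C(ℝ, Y)) (H : C(ℝ × ℝ, Y)) {p q s t : ℝ}
    (H0 : ∀ x ∈ Set.Icc p q, H (x, 0) = f x) (Hcj : ∀ z, H (cj z) = H z)
    (K : Set (ℝ × ℝ)) (hKB : K ⊆ BoxS p q) (hKc : IsCompact K) (hKp : IsPreconnected K)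
    (z : Y) (hz : ∀ w ∈ K, H w = z) (hs : (s, 0) ∈ K) (ht : (t, 0) ∈ K) (hst : s < t) :
    cl f s t = 1 := by
  classical
  let Kh : Set (ℝ × ℝ) := K ∪ cj ⁻¹' K
  have hKh : IsClosed Kh := hKc.isClosed.union (hKc.isClosed.preimage continuous_cj)
  let O := Khᶜ
  have hO : IsOpen O := hKh.isOpen_compl
  have hzKh : ∀ w ∈ Kh, H w = z := by
    rintro w (h | h)
    · exact hz w h
    · rw [← Hcj]; exact hz _ h
  have hps : p ≤ s := (hKB hs).1.1
  have htq : t ≤ q := (hKB ht).1.2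
  let W : Set (ℝ × ℝ) := {w | ∃ τ ∈ Set.Ioo s t, w ∈ connectedComponentIn O (τ, 0)}
  have hWO : W ⊆ O := by rintro w ⟨τ, _, h⟩; exact connectedComponentIn_subset _ _ h
  have hWop : IsOpen W := by
    have : W = ⋃ τ ∈ Set.Ioo s t, connectedComponentIn O (τ, 0) := by ext w; simp [W]
    rw [this]
    exact isOpen_biUnion fun τ _ => hO.connectedComponentIn
  have hWcomp : ∀ w ∈ W, ∀ S : Set (ℝ × ℝ), IsPreconnected S → S ⊆ O → w ∈ S → S ⊆ W := by
    rintro w ⟨τ, hτ, hw⟩ S hS hSO hwS v hv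
    refine ⟨τ, hτ, ?_⟩
    rw [connectedComponentIn_eq hw]
    exact hS.subset_connectedComponentIn hwS hSO hv
  have hfr : ∀ w ∈ frontier W, H w = z := by
    intro w hw
    by_cases hwO : w ∈ O
    · exfalso
      have h1 : w ∈ closure W := hw.1
      have h2 : (connectedComponentIn O w) ∈ nhds w :=
        hO.connectedComponentIn.mem_nhds (mem_connectedComponentIn hwO)
      obtain ⟨v, hv, hvW⟩ := mem_closure_iff_nhds.1 h1 _ h2
      have := hWcomp v hvW _ isPreconnected_connectedComponentIn (connectedComponentIn_subset _ _) hv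
        (mem_connectedComponentIn hwO)
      rw [hWop.frontier_eq] at hw
      exact hw.2 this
    · exact hzKh w (not_not.1 hwO)
  let H' : C(ℝ × ℝ, Y) := ⟨fun w => if w ∈ W then H w else z,
    Continuous.if hfr H.continuous continuous_const⟩
  have hH' : ∀ w, H' w = if w ∈ W then H w else z := fun _ => rfl
  have hWx : ∀ x, (x, (0:ℝ)) ∈ W → x ∈ Set.Ioo s t := by
    rintro x hx
    have hxO := hWO hx
    obtain ⟨τ, hτ, hx⟩ := hx
    have hτ' : (τ, (0:ℝ)) ∈ connectedComponentIn O (τ, 0) := by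
      apply mem_connectedComponentIn
      by_contra h
      rw [connectedComponentIn_eq_empty h] at hx; exact hx
    have := fold_preconn_avoid (connectedComponentIn O (τ, 0)) K isPreconnected_connectedComponentIn
      hKc.isClosed (fun w hw => (hKB hw).2.1) hKp (fun w hw => by
        have := connectedComponentIn_subset _ _ hw
        exact ⟨fun h => this (Or.inl h), fun h => this (Or.inr h)⟩) hx hτ' hs ht
    have h1 : x ≠ s := by rintro rfl; exact hxO (Or.inl hs)
    have h2 : x ≠ t := by rintro rfl; exact hxO (Or.inl ht)
    have h3 : (τ - s) * (τ - t) < 0 := mul_neg_of_pos_of_neg (by linarith [hτ.1]) (by linarith [hτ.2])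
    have h4 : (x - s) * (x - t) ≤ 0 := by
      by_contra h; push Not at h
      have := mul_neg_of_pos_of_neg h h3
      linarith
    rcases lt_or_gt_of_ne h1 with h | h
    · exfalso; have := mul_pos_of_neg_of_neg (a := x - s) (b := x - t) (by linarith) (by linarith); linarith
    · rcases lt_or_gt_of_ne h2 with h' | h'
      · exact ⟨h, h'⟩
      · exfalso; have := mul_pos (a := x - s) (b := x - t) (by linarith) (by linarith); linarith
  let Q : Set (ℝ × ℝ) := ({w | w.1 ≤ p - 1} ∪ {w | 2 ≤ w.2}) ∪ {w | q + 1 ≤ w.1}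
  have hQp : IsPreconnected Q := by
    have c1 : Convex ℝ {w : ℝ × ℝ | w.1 ≤ p - 1} := convex_halfSpace_le (f := Prod.fst) ⟨fun _ _ => rfl, fun _ _ => rfl⟩ _
    have c2 : Convex ℝ {w : ℝ × ℝ | 2 ≤ w.2} := convex_halfSpace_ge (f := Prod.snd) ⟨fun _ _ => rfl, fun _ _ => rfl⟩ _
    have c3 : Convex ℝ {w : ℝ × ℝ | q + 1 ≤ w.1} := convex_halfSpace_ge (f := Prod.fst) ⟨fun _ _ => rfl, fun _ _ => rfl⟩ _
    refine IsPreconnected.union (q + 1, 2) ?_ ?_ (IsPreconnected.union (p - 1, 2) ?_ ?_ c1.isPreconnected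
      c2.isPreconnected) c3.isPreconnected <;> simp
  have hQO : Q ⊆ O := by
    intro w hw hK
    have : p ≤ w.1 ∧ w.1 ≤ q ∧ w.2 ≤ 1 := by
      rcases hK with h | h
      · exact ⟨(hKB h).1.1, (hKB h).1.2, (hKB h).2.2⟩
      · have h1 := (hKB h).1.1
        have h2 := (hKB h).1.2
        have h3 := (hKB h).2.1
        simp only [cj] at h1 h2 h3
        exact ⟨h1, h2, by linarith⟩
    rcases hw with (h | h) | h <;> simp only [Set.mem_ofPred_eq] at h <;> linarith
  have hQW : ∀ w ∈ Q, w ∉ W := by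
    intro w hw hwW
    have h1 := hWcomp w hwW Q hQp hQO hw (show (p - 1, (0:ℝ)) ∈ Q from Or.inl (Or.inl (by simp)))
    have := (hWx _ h1).1
    linarith
  let f' : C(ℝ, Y) := ⟨fun x => f (max s (min t x)), by fun_prop⟩
  have hf' : ∀ x, f' x = f (max s (min t x)) := fun _ => rfl
  have hfs : f s = z := by rw [← H0 s ⟨hps, by linarith⟩]; exact hz _ hs
  have hft : f t = z := by rw [← H0 t ⟨by linarith, htq⟩]; exact hz _ ht
  have fl : ∀ x ≤ s, f' x = z := by
    intro x hx
    rw [hf', min_eq_right (by linarith), max_eq_left hx, hfs]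
  have fr : ∀ x ≥ t, f' x = z := by
    intro x hx
    rw [hf', min_eq_left hx, max_eq_right hst.le, hft]
  have fm : ∀ x ∈ Set.Icc s t, f' x = f x := by
    intro x hx
    rw [hf', min_eq_right hx.2, max_eq_right hx.1]
  have key := cl_eq_one_of_box f' H' (p - 1) (q + 1) 2 z (by linarith) (by norm_num) (by
      intro x hx
      rw [hH']
      split_ifs with h
      · have := hWx x h
        rw [fm x ⟨this.1.le, this.2.le⟩, H0 x ⟨by linarith [this.1], by linarith [this.2]⟩]
      · rcases le_or_gt x s with h1 | h1
        · rw [fl x h1]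
        rcases le_or_gt t x with h2 | h2
        · rw [fr x h2]
        rw [fm x ⟨h1.le, h2.le⟩, ← H0 x ⟨by linarith, by linarith⟩]
        refine (hzKh _ ?_).symm
        by_contra hn
        exact h ⟨x, ⟨h1, h2⟩, mem_connectedComponentIn hn⟩)
    (fun y _ => by rw [hH', if_neg (hQW _ (Or.inl (Or.inl (by simp))))])
    (fun y _ => by rw [hH', if_neg (hQW _ (Or.inr (by simp)))])
    (fun x _ => by rw [hH', if_neg (hQW _ (Or.inl (Or.inr (by simp))))])
  rw [← cl_mul f' (p - 1) s, ← cl_mul f' s t, cl_const f' (p-1) s, cl_const f' t, mul_one, one_mul] at key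
  · rw [← key]
    refine (cl_congr _ _ _ _ ?_).symm
    rw [Set.uIcc_of_le hst.le]; exact fm
  · rw [Set.uIcc_of_le (by linarith)]
    intro x hx
    rw [fr x hx.1, fr t le_rfl]
  · rw [Set.uIcc_of_le (by linarith)]
    intro x hx
    rw [fl x hx.2, fl _ (by linarith)]

end lemC

theorem monotoneOn_continuousOn {g : ℝ → ℝ} {p c u v : ℝ} (hm : MonotoneOn g (Set.Icc p c))
    (him : g '' Set.Icc p c = Set.Icc u v) : ContinuousOn g (Set.Icc p c) := by
  let h : Set.Icc p c → Set.Icc u v := fun x => ⟨g x, him ▸ ⟨x, x.2, rfl⟩⟩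
  have h1 : Monotone h := fun x y hxy => hm x.2 y.2 hxy
  have h2 : Function.Surjective h := by
    rintro ⟨y, hy⟩
    rw [← him] at hy
    obtain ⟨x, hx, rfl⟩ := hy
    exact ⟨⟨x, hx⟩, rfl⟩
  have := h1.continuous_of_surjective h2
  rw [continuousOn_iff_continuous_domRestrict]
  exact continuous_subtype_val.comp this

theorem antitoneOn_continuousOn {g : ℝ → ℝ} {p c u v : ℝ} (hm : AntitoneOn g (Set.Icc p c))
    (him : g '' Set.Icc p c = Set.Icc u v) : ContinuousOn g (Set.Icc p c) := by
  have : ContinuousOn (fun x => - g x) (Set.Icc p c) := by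
    refine monotoneOn_continuousOn (u := -v) (v := -u) (fun x hx y hy hxy => neg_le_neg (hm hx hy hxy)) ?_
    have : (fun x => - g x) '' Set.Icc p c = Neg.neg '' (g '' Set.Icc p c) := by
      rw [Set.image_image]
    rw [this, him]; simp
  exact this.neg.congr (fun x _ => by simp)

/-- the order-theoretic part: a strictly antitone relation with dense domain and range. -/
theorem anti_relation (E : ℝ → ℝ → Prop) {p c q : ℝ} (hpc : p ≤ c) (hcq : c ≤ q)
    (hx : ∀ x y, E x y → x ∈ Set.Icc p c) (hy : ∀ x y, E x y → y ∈ Set.Icc c q)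
    (h1 : ∀ x y x' y', E x y → E x' y' → x < x' → y' < y)
    (h2 : ∀ x y x' y', E x y → E x' y' → y < y' → x' < x)
    (hpq : E p q) (hcc : E c c)
    (d1 : ∀ x1 x2, p ≤ x1 → x1 < x2 → x2 ≤ c → ∃ x ∈ Set.Icc x1 x2, ∃ y, E x y)
    (d2 : ∀ y1 y2, c ≤ y1 → y1 < y2 → y2 ≤ q → ∃ y ∈ Set.Icc y1 y2, ∃ x, E x y) :
    ∃ g : ℝ → ℝ, StrictAntiOn g (Set.Icc p c) ∧ g '' Set.Icc p c = Set.Icc c q ∧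
      (∀ x y, E x y → g x = y) := by
  let g : ℝ → ℝ := fun x => sInf {y | ∃ x' ≤ x, E x' y}
  have hbdd : ∀ x, BddBelow {y | ∃ x' ≤ x, E x' y} := fun x => ⟨c, by
    rintro y ⟨x', _, h⟩; exact (hy _ _ h).1⟩
  have hE1 : ∀ x y y', E x y → E x y' → y = y' := by
    intro x y y' h h'
    rcases lt_trichotomy y y' with l | l | l
    · exact absurd (h2 _ _ _ _ h h' l) (lt_irrefl _)
    · exact l
    · exact absurd (h2 _ _ _ _ h' h l) (lt_irrefl _)
  have hgE : ∀ x y, E x y → g x = y := by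
    intro x y h
    refine le_antisymm (csInf_le (hbdd x) ⟨x, le_rfl, h⟩) (le_csInf ⟨y, x, le_rfl, h⟩ ?_)
    rintro y' ⟨x', hx', h'⟩
    rcases hx'.eq_or_lt with rfl | l
    · exact (hE1 _ _ _ h h').le
    · exact (h1 _ _ _ _ h' h l).le
  have hanti : ∀ x x', p ≤ x → x ≤ x' → g x' ≤ g x := by
    intro x x' hpx hxx
    refine csInf_le_csInf (hbdd _) ⟨q, p, hpx, hpq⟩ ?_
    rintro y ⟨u, hu, h⟩
    exact ⟨u, hu.trans hxx, h⟩
  have hmem : ∀ x ∈ Set.Icc p c, g x ∈ Set.Icc c q := by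
    intro x hx'
    constructor
    · rw [← hgE _ _ hcc]; exact hanti _ _ hx'.1 hx'.2
    · rw [← hgE _ _ hpq]; exact hanti _ _ le_rfl hx'.1
  refine ⟨g, ?_, ?_, hgE⟩
  · intro x hx' x' hx'' hlt
    obtain ⟨u, hu, y, huy⟩ := d1 x (x + (x' - x) / 3) hx'.1 (by linarith) (by linarith [hx''.2])
    obtain ⟨v, hv, y', hvy⟩ := d1 (x + 2 * (x' - x) / 3) x' (by linarith [hx'.1]) (by linarith) hx''.2
    have := h1 _ _ _ _ huy hvy (by linarith [hu.2, hv.1])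
    have a1 := hanti x u hx'.1 hu.1
    have a2 := hanti v x' (hx _ _ hvy).1 hv.2
    rw [hgE _ _ huy] at a1
    rw [hgE _ _ hvy] at a2
    linarith
  · apply Set.Subset.antisymm
    · rintro _ ⟨x, hx', rfl⟩; exact hmem x hx'
    · intro y hy'
      let S : Set ℝ := {x | ∃ y' ≥ y, E x y'}
      have hS1 : p ∈ S := ⟨q, hy'.2, hpq⟩
      have hS2 : BddAbove S := ⟨c, by rintro x ⟨y', _, h⟩; exact (hx _ _ h).2⟩
      have hxm : sSup S ∈ Set.Icc p c := ⟨le_csSup hS2 hS1, csSup_le ⟨p, hS1⟩ (by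
        rintro x ⟨y', _, h⟩; exact (hx _ _ h).2)⟩
      refine ⟨sSup S, hxm, ?_⟩
      have hgm := hmem _ hxm
      rcases lt_trichotomy (g (sSup S)) y with l | l | l
      · exfalso
        obtain ⟨v, hv, u, huv⟩ := d2 (g (sSup S) + (y - g (sSup S)) / 3) (g (sSup S) + 2 * (y - g (sSup S)) / 3)
          (by linarith [hgm.1]) (by linarith) (by linarith [hy'.2])
        have : sSup S ≤ u := by
          apply csSup_le ⟨p, hS1⟩
          rintro x ⟨y', hyy, h⟩
          exact (h2 _ _ _ _ huv h (by linarith [hv.2])).le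
        have := hanti _ _ hxm.1 this
        rw [hgE _ _ huv] at this
        linarith [hv.1]
      · exact l
      · exfalso
        obtain ⟨v, hv, u, huv⟩ := d2 (y + (g (sSup S) - y) / 3) (y + 2 * (g (sSup S) - y) / 3)
          (by linarith [hy'.1]) (by linarith) (by linarith [hgm.2])
        have : u ≤ sSup S := le_csSup hS2 ⟨v, by linarith [hv.1], huv⟩
        have := hanti _ _ (hx _ _ huv).1 this
        rw [hgE _ _ huv] at this
        linarith [hv.2]

end

noncomputable section

section
variable {Y : Type*} [TopologicalSpace Y]

/-- Connected compact subset of the box on which `H` is constant -/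
def Good (H : C(ℝ × ℝ, Y)) (p q : ℝ) (K : Set (ℝ × ℝ)) : Prop :=
  K ⊆ BoxS p q ∧ IsCompact K ∧ IsPreconnected K ∧ ∃ z, ∀ w ∈ K, H w = z

theorem Good.union {H : C(ℝ × ℝ, Y)} {p q : ℝ} {K K' : Set (ℝ × ℝ)} (h : Good H p q K)
    (h' : Good H p q K') (hn : (K ∩ K').Nonempty) : Good H p q (K ∪ K') := by
  obtain ⟨h1, h2, h3, z, h4⟩ := h
  obtain ⟨h1', h2', h3', z', h4'⟩ := h'
  obtain ⟨w, hw, hw'⟩ := hn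
  refine ⟨Set.union_subset h1 h1', h2.union h2', h3.union w hw hw' h3', z, ?_⟩
  rintro v (hv | hv)
  · exact h4 v hv
  · rw [h4' v hv, ← h4' w hw', h4 w hw]

variable [PathConnectedSpace Y]

theorem Good.red {f : C(ℝ, Y)} {H : C(ℝ × ℝ, Y)} {p q : ℝ} {K : Set (ℝ × ℝ)}
    (H0 : ∀ x ∈ Set.Icc p q, H (x, 0) = f x) (Hcj : ∀ z, H (cj z) = H z) (hK : Good H p q K)
    {u v s t : ℝ} (hr : Red f u v) (hs : (s, 0) ∈ K) (ht : (t, 0) ∈ K) (hst : s < t) (hus : u ≤ s)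
    (htv : t ≤ v) : False := by
  obtain ⟨h1, h2, h3, z, h4⟩ := hK
  refine hr s t hus hst htv ?_ (lemmaC f H H0 Hcj K h1 h2 h3 z h4 hs ht hst)
  rw [← H0 s (h1 hs).1, ← H0 t (h1 ht).1, h4 _ hs, h4 _ ht]

theorem Red.exists_ne {f : C(ℝ, Y)} {u v x1 x2 : ℝ} (hr : Red f u v) (h1 : u ≤ x1) (h12 : x1 < x2)
    (h2 : x2 ≤ v) : ∃ x3 ∈ Set.Ioc x1 x2, f x3 ≠ f x1 := by
  by_contra hcon
  push Not at hcon
  have hc : ∀ x ∈ Set.Icc x1 x2, f x = f x1 := by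
    intro x hx
    rcases hx.1.eq_or_lt with rfl | h
    · rfl
    · exact hcon x ⟨h, hx.2⟩
  refine hr x1 x2 h1 h12 h2 (hc x2 ⟨h12.le, le_rfl⟩).symm (cl_const f _ _ ?_)
  rwa [Set.uIcc_of_le h12.le]

end

/-- The folding theorem: a null-homotopic loop in a planar set with empty interior that consists of
two reduced halves is of the form `γ γ⁻¹`. -/
theorem fold_theorem (X : Set (ℝ × ℝ)) [PathConnectedSpace X] (hX : interior X = ∅) (f : C(ℝ, X))
    {p c q : ℝ} (hpc : p ≤ c) (hcq : c ≤ q) (he : f p = f q) (h1 : cl f p q = 1)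
    (r1 : Red f p c) (r2 : Red f c q) :
    ∃ g : ℝ → ℝ, StrictAntiOn g (Set.Icc p c) ∧ g '' Set.Icc p c = Set.Icc c q ∧
      ∀ x ∈ Set.Icc p c, f (g x) = f x := by
  obtain ⟨H, H0, Hs, Hcj⟩ := exists_nullhomotopy f p q (hpc.trans hcq) he h1
  have hpq := hpc.trans hcq
  have cross : ∀ K K' : Set (ℝ × ℝ), Good H p q K → Good H p q K' → Disjoint K K' →
      ∀ x x' y y', (x, 0) ∈ K → (x', 0) ∈ K → (y, 0) ∈ K' → (y', 0) ∈ K' →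
      0 ≤ (x - y) * (x - y') * (x' - y) * (x' - y') := by
    intro K K' h h' hd x x' y y' a1 a2 a3 a4
    exact crossing K K' h.2.2.1 h'.2.2.1 h.2.1.isClosed h'.2.1.isClosed (fun z hz => (h.1 hz).2.1)
      (fun z hz => (h'.1 hz).2.1) hd a1 a2 a3 a4
  let E : ℝ → ℝ → Prop := fun x y => x ∈ Set.Icc p c ∧ y ∈ Set.Icc c q ∧
    ∃ K, Good H p q K ∧ (x, 0) ∈ K ∧ (y, 0) ∈ K
  have K0 : Good H p q (J2S p q p q) := by
    refine ⟨J2S_subset le_rfl le_rfl hpq, ?_, J2S_preconn le_rfl le_rfl hpq, f p, ?_⟩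
    · exact (isCompact_Icc.prod isCompact_Icc).of_isClosed_subset J2S_closed
        (J2S_subset le_rfl le_rfl hpq)
    · rintro ⟨x, y⟩ h
      apply Hs
      simp only [J2S, Set.mem_union, Set.mem_prod, Set.mem_Icc, Set.mem_singleton_iff] at h
      rcases h with (((⟨⟨h, h'⟩, h''⟩ | ⟨h, h', h''⟩) | ⟨⟨h, h'⟩, h''⟩) | ⟨h, h', h''⟩) | ⟨⟨h, h'⟩, h''⟩
      · exact Or.inl h'
      · exact Or.inl h.le
      · exact Or.inr (Or.inr h''.ge)
      · exact Or.inr (Or.inl h.ge)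
      · exact Or.inr (Or.inl h)
  have K0p : ((p, 0) : ℝ × ℝ) ∈ J2S p q p q := by simp [J2S]
  have K0q : ((q, 0) : ℝ × ℝ) ∈ J2S p q p q := by simp [J2S]
  have hE1 : ∀ x y x' y', E x y → E x' y' → x < x' → y' < y := by
    rintro x y x' y' ⟨hx, hy, K, hK, hxK, hyK⟩ ⟨hx', hy', K', hK', hxK', hyK'⟩ hlt
    by_cases hn : (K ∩ K').Nonempty
    · exact ((hK.union hK' hn).red H0 Hcj r1 (Or.inl hxK) (Or.inr hxK') hlt hx.1 hx'.2).elim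
    · by_contra hyy
      push Not at hyy
      have hyne : y ≠ y' := by rintro rfl; exact hn ⟨_, hyK, hyK'⟩
      have hyl := lt_of_le_of_ne hyy hyne
      have hne : x' ≠ y := by rintro rfl; exact hn ⟨_, hyK, hxK'⟩
      have hl : x' < y := lt_of_le_of_ne (hx'.2.trans hy.1) hne
      have := cross K K' hK hK' (Set.not_nonempty_iff_eq_empty.1 hn |> Set.disjoint_iff_inter_eq_empty.2)
        x y x' y' hxK hyK hxK' hyK'
      have a1 : 0 < (x - x') * (x - y') := mul_pos_of_neg_of_neg (by linarith) (by linarith)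
      have a2 : (x - x') * (x - y') * (y - x') * (y - y') < 0 :=
        mul_neg_of_pos_of_neg (mul_pos a1 (by linarith)) (by linarith)
      linarith
  have hE2 : ∀ x y x' y', E x y → E x' y' → y < y' → x' < x := by
    rintro x y x' y' h h' hlt
    rcases lt_trichotomy x x' with l | l | l
    · exact absurd (hE1 _ _ _ _ h h' l) (by linarith)
    · subst l
      obtain ⟨hx, hy, K, hK, hxK, hyK⟩ := h
      obtain ⟨hx', hy', K', hK', hxK', hyK'⟩ := h'
      exact ((hK.union hK' ⟨_, hxK, hxK'⟩).red H0 Hcj r2 (Or.inl hyK) (Or.inr hyK') hlt hy.1 hy'.2).elim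
    · exact l
  have hpq' : E p q := ⟨⟨le_rfl, hpc⟩, ⟨hcq, le_rfl⟩, _, K0, K0p, K0q⟩
  have hcc : E c c := by
    refine ⟨⟨hpc, le_rfl⟩, ⟨le_rfl, hcq⟩, {(c, 0)}, ⟨?_, isCompact_singleton, isPreconnected_singleton,
      H (c, 0), by simp⟩, rfl, rfl⟩
    simp [BoxS, hpc, hcq]
  -- key consequence of Lemma J
  have hJ : ∀ x1 x2, p ≤ x1 → x1 < x2 → x2 ≤ q → f x2 ≠ f x1 →
      ∃ K, Good H p q K ∧ ∃ x ∈ Set.Icc x1 x2, (x, 0) ∈ K ∧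
        (((p, 0) ∈ K ∧ (q, 0) ∈ K) ∨ ∃ x', (x', 0) ∈ K ∧ p ≤ x' ∧ x' ≤ q ∧ x' ≠ x ∧ (x' ≤ x1 ∨ x2 ≤ x')) := by
    intro x1 x2 a1 a12 a2 hne
    obtain ⟨h, hc, hu, hv, hS⟩ := exists_sep X hX (f x1) (f x2) (fun h => hne (Subtype.ext h.symm))
    let k : C(ℝ × ℝ, ℝ) := ⟨fun z => h (H z), by fun_prop⟩
    have hk : ∀ z, k z = h (H z) := fun _ => rfl
    obtain ⟨K, hKB, hKc, hKp, hK0, ⟨x, hx, hxK⟩, ⟨w, hwK, hwJ⟩⟩ := lemmaJ k a1 a12.le a2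
      (by rw [hk, H0 x1 ⟨a1, by linarith⟩]; exact hu) (by rw [hk, H0 x2 ⟨by linarith, a2⟩]; exact hv)
    have hsub := hS ((fun z => (H z : ℝ × ℝ)) '' K) (by rintro _ ⟨z, _, rfl⟩; exact (H z).2)
      (by rintro _ ⟨z, hz, rfl⟩; exact hK0 z hz) (hKp.image _ (by fun_prop))
    have hG : Good H p q K := ⟨hKB, hKc, hKp, H (x, 0), fun w hw =>
      Subtype.ext (hsub ⟨w, hw, rfl⟩ ⟨_, hxK, rfl⟩)⟩
    have kx := hK0 _ hxK
    have k1 : k (x1, 0) ≠ 0 := by rw [hk, H0 x1 ⟨a1, by linarith⟩]; exact hu.ne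
    have k2 : k (x2, 0) ≠ 0 := by rw [hk, H0 x2 ⟨by linarith, a2⟩]; exact hv.ne'
    have hx1 : x1 ≠ x := by rintro rfl; exact k1 kx
    have hx2 : x2 ≠ x := by rintro rfl; exact k2 kx
    have hx1' := lt_of_le_of_ne hx.1 hx1
    have hx2' := lt_of_le_of_ne hx.2 hx2.symm
    by_cases hside : w ∈ J2S p q p q
    · refine ⟨K ∪ J2S p q p q, hG.union K0 ⟨w, hwK, hside⟩, x, hx, Or.inl hxK, Or.inl ⟨Or.inr K0p, Or.inr K0q⟩⟩
    · refine ⟨K, hG, x, hx, hxK, Or.inr ?_⟩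
      obtain ⟨w1, w2⟩ := w
      simp only [J2S, Set.mem_union, Set.mem_prod, Set.mem_Icc, Set.mem_singleton_iff] at hwJ hside
      push Not at hside
      have : w2 = 0 ∧ p ≤ w1 ∧ w1 ≤ q ∧ (w1 ≤ x1 ∨ x2 ≤ w1) := by
        rcases hwJ with (((⟨⟨h, h'⟩, h''⟩ | ⟨h, h', h''⟩) | ⟨⟨h, h'⟩, h''⟩) | ⟨h, h', h''⟩) | ⟨⟨h, h'⟩, h''⟩
        · exact ⟨h'', h, by linarith, Or.inl h'⟩
        · exact absurd h'' (by have := hside.1.1.1.2 h h'; linarith)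
        · exact absurd h'' (hside.1.1.2 ⟨h, h'⟩)
        · exact absurd h'' (by have := hside.1.2 h h'; linarith)
        · exact ⟨h'', by linarith, h', Or.inr h⟩
      obtain ⟨rfl, b1, b2, b3⟩ := this
      exact ⟨w1, hwK, b1, b2, by rcases b3 with b | b <;> [exact (by linarith : w1 < x).ne; exact (by linarith : x < w1).ne'], b3⟩
  have d1 : ∀ x1 x2, p ≤ x1 → x1 < x2 → x2 ≤ c → ∃ x ∈ Set.Icc x1 x2, ∃ y, E x y := by
    intro x1 x2 a1 a12 a2
    obtain ⟨x3, hx3, hne⟩ := r1.exists_ne a1 a12 a2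
    obtain ⟨K, hK, x, hx, hxK, h⟩ := hJ x1 x3 a1 hx3.1 (by linarith [hx3.2]) hne
    have hxc : x ≤ c := by linarith [hx.2, hx3.2]
    have hpx : p ≤ x := by linarith [hx.1]
    refine ⟨x, ⟨hx.1, hx.2.trans hx3.2⟩, ?_⟩
    rcases h with ⟨_, h⟩ | ⟨x', hx'K, b1, b2, bne, b3⟩
    · exact ⟨q, ⟨hpx, hxc⟩, ⟨hcq, le_rfl⟩, K, hK, hxK, h⟩
    · rcases le_or_gt c x' with l | l
      · exact ⟨x', ⟨hpx, hxc⟩, ⟨l, b2⟩, K, hK, hxK, hx'K⟩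
      · exfalso
        rcases lt_or_gt_of_ne bne with l' | l'
        · exact hK.red H0 Hcj r1 hx'K hxK l' b1 hxc
        · exact hK.red H0 Hcj r1 hxK hx'K l' hpx l.le
  have d2 : ∀ y1 y2, c ≤ y1 → y1 < y2 → y2 ≤ q → ∃ y ∈ Set.Icc y1 y2, ∃ x, E x y := by
    intro x1 x2 a1 a12 a2
    obtain ⟨x3, hx3, hne⟩ := r2.exists_ne a1 a12 a2
    obtain ⟨K, hK, x, hx, hxK, h⟩ := hJ x1 x3 (by linarith) hx3.1 (by linarith [hx3.2]) hne
    have hcx : c ≤ x := by linarith [hx.1]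
    have hxq : x ≤ q := by linarith [hx.2, hx3.2]
    refine ⟨x, ⟨hx.1, hx.2.trans hx3.2⟩, ?_⟩
    rcases h with ⟨h, _⟩ | ⟨x', hx'K, b1, b2, bne, b3⟩
    · exact ⟨p, ⟨le_rfl, hpc⟩, ⟨hcx, hxq⟩, K, hK, h, hxK⟩
    · rcases le_or_gt x' c with l | l
      · exact ⟨x', ⟨b1, l⟩, ⟨hcx, hxq⟩, K, hK, hx'K, hxK⟩
      · exfalso
        rcases lt_or_gt_of_ne bne with l' | l'
        · exact hK.red H0 Hcj r2 hx'K hxK l' l.le hxq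
        · exact hK.red H0 Hcj r2 hxK hx'K l' hcx b2
  obtain ⟨g, g1, g2, g3⟩ := anti_relation E hpc hcq (fun x y h => h.1) (fun x y h => h.2.1) hE1 hE2 hpq' hcc d1 d2
  refine ⟨g, g1, g2, ?_⟩
  have gc : ContinuousOn g (Set.Icc p c) := antitoneOn_continuousOn g1.antitoneOn g2
  have hEf : ∀ x y, E x y → f x = f y := by
    rintro x y ⟨hx, hy, K, ⟨hK1, _, _, z, hz⟩, hxK, hyK⟩
    rw [← H0 x ⟨hx.1, hx.2.trans hcq⟩, ← H0 y ⟨hpc.trans hy.1, hy.2⟩, hz _ hxK, hz _ hyK]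
  have hEq : Set.EqOn (fun x => f (g x)) f {x | ∃ y, E x y} := by
    rintro x ⟨y, h⟩
    simp only
    rw [g3 x y h, hEf x y h]
  refine hEq.of_subset_closure (t := Set.Icc p c) (f.continuous.comp_continuousOn gc) f.continuous.continuousOn
    (by rintro x ⟨y, h⟩; exact h.1) ?_
  intro x hx
  rw [Metric.mem_closure_iff]
  intro ε hε
  rcases hx.2.eq_or_lt with rfl | hlt
  · exact ⟨x, ⟨x, hcc⟩, by simpa using hε⟩
  · obtain ⟨u, hu, y, hy⟩ := d1 x (min c (x + ε / 2)) hx.1 (lt_min hlt (by linarith)) (min_le_left _ _)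
    refine ⟨u, ⟨y, hy⟩, ?_⟩
    rw [Real.dist_eq, abs_sub_lt_iff]
    have := hu.2.trans (min_le_right _ _)
    constructor <;> linarith [hu.1]

end

noncomputable section

section matching
variable {Y : Type*} [TopologicalSpace Y]

/-- `f` on `[p,q]` is the reverse of `f` on `[p',q']` (up to weakly monotone reparametrisation). -/
def MatchXY (f : C(ℝ, Y)) (p q p' q' : ℝ) (X Z : ℝ → ℝ) : Prop :=
  Monotone X ∧ Antitone Z ∧ ∀ w, (X w ∈ Set.Icc p q) ∧ (Z w ∈ Set.Icc p' q') ∧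
    X w - Z w = max (p - q') (min (q - p') w) ∧ f (X w) = f (Z w)

def Match (f : C(ℝ, Y)) (p q p' q' : ℝ) : Prop := ∃ X Z, MatchXY f p q p' q' X Z

theorem Match.le {f : C(ℝ, Y)} {p q p' q' : ℝ} (h : Match f p q p' q') : p ≤ q ∧ p' ≤ q' := by
  obtain ⟨X, Z, _, _, h⟩ := h
  exact ⟨(h 0).1.1.trans (h 0).1.2, (h 0).2.1.1.trans (h 0).2.1.2⟩

theorem Match.of_param {f : C(ℝ, Y)} {p q p' q' u v : ℝ} (huv : u ≤ v) (x y : ℝ → ℝ)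
    (hx : ContinuousOn x (Set.Icc u v)) (hy : ContinuousOn y (Set.Icc u v))
    (hmx : MonotoneOn x (Set.Icc u v)) (hmy : AntitoneOn y (Set.Icc u v))
    (xu : x u = p) (xv : x v = q) (yu : y u = q') (yv : y v = p')
    (hf : ∀ t ∈ Set.Icc u v, f (x t) = f (y t)) : Match f p q p' q' := by
  have hu : u ∈ Set.Icc u v := ⟨le_rfl, huv⟩
  have hv : v ∈ Set.Icc u v := ⟨huv, le_rfl⟩
  have hpq : p ≤ q := by rw [← xu, ← xv]; exact hmx hu hv huv
  have hpq' : p' ≤ q' := by rw [← yu, ← yv]; exact hmy hu hv huv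
  have hs : ∀ c, c ∈ Set.Icc (p - q') (q - p') → ∃ t ∈ Set.Icc u v, x t - y t = c := by
    intro c hc
    have := intermediate_value_Icc huv (hx.sub hy)
    simp only [Pi.sub_apply, xu, yu, xv, yv] at this
    exact this hc
  choose! T hT hTe using hs
  let C : ℝ → ℝ := fun w => max (p - q') (min (q - p') w)
  have hC : ∀ w, C w ∈ Set.Icc (p - q') (q - p') := fun w =>
    ⟨le_max_left _ _, max_le (by linarith) (min_le_left _ _)⟩
  have hCm : Monotone C := fun w w' h => max_le_max le_rfl (min_le_min le_rfl h)
  have hTm : ∀ w w', w ≤ w' → T (C w) ≤ T (C w') := by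
    intro w w' h
    by_contra hlt
    push Not at hlt
    have a1 := hmx (hT _ (hC w')) (hT _ (hC w)) hlt.le
    have a2 := hmy (hT _ (hC w')) (hT _ (hC w)) hlt.le
    have a3 := hTe _ (hC w)
    have a4 := hTe _ (hC w')
    have a5 : C w = C w' := le_antisymm (hCm h) (by linarith)
    rw [a5] at hlt
    exact lt_irrefl _ hlt
  refine ⟨fun w => x (T (C w)), fun w => y (T (C w)), fun w w' h => hmx (hT _ (hC w)) (hT _ (hC w')) (hTm _ _ h),
    fun w w' h => hmy (hT _ (hC w)) (hT _ (hC w')) (hTm _ _ h), fun w => ?_⟩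
  have ht := hT _ (hC w)
  refine ⟨⟨?_, ?_⟩, ⟨?_, ?_⟩, hTe _ (hC w), hf _ ht⟩
  · rw [← xu]; exact hmx hu ht ht.1
  · rw [← xv]; exact hmx ht hv ht.2
  · rw [← yv]; exact hmy ht hv ht.2
  · rw [← yu]; exact hmy hu ht ht.1

theorem Match.of_anti {f : C(ℝ, Y)} {p q p' q' : ℝ} (hpq : p ≤ q) (g : ℝ → ℝ)
    (hg : AntitoneOn g (Set.Icc p q)) (him : g '' Set.Icc p q = Set.Icc p' q')
    (hf : ∀ x ∈ Set.Icc p q, f (g x) = f x) : Match f p q p' q' := by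
  have hp : p ∈ Set.Icc p q := ⟨le_rfl, hpq⟩
  have hq : q ∈ Set.Icc p q := ⟨hpq, le_rfl⟩
  have hne : p' ≤ q' := by
    have : (Set.Icc p' q').Nonempty := him ▸ ⟨_, p, hp, rfl⟩
    exact Set.nonempty_Icc.1 this
  have hgp : g p = q' := by
    have h1 : g p ∈ Set.Icc p' q' := him ▸ ⟨p, hp, rfl⟩
    have h2 : q' ∈ g '' Set.Icc p q := him ▸ ⟨hne, le_rfl⟩
    obtain ⟨x, hx, hxe⟩ := h2
    exact le_antisymm h1.2 (hxe ▸ hg hp hx hx.1)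
  have hgq : g q = p' := by
    have h1 : g q ∈ Set.Icc p' q' := him ▸ ⟨q, hq, rfl⟩
    have h2 : p' ∈ g '' Set.Icc p q := him ▸ ⟨le_rfl, hne⟩
    obtain ⟨x, hx, hxe⟩ := h2
    exact le_antisymm (hxe ▸ hg hx hq hx.2) h1.1
  exact Match.of_param hpq id g continuousOn_id (antitoneOn_continuousOn hg him)
    (fun x _ y _ h => h) hg rfl rfl hgp hgq (fun t ht => (hf t ht).symm)

theorem MatchXY.lipX {f : C(ℝ, Y)} {p q p' q' : ℝ} {X Z : ℝ → ℝ} (h : MatchXY f p q p' q' X Z)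
    (w w' : ℝ) (hw : w ≤ w') : X w' - X w ≤ w' - w ∧ Z w - Z w' ≤ w' - w := by
  obtain ⟨hm, ha, h⟩ := h
  have e1 := (h w).2.2.1
  have e2 := (h w').2.2.1
  have m1 := hm hw
  have m2 := ha hw
  have : max (p - q') (min (q - p') w') - max (p - q') (min (q - p') w) ≤ w' - w := by
    rcases max_cases (p - q') (min (q - p') w') with ⟨h1, h1'⟩ | ⟨h1, h1'⟩ <;>
    rcases max_cases (p - q') (min (q - p') w) with ⟨h2, h2'⟩ | ⟨h2, h2'⟩ <;>
    rcases min_cases (q - p') w' with ⟨h3, h3'⟩ | ⟨h3, h3'⟩ <;>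
    rcases min_cases (q - p') w with ⟨h4, h4'⟩ | ⟨h4, h4'⟩ <;> linarith
  constructor <;> linarith

theorem continuous_of_mono_lip {X : ℝ → ℝ} (hm : Monotone X) (h : ∀ w w', w ≤ w' → X w' - X w ≤ w' - w) :
    Continuous X := by
  have : LipschitzWith 1 X := by
    apply LipschitzWith.of_dist_le_mul
    intro x y
    rw [NNReal.coe_one, one_mul, Real.dist_eq, Real.dist_eq]
    rcases le_total x y with l | l
    · have := h _ _ l; have := hm l
      rw [abs_sub_comm, abs_of_nonneg (by linarith), abs_sub_comm, abs_of_nonneg (by linarith)]; linarith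
    · have := h _ _ l; have := hm l
      rw [abs_of_nonneg (by linarith), abs_of_nonneg (by linarith)]; linarith
  exact this.continuous

theorem MatchXY.contX {f : C(ℝ, Y)} {p q p' q' : ℝ} {X Z : ℝ → ℝ} (h : MatchXY f p q p' q' X Z) :
    Continuous X := continuous_of_mono_lip h.1 fun w w' hw => (h.lipX w w' hw).1

theorem MatchXY.contZ {f : C(ℝ, Y)} {p q p' q' : ℝ} {X Z : ℝ → ℝ} (h : MatchXY f p q p' q' X Z) :
    Continuous Z := by
  have : Continuous fun w => - Z w := continuous_of_mono_lip (fun w w' hw => neg_le_neg (h.2.1 hw))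
    fun w w' hw => by have := (h.lipX w w' hw).2; linarith
  have h2 : Continuous fun w => - (- Z w) := this.neg
  simp only [neg_neg] at h2
  exact h2

theorem MatchXY.ends {f : C(ℝ, Y)} {p q p' q' : ℝ} {X Z : ℝ → ℝ} (h : MatchXY f p q p' q' X Z) :
    X (p - q') = p ∧ Z (p - q') = q' ∧ X (q - p') = q ∧ Z (q - p') = p' := by
  have hle := Match.le ⟨X, Z, h⟩
  obtain ⟨_, _, h⟩ := h
  have h1 := h (p - q')
  have h2 := h (q - p')
  rw [min_eq_right (by linarith), max_eq_left le_rfl] at h1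
  rw [min_eq_left le_rfl, max_eq_right (by linarith)] at h2
  obtain ⟨⟨a1, a2⟩, ⟨a3, a4⟩, a5, _⟩ := h1
  obtain ⟨⟨b1, b2⟩, ⟨b3, b4⟩, b5, _⟩ := h2
  refine ⟨?_, ?_, ?_, ?_⟩ <;> linarith

theorem MatchXY.surj {f : C(ℝ, Y)} {p q p' q' : ℝ} {X Z : ℝ → ℝ} (h : MatchXY f p q p' q' X Z)
    {m : ℝ} (hm : m ∈ Set.Icc p q) : ∃ w ∈ Set.Icc (p - q') (q - p'), X w = m := by
  have hle := Match.le ⟨X, Z, h⟩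
  obtain ⟨e1, e2, e3, e4⟩ := h.ends
  have := intermediate_value_Icc (show p - q' ≤ q - p' by linarith) h.contX.continuousOn
  rw [e1, e3] at this
  exact this hm

theorem Match.symm {f : C(ℝ, Y)} {p q p' q' : ℝ} (h : Match f p q p' q') : Match f p' q' p q := by
  have hle := h.le
  obtain ⟨X, Z, h⟩ := h
  obtain ⟨e1, e2, e3, e4⟩ := h.ends
  refine Match.of_param (u := p' - q) (v := q' - p) (by linarith) (fun w => Z (-w)) (fun w => X (-w))
    (h.contZ.comp continuous_neg).continuousOn (h.contX.comp continuous_neg).continuousOn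
    (fun w _ w' _ hw => h.2.1 (neg_le_neg hw)) (fun w _ w' _ hw => h.1 (neg_le_neg hw)) ?_ ?_ ?_ ?_
    (fun t _ => (h.2.2 _).2.2.2.symm) <;> simpa

theorem Match.cut {f : C(ℝ, Y)} {p q p' q' : ℝ} (h : Match f p q p' q') {m : ℝ}
    (hm : m ∈ Set.Icc p q) : ∃ m' ∈ Set.Icc p' q', Match f p m m' q' ∧ Match f m q p' m' := by
  obtain ⟨X, Z, h⟩ := h
  obtain ⟨e1, e2, e3, e4⟩ := h.ends
  obtain ⟨w, hw, rfl⟩ := h.surj hm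
  refine ⟨Z w, (h.2.2 w).2.1, ?_, ?_⟩
  · exact Match.of_param hw.1 X Z h.contX.continuousOn h.contZ.continuousOn (h.1.monotoneOn _)
      (h.2.1.antitoneOn _) e1 rfl e2 rfl (fun t _ => (h.2.2 t).2.2.2)
  · exact Match.of_param hw.2 X Z h.contX.continuousOn h.contZ.continuousOn (h.1.monotoneOn _)
      (h.2.1.antitoneOn _) rfl e3 rfl e4 (fun t _ => (h.2.2 t).2.2.2)

theorem Match.push {f f' : C(ℝ, Y)} {p q p' q' : ℝ} (h : Match f p q p' q') (κ : ℝ → ℝ)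
    (hκ : Continuous κ) (hm : Monotone κ) (h1 : ∀ x ∈ Set.Icc p q, f' (κ x) = f x)
    (h2 : ∀ x ∈ Set.Icc p' q', f' (κ x) = f x) : Match f' (κ p) (κ q) (κ p') (κ q') := by
  have hle := h.le
  obtain ⟨X, Z, h⟩ := h
  obtain ⟨e1, e2, e3, e4⟩ := h.ends
  refine Match.of_param (u := p - q') (v := q - p') (by linarith) (fun w => κ (X w)) (fun w => κ (Z w))
    (hκ.comp h.contX).continuousOn (hκ.comp h.contZ).continuousOn
    (fun w _ w' _ hw => hm (h.1 hw)) (fun w _ w' _ hw => hm (h.2.1 hw)) (by simp [e1]) (by simp [e3])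
    (by simp [e2]) (by simp [e4]) ?_
  intro t _
  obtain ⟨a1, a2, _, a4⟩ := h.2.2 t
  rw [h1 _ a1, h2 _ a2, a4]

theorem Match.image {f : C(ℝ, Y)} {p q p' q' : ℝ} (h : Match f p q p' q') {x : ℝ}
    (hx : x ∈ Set.Icc p q) : ∃ y ∈ Set.Icc p' q', f x = f y := by
  obtain ⟨X, Z, h⟩ := h
  obtain ⟨w, hw, rfl⟩ := h.surj hx
  exact ⟨Z w, (h.2.2 w).2.1, (h.2.2 w).2.2.2⟩

theorem Match.ends_eq {f : C(ℝ, Y)} {p q p' q' : ℝ} (h : Match f p q p' q') :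
    f p = f q' ∧ f q = f p' := by
  obtain ⟨X, Z, h⟩ := h
  obtain ⟨e1, e2, e3, e4⟩ := h.ends
  have h1 := (h.2.2 (p - q')).2.2.2
  have h2 := (h.2.2 (q - p')).2.2.2
  rw [e1, e2] at h1; rw [e3, e4] at h2
  exact ⟨h1, h2⟩

theorem Match.cl_eq [PathConnectedSpace Y] {f : C(ℝ, Y)} {p q p' q' : ℝ} (h : Match f p q p' q') :
    cl f p q * cl f p' q' = 1 := by
  obtain ⟨X, Z, h⟩ := h
  obtain ⟨e1, e2, e3, e4⟩ := h.ends
  let F : C(ℝ, Y) := ⟨fun w => f (X w), f.continuous.comp h.contX⟩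
  have h1 := cl_reparam F f X (p - q') (q - p') h.contX.continuousOn (fun x _ => rfl)
  have h2 := cl_reparam F f Z (p - q') (q - p') h.contZ.continuousOn (fun x _ => (h.2.2 x).2.2.2)
  rw [e1, e3] at h1
  rw [e2, e4] at h2
  rw [← h1, h2, cl_mul, cl_self]

/-- nowhere constant -/
def NCst (f : C(ℝ, Y)) (a b : ℝ) : Prop :=
  ∀ x y, a ≤ x → x < y → y ≤ b → ∃ z ∈ Set.Icc x y, f z ≠ f x

theorem Match.homeo {f : C(ℝ, Y)} {p q p' q' a b : ℝ} (h : Match f p q p' q') (hn : NCst f a b)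
    (h1 : a ≤ p) (h2 : q ≤ b) (h3 : a ≤ p') (h4 : q' ≤ b) :
    ∃ g : ℝ → ℝ, StrictAntiOn g (Set.Icc p q) ∧ g '' Set.Icc p q = Set.Icc p' q' ∧
      ∀ x ∈ Set.Icc p q, f (g x) = f x := by
  have hle := h.le
  obtain ⟨X, Z, h⟩ := h
  obtain ⟨e1, e2, e3, e4⟩ := h.ends
  have hclamp : ∀ w ∈ Set.Icc (p - q') (q - p'), X w - Z w = w := by
    intro w hw
    rw [(h.2.2 w).2.2.1, min_eq_right hw.2, max_eq_right hw.1]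
  have hX : StrictMonoOn X (Set.Icc (p - q') (q - p')) := by
    intro w hw w' hw' hlt
    refine lt_of_le_of_ne (h.1 hlt.le) fun he => ?_
    have z1 := hclamp w hw
    have z2 := hclamp w' hw'
    obtain ⟨z, hz, hzn⟩ := hn (Z w') (Z w) (h3.trans (h.2.2 _).2.1.1) (by linarith)
      ((h.2.2 _).2.1.2.trans h4)
    have hivt := intermediate_value_Icc' hlt.le h.contZ.continuousOn
    obtain ⟨v, hv, rfl⟩ := hivt hz
    apply hzn
    have b1 := h.1 hv.1
    have b2 := h.1 hv.2
    rw [← (h.2.2 v).2.2.2, ← (h.2.2 w').2.2.2]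
    congr 1; linarith
  have hZ : StrictAntiOn Z (Set.Icc (p - q') (q - p')) := by
    intro w hw w' hw' hlt
    refine lt_of_le_of_ne (h.2.1 hlt.le) fun he => ?_
    have z1 := hclamp w hw
    have z2 := hclamp w' hw'
    obtain ⟨z, hz, hzn⟩ := hn (X w) (X w') (h1.trans (h.2.2 _).1.1) (by linarith)
      ((h.2.2 _).1.2.trans h2)
    have hivt := intermediate_value_Icc hlt.le h.contX.continuousOn
    obtain ⟨v, hv, rfl⟩ := hivt hz
    apply hzn
    have b1 := h.2.1 hv.1
    have b2 := h.2.1 hv.2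
    rw [(h.2.2 v).2.2.2, (h.2.2 w).2.2.2]
    congr 1; linarith
  choose! W hW hWe using fun m (hm : m ∈ Set.Icc p q) => h.surj hm
  refine ⟨fun x => Z (W x), ?_, ?_, ?_⟩
  · intro x hx x' hx' hlt
    apply hZ (hW x hx) (hW x' hx')
    rw [← hX.lt_iff_lt (hW x hx) (hW x' hx'), hWe x hx, hWe x' hx']
    exact hlt
  · apply Set.Subset.antisymm
    · rintro _ ⟨x, hx, rfl⟩; exact (h.2.2 _).2.1
    · intro y hy
      have hivt := intermediate_value_Icc' (show p - q' ≤ q - p' by linarith) h.contZ.continuousOn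
      rw [e2, e4] at hivt
      obtain ⟨w, hw, rfl⟩ := hivt hy
      refine ⟨X w, (h.2.2 w).1, ?_⟩
      simp only
      congr 1
      exact hX.injOn (hW _ (h.2.2 w).1) hw (hWe _ (h.2.2 w).1)
  · intro x hx
    simp only
    rw [← (h.2.2 _).2.2.2, hWe x hx]

theorem Match.comp3 {f : C(ℝ, Y)} {a b l1 r1 l2 r2 l3 r3 l4 r4 : ℝ} (hn : NCst f a b)
    (h12 : Match f l1 r1 l2 r2) (h23 : Match f l2 r2 l3 r3) (h34 : Match f l3 r3 l4 r4)
    (a1 : a ≤ l1) (b1 : r1 ≤ b) (a2 : a ≤ l2) (b2 : r2 ≤ b) (a3 : a ≤ l3) (b3 : r3 ≤ b)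
    (a4 : a ≤ l4) (b4 : r4 ≤ b) : Match f l1 r1 l4 r4 := by
  have hle := h12.le.1
  obtain ⟨g1, s1, i1, f1⟩ := h12.homeo hn a1 b1 a2 b2
  obtain ⟨g2, s2, i2, f2⟩ := h23.homeo hn a2 b2 a3 b3
  obtain ⟨g3, s3, i3, f3⟩ := h34.homeo hn a3 b3 a4 b4
  have m1 : ∀ x ∈ Set.Icc l1 r1, g1 x ∈ Set.Icc l2 r2 := fun x hx => i1 ▸ ⟨x, hx, rfl⟩
  have m2 : ∀ x ∈ Set.Icc l2 r2, g2 x ∈ Set.Icc l3 r3 := fun x hx => i2 ▸ ⟨x, hx, rfl⟩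
  refine Match.of_anti hle (fun x => g3 (g2 (g1 x))) ?_ ?_ ?_
  · intro x hx y hy hxy
    exact s3.antitoneOn (m2 _ (m1 _ hx)) (m2 _ (m1 _ hy)) (s2.antitoneOn (m1 _ hy) (m1 _ hx)
      (s1.antitoneOn hx hy hxy))
  · rw [← i3, ← i2, ← i1, Set.image_image, Set.image_image]
  · intro x hx
    rw [f3 _ (m2 _ (m1 _ hx)), f2 _ (m1 _ hx), f1 _ hx]

theorem Match.isCompact [T2Space Y] (f : C(ℝ, Y)) (a b : ℝ) :
    IsCompact {v : ℝ × ℝ × ℝ × ℝ | (v.1 ∈ Set.Icc a b ∧ v.2.1 ∈ Set.Icc a b ∧ v.2.2.1 ∈ Set.Icc a b ∧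
      v.2.2.2 ∈ Set.Icc a b) ∧ Match f v.1 v.2.1 v.2.2.1 v.2.2.2} := by
  let Ω := (ℝ × ℝ × ℝ × ℝ) × (ℝ → ℝ) × (ℝ → ℝ)
  let big : Set Ω := (Set.Icc a b ×ˢ Set.Icc a b ×ˢ Set.Icc a b ×ˢ Set.Icc a b) ×ˢ
    (Set.univ.pi fun _ => Set.Icc a b) ×ˢ (Set.univ.pi fun _ => Set.Icc a b)
  have hbig : IsCompact big := by
    have hp : IsCompact (Set.univ.pi fun _ : ℝ => Set.Icc a b) := isCompact_univ_pi fun _ => isCompact_Icc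
    exact (isCompact_Icc.prod (isCompact_Icc.prod (isCompact_Icc.prod isCompact_Icc))).prod (hp.prod hp)
  let S : Set Ω := {o | MatchXY f o.1.1 o.1.2.1 o.1.2.2.1 o.1.2.2.2 o.2.1 o.2.2}
  have hS : IsClosed S := by
    have e : S = (⋂ (w : ℝ) (w' : ℝ) (_ : w ≤ w'), {o : Ω | o.2.1 w ≤ o.2.1 w'}) ∩
      ((⋂ (w : ℝ) (w' : ℝ) (_ : w ≤ w'), {o : Ω | o.2.2 w' ≤ o.2.2 w}) ∩ ⋂ w : ℝ,
        (({o : Ω | o.1.1 ≤ o.2.1 w} ∩ {o : Ω | o.2.1 w ≤ o.1.2.1}) ∩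
        (({o : Ω | o.1.2.2.1 ≤ o.2.2 w} ∩ {o : Ω | o.2.2 w ≤ o.1.2.2.2}) ∩
        ({o : Ω | o.2.1 w - o.2.2 w = max (o.1.1 - o.1.2.2.2) (min (o.1.2.1 - o.1.2.2.1) w)} ∩
         {o : Ω | f (o.2.1 w) = f (o.2.2 w)})))) := by
      ext o
      simp only [S, MatchXY, Monotone, Antitone, Set.mem_inter_iff, Set.mem_iInter, Set.mem_ofPred_eq,
        Set.mem_Icc]
    rw [e]
    have c1 : ∀ w, Continuous fun o : Ω => o.2.1 w := fun w =>
      (continuous_apply w).comp (continuous_fst.comp continuous_snd)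
    have c2 : ∀ w, Continuous fun o : Ω => o.2.2 w := fun w =>
      (continuous_apply w).comp (continuous_snd.comp continuous_snd)
    refine IsClosed.inter ?_ (IsClosed.inter ?_ ?_)
    · exact isClosed_iInter fun w => isClosed_iInter fun w' => isClosed_iInter fun _ => isClosed_le (c1 w) (c1 w')
    · exact isClosed_iInter fun w => isClosed_iInter fun w' => isClosed_iInter fun _ => isClosed_le (c2 w') (c2 w)
    · refine isClosed_iInter fun w => ?_
      refine ((isClosed_le ?_ (c1 w)).inter (isClosed_le (c1 w) ?_)).inter
        (((isClosed_le ?_ (c2 w)).inter (isClosed_le (c2 w) ?_)).inter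
        ((isClosed_eq ((c1 w).sub (c2 w)) ?_).inter (isClosed_eq (f.continuous.comp (c1 w)) (f.continuous.comp (c2 w)))))
      all_goals fun_prop
  have := (hbig.inter_right hS).image (continuous_fst : Continuous (Prod.fst : Ω → _))
  convert this using 1
  ext ⟨p, q, p', q'⟩
  constructor
  · rintro ⟨⟨h1, h2, h3, h4⟩, X, Z, h⟩
    simp only at h1 h2 h3 h4 h
    refine ⟨((p, q, p', q'), X, Z), ⟨⟨⟨h1, h2, h3, h4⟩, ?_, ?_⟩, h⟩, rfl⟩
    · intro w _; exact ⟨h1.1.trans (h.2.2 w).1.1, (h.2.2 w).1.2.trans h2.2⟩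
    · intro w _; exact ⟨h3.1.trans (h.2.2 w).2.1.1, (h.2.2 w).2.1.2.trans h4.2⟩
  · rintro ⟨⟨v, X, Z⟩, ⟨⟨⟨h1, h2, h3, h4⟩, -⟩, h⟩, rfl⟩
    exact ⟨⟨h1, h2, h3, h4⟩, X, Z, h⟩

end matching
end

noncomputable section

section parts

/-- A finite family of nonoverlapping intervals covering `[a,b]` up to the hole `(p,q)`. -/
structure IPart {K : Type} (a b p q : ℝ) (B : Set ℝ) (l r : K → ℝ) : Prop where
  ha : ∀ k, a ≤ l k
  hle : ∀ k, l k ≤ r k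
  hb : ∀ k, r k ≤ b
  dis : ∀ k m, k ≠ m → l k = r k ∨ l m = r m ∨ r k ≤ l m ∨ r m ≤ l k
  hole : ∀ k, l k = r k ∨ r k ≤ p ∨ q ≤ l k
  cov : ∀ x, a ≤ x → x ≤ b → (p ≤ x ∧ x ≤ q) ∨ ∃ k, l k ≤ x ∧ x ≤ r k
  bps : ∀ x ∈ B, ∀ k, l k = r k ∨ r k ≤ x ∨ x ≤ l k

variable {K : Type} {a b p q : ℝ} {B : Set ℝ} {l r : K → ℝ}

theorem cover_left [Finite K] {u p : ℝ} (hup : u < p)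
    (h : ∀ x, u < x → x < p → ∃ k : K, l k ≤ x ∧ x ≤ r k) : ∃ k, l k < p ∧ p ≤ r k := by
  by_contra hc
  push Not at hc
  have : ∃ M, u ≤ M ∧ M < p ∧ ∀ k, r k < p → r k ≤ M := by
    have := Fintype.ofFinite K
    classical
    let T : Finset ℝ := insert u ((Finset.univ.image r).filter (· < p))
    have hne : T.Nonempty := ⟨u, Finset.mem_insert_self _ _⟩
    refine ⟨T.max' hne, T.le_max' _ (Finset.mem_insert_self _ _), ?_, ?_⟩
    · rw [Finset.max'_lt_iff]
      intro y hy
      rcases Finset.mem_insert.1 hy with rfl | hy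
      · exact hup
      · exact (Finset.mem_filter.1 hy).2
    · intro k hk
      apply T.le_max'
      apply Finset.mem_insert_of_mem
      exact Finset.mem_filter.2 ⟨Finset.mem_image_of_mem _ (Finset.mem_univ _), hk⟩
  obtain ⟨M, h1, h2, h3⟩ := this
  obtain ⟨k, hk1, hk2⟩ := h ((M + p) / 2) (by linarith) (by linarith)
  have := h3 k (hc k (by linarith))
  linarith

theorem cover_right [Finite K] {u p : ℝ} (hup : p < u)
    (h : ∀ x, p < x → x < u → ∃ k : K, l k ≤ x ∧ x ≤ r k) : ∃ k, l k ≤ p ∧ p < r k := by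
  obtain ⟨k, h1, h2⟩ := cover_left (K := K) (l := fun k => - r k) (r := fun k => - l k) (u := -u) (p := -p)
    (by linarith) (fun x h1 h2 => by
      obtain ⟨k, hk1, hk2⟩ := h (-x) (by linarith) (by linarith)
      exact ⟨k, by linarith, by linarith⟩)
  exact ⟨k, by linarith, by linarith⟩

theorem IPart.full [Finite K] (h : IPart a b p p B l r) (hab : a < b) (x : ℝ) (hx : a ≤ x) (hx' : x ≤ b) :
    ∃ k, l k ≤ x ∧ x ≤ r k := by
  rcases h.cov x hx hx' with ⟨h1, h2⟩ | h1
  · have e : x = p := le_antisymm h2 h1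
    subst e
    rcases hx.eq_or_lt with e | e
    · subst e
      obtain ⟨k, h1, h2⟩ := cover_right (K := K) (l := l) (r := r) hab (fun y h1 h2 => by
        rcases h.cov y h1.le h2.le with ⟨_, h3⟩ | h3
        · exact absurd h3 (not_le.2 h1)
        · exact h3)
      exact ⟨k, h1, h2.le⟩
    · obtain ⟨k, h1, h2⟩ := cover_left (K := K) (l := l) (r := r) e (fun y h1 h2 => by
        rcases h.cov y h1.le (by linarith) with ⟨h3, _⟩ | h3
        · exact absurd h3 (not_le.2 h2)
        · exact h3)
      exact ⟨k, h1.le, h2⟩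
  · exact h1

theorem IPart.to_left [Finite K] (h : IPart a b p p B l r) (hab : a < b) : IPart a b a a B l r :=
  { h with
    hole := fun k => Or.inr (Or.inr (h.ha k))
    cov := fun x h1 h2 => Or.inr (h.full hab x h1 h2) }

theorem IPart.to_bp [Finite K] (h : IPart a b p p B l r) (hab : a < b) {c : ℝ} (hc : c ∈ B) :
    IPart a b c c B l r :=
  { h with
    hole := h.bps c hc
    cov := fun x h1 h2 => Or.inr (h.full hab x h1 h2) }

theorem IPart.monoB (h : IPart a b p q B l r) {B' : Set ℝ} (hB : B' ⊆ B) : IPart a b p q B' l r :=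
  { h with bps := fun x hx => h.bps x (hB hx) }

theorem IPart.cov_nd [Finite K] (h : IPart a b p q B l r) (hab : a < b) (x : ℝ) (hx : a ≤ x) (hx' : x ≤ b) :
    (p ≤ x ∧ x ≤ q) ∨ ∃ k, l k ≤ x ∧ x ≤ r k ∧ l k < r k := by
  by_cases hpq : p ≤ x ∧ x ≤ q
  · exact Or.inl hpq
  right
  have key : (∃ u, x < u ∧ ∀ y, x < y → y < u → (a ≤ y ∧ y ≤ b ∧ ¬ (p ≤ y ∧ y ≤ q))) ∨
     (∃ u, u < x ∧ ∀ y, u < y → y < x → (a ≤ y ∧ y ≤ b ∧ ¬ (p ≤ y ∧ y ≤ q))) := by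
    by_cases hp : p ≤ x
    · have hq : q < x := by by_contra hh; exact hpq ⟨hp, not_lt.1 hh⟩
      rcases hx.eq_or_lt with e | e
      · left
        refine ⟨b, by linarith, fun y h1 h2 => ⟨by linarith, h2.le, fun h3 => by linarith [h3.2]⟩⟩
      · right
        refine ⟨max a q, max_lt e hq, fun y h1 h2 => ?_⟩
        have := (max_lt_iff.1 h1)
        exact ⟨this.1.le, by linarith, fun h3 => by linarith [h3.2]⟩
    · push Not at hp
      rcases hx'.eq_or_lt with e | e
      · right
        refine ⟨a, by linarith, fun y h1 h2 => ⟨h1.le, by linarith, fun h3 => by linarith [h3.1]⟩⟩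
      · left
        refine ⟨min p b, lt_min hp e, fun y h1 h2 => ?_⟩
        have := (lt_min_iff.1 h2)
        exact ⟨by linarith, this.2.le, fun h3 => by linarith [h3.1]⟩
  rcases key with ⟨u, hu, hy⟩ | ⟨u, hu, hy⟩
  · obtain ⟨k, h1, h2⟩ := cover_right (K := K) (l := l) (r := r) hu (fun y h1 h2 => by
      obtain ⟨a1, a2, a3⟩ := hy y h1 h2
      exact (h.cov y a1 a2).resolve_left a3)
    exact ⟨k, h1, h2.le, by linarith⟩
  · obtain ⟨k, h1, h2⟩ := cover_left (K := K) (l := l) (r := r) hu (fun y h1 h2 => by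
      obtain ⟨a1, a2, a3⟩ := hy y h1 h2
      exact (h.cov y a1 a2).resolve_left a3)
    exact ⟨k, h1.le, h2, by linarith⟩

theorem IPart.split [Finite K] (hab : a < b) (h : IPart a b p q B l r) {m s : K} {y : ℝ} {l' r' : K → ℝ} {B' : Set ℝ}
    (hms : m ≠ s) (hs : l s = r s) (hy : l m ≤ y ∧ y ≤ r m)
    (e1 : l' m = l m) (e2 : r' m = y) (e3 : l' s = y) (e4 : r' s = r m)
    (e5 : ∀ k, k ≠ m → k ≠ s → l' k = l k) (e6 : ∀ k, k ≠ m → k ≠ s → r' k = r k)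
    (hB : ∀ x ∈ B', x ∈ B ∨ (x = y ∧ l m < y ∧ y < r m)) : IPart a b p q B' l' r' := by
  have hcase : ∀ k, k = m ∨ k = s ∨ (k ≠ m ∧ k ≠ s) := by intro k; tauto
  have A := h.ha m
  have Bm := h.hb m
  refine ⟨?_, ?_, ?_, ?_, ?_, ?_, ?_⟩
  · intro k; rcases hcase k with rfl | rfl | ⟨h1, h2⟩
    · rw [e1]; exact A
    · rw [e3]; linarith
    · rw [e5 k h1 h2]; exact h.ha k
  · intro k; rcases hcase k with rfl | rfl | ⟨h1, h2⟩
    · rw [e1, e2]; exact hy.1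
    · rw [e3, e4]; exact hy.2
    · rw [e5 k h1 h2, e6 k h1 h2]; exact h.hle k
  · intro k; rcases hcase k with rfl | rfl | ⟨h1, h2⟩
    · rw [e2]; linarith
    · rw [e4]; exact Bm
    · rw [e6 k h1 h2]; exact h.hb k
  · intro k j hkj
    rcases hcase k with rfl | rfl | ⟨h1, h2⟩ <;> rcases hcase j with rfl | rfl | ⟨h3, h4⟩
    · exact absurd rfl hkj
    · rw [e1, e2, e3, e4]; right; right; left; exact le_rfl
    · rw [e1, e2, e5 j h3 h4, e6 j h3 h4]
      rcases h.dis k j hkj with d | d | d | d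
      · left; linarith
      · right; left; exact d
      · right; right; left; linarith
      · right; right; right; exact d
    · rw [e1, e2, e3, e4]; right; right; right; exact le_rfl
    · exact absurd rfl hkj
    · rw [e3, e4, e5 j h3 h4, e6 j h3 h4]
      rcases h.dis m j (Ne.symm h3) with d | d | d | d
      · left; linarith
      · right; left; exact d
      · right; right; left; linarith
      · right; right; right; linarith
    · rw [e1, e2, e5 k h1 h2, e6 k h1 h2]
      rcases h.dis k j hkj with d | d | d | d
      · left; exact d
      · right; left; linarith
      · right; right; left; exact d
      · right; right; right; linarith
    · rw [e3, e4, e5 k h1 h2, e6 k h1 h2]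
      rcases h.dis k m h1 with d | d | d | d
      · left; exact d
      · right; left; linarith
      · right; right; left; linarith
      · right; right; right; linarith
    · rw [e5 k h1 h2, e6 k h1 h2, e5 j h3 h4, e6 j h3 h4]; exact h.dis k j hkj
  · intro k; rcases hcase k with rfl | rfl | ⟨h1, h2⟩
    · rw [e1, e2]
      rcases h.hole k with d | d | d
      · left; linarith
      · right; left; linarith
      · right; right; exact d
    · rw [e3, e4]
      rcases h.hole m with d | d | d
      · left; linarith
      · right; left; linarith
      · right; right; linarith
    · rw [e5 k h1 h2, e6 k h1 h2]; exact h.hole k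
  · intro x hx hx'
    rcases h.cov_nd hab x hx hx' with d | ⟨k, h1, h2, hnd⟩
    · exact Or.inl d
    · right
      rcases hcase k with rfl | rfl | ⟨h3, h4⟩
      · rcases le_total x y with hxy | hxy
        · exact ⟨k, by rw [e1, e2]; exact ⟨h1, hxy⟩⟩
        · exact ⟨s, by rw [e3, e4]; exact ⟨hxy, h2⟩⟩
      · linarith
      · exact ⟨k, by rw [e5 k h3 h4, e6 k h3 h4]; exact ⟨h1, h2⟩⟩
  · intro x hx k
    rcases hB x hx with hx | ⟨rfl, hx1, hx2⟩
    · rcases hcase k with rfl | rfl | ⟨h1, h2⟩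
      · rw [e1, e2]
        rcases h.bps x hx k with d | d | d
        · left; linarith
        · right; left; linarith
        · right; right; exact d
      · rw [e3, e4]
        rcases h.bps x hx m with d | d | d
        · left; linarith
        · right; left; linarith
        · right; right; linarith
      · rw [e5 k h1 h2, e6 k h1 h2]; exact h.bps x hx k
    · rcases hcase k with rfl | rfl | ⟨h1, h2⟩
      · rw [e1, e2]; right; left; exact le_rfl
      · rw [e3, e4]; right; right; exact le_rfl
      · rw [e5 k h1 h2, e6 k h1 h2]
        rcases h.dis k m h1 with d | d | d | d
        · left; exact d
        · linarith
        · right; left; linarith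
        · right; right; linarith

theorem IPart.perm (h : IPart a b p q B l r) (τ : K ≃ K) : IPart a b p q B (l ∘ τ) (r ∘ τ) where
  ha k := h.ha _
  hle k := h.hle _
  hb k := h.hb _
  dis k m hkm := h.dis _ _ (fun e => hkm (τ.injective e))
  hole k := h.hole _
  cov x hx hx' := (h.cov x hx hx').imp id (fun ⟨k, hk⟩ => ⟨τ.symm k, by simpa using hk⟩)
  bps x hx k := h.bps x hx _

theorem IPart.split2 [Finite K] (hab : a < b) (h : IPart a b p q B l r) {m s : K} {y : ℝ} {l' r' : K → ℝ} {B' : Set ℝ}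
    (hms : m ≠ s) (hs : l s = r s) (hy : l m ≤ y ∧ y ≤ r m)
    (e1 : l' m = y) (e2 : r' m = r m) (e3 : l' s = l m) (e4 : r' s = y)
    (e5 : ∀ k, k ≠ m → k ≠ s → l' k = l k) (e6 : ∀ k, k ≠ m → k ≠ s → r' k = r k)
    (hB : ∀ x ∈ B', x ∈ B ∨ (x = y ∧ l m < y ∧ y < r m)) : IPart a b p q B' l' r' := by
  classical
  have := (h.split hab (l' := l' ∘ Equiv.swap m s) (r' := r' ∘ Equiv.swap m s) hms hs hy (by simpa) (by simpa)
    (by simpa) (by simpa) (fun k h1 h2 => by simp [Equiv.swap_apply_of_ne_of_ne h1 h2, e5 k h1 h2])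
    (fun k h1 h2 => by simp [Equiv.swap_apply_of_ne_of_ne h1 h2, e6 k h1 h2]) hB).perm (Equiv.swap m s)
  have e : ∀ g : K → ℝ, (g ∘ Equiv.swap m s) ∘ Equiv.swap m s = g := by
    intro g; ext k; simp
  rwa [e, e] at this

theorem IPart.shrink (h : IPart a b p q B l r) {k m : K} {l' r' : K → ℝ} (hpq : p ≤ q)
    (hk : r k = p) (hm : l m = q) (hk' : l k < r k) (hm' : l m < r m)
    (e1 : l' k = l k) (e2 : r' k = l k) (e3 : l' m = r m) (e4 : r' m = r m)
    (e5 : ∀ j, j ≠ k → j ≠ m → l' j = l j) (e6 : ∀ j, j ≠ k → j ≠ m → r' j = r j) :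
    IPart a b (l k) (r m) B l' r' := by
  have hcase : ∀ j, j = k ∨ j = m ∨ (j ≠ k ∧ j ≠ m) := by intro k; tauto
  refine ⟨?_, ?_, ?_, ?_, ?_, ?_, ?_⟩
  · intro j; rcases hcase j with rfl | rfl | ⟨h1, h2⟩
    · rw [e1]; exact h.ha j
    · rw [e3]; linarith [h.ha j]
    · rw [e5 j h1 h2]; exact h.ha j
  · intro j; rcases hcase j with rfl | rfl | ⟨h1, h2⟩
    · rw [e1, e2]
    · rw [e3, e4]
    · rw [e5 j h1 h2, e6 j h1 h2]; exact h.hle j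
  · intro j; rcases hcase j with rfl | rfl | ⟨h1, h2⟩
    · rw [e2]; linarith [h.hb j]
    · rw [e4]; exact h.hb j
    · rw [e6 j h1 h2]; exact h.hb j
  · intro i j hij
    rcases hcase i with rfl | rfl | ⟨h1, h2⟩
    · left; rw [e1, e2]
    · left; rw [e3, e4]
    · rcases hcase j with rfl | rfl | ⟨h3, h4⟩
      · right; left; rw [e1, e2]
      · right; left; rw [e3, e4]
      · rw [e5 i h1 h2, e6 i h1 h2, e5 j h3 h4, e6 j h3 h4]; exact h.dis i j hij
  · intro j; rcases hcase j with rfl | rfl | ⟨h1, h2⟩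
    · left; rw [e1, e2]
    · left; rw [e3, e4]
    · rw [e5 j h1 h2, e6 j h1 h2]
      rcases h.hole j with d | d | d
      · left; exact d
      · rcases h.dis j k h1 with d' | d' | d' | d'
        · left; exact d'
        · linarith
        · right; left; exact d'
        · left; linarith [h.hle j]
      · rcases h.dis j m h2 with d' | d' | d' | d'
        · left; exact d'
        · linarith
        · left; linarith [h.hle j]
        · right; right; exact d'
  · intro x hx hx'
    by_cases hin : l k ≤ x ∧ x ≤ r m
    · exact Or.inl hin
    right
    rcases h.cov x hx hx' with d | ⟨j, h1, h2⟩
    · exact absurd ⟨by linarith [d.1], by linarith [d.2]⟩ hin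
    · rcases hcase j with rfl | rfl | ⟨h3, h4⟩
      · exact absurd ⟨by linarith, by linarith⟩ hin
      · exact absurd ⟨by linarith, by linarith⟩ hin
      · exact ⟨j, by rw [e5 j h3 h4, e6 j h3 h4]; exact ⟨h1, h2⟩⟩
  · intro x hx j
    rcases hcase j with rfl | rfl | ⟨h1, h2⟩
    · left; rw [e1, e2]
    · left; rw [e3, e4]
    · rw [e5 j h1 h2, e6 j h1 h2]; exact h.bps x hx j

theorem IPart.push (h : IPart a b p q B l r) {κ : ℝ → ℝ} (hm : Monotone κ) (hκ : Continuous κ) (hab : a ≤ b) :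
    IPart (κ a) (κ b) (κ p) (κ q) (κ '' B) (κ ∘ l) (κ ∘ r) where
  ha k := hm (h.ha k)
  hle k := hm (h.hle k)
  hb k := hm (h.hb k)
  dis k m hkm := by
    rcases h.dis k m hkm with d | d | d | d
    · left; simp [d]
    · right; left; simp [d]
    · right; right; left; exact hm d
    · right; right; right; exact hm d
  hole k := by
    rcases h.hole k with d | d | d
    · left; simp [d]
    · right; left; exact hm d
    · right; right; exact hm d
  cov x hx hx' := by
    obtain ⟨y, hy, rfl⟩ := intermediate_value_Icc hab hκ.continuousOn ⟨hx, hx'⟩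
    rcases h.cov y hy.1 hy.2 with d | ⟨k, d⟩
    · exact Or.inl ⟨hm d.1, hm d.2⟩
    · exact Or.inr ⟨k, hm d.1, hm d.2⟩
  bps x hx k := by
    obtain ⟨y, hy, rfl⟩ := hx
    rcases h.bps y hy k with d | d | d
    · left; simp [d]
    · right; left; exact hm d
    · right; right; exact hm d

/-- fixed-point free involution -/
class HasBar (K : Type) where
  bar : K → K
  bar_bar : ∀ k, bar (bar k) = k
  bar_ne : ∀ k, bar k ≠ k

end parts
end

noncomputable section

section pairs
open HasBar

variable {Y : Type*} [TopologicalSpace Y]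

/-- the interval is degenerate or mapped into `U` -/
def TI (f : C(ℝ, Y)) (U : Set Y) (u v : ℝ) : Prop := u = v ∨ ∀ t ∈ Set.Icc (0:ℝ) 1, f (u + t * (v - u)) ∈ U

theorem TI_iff {f : C(ℝ, Y)} {U : Set Y} {u v : ℝ} (h : u ≤ v) :
    TI f U u v ↔ u = v ∨ ∀ x, u ≤ x → x ≤ v → f x ∈ U := by
  unfold TI
  constructor
  · rintro (e | e)
    · exact Or.inl e
    · by_cases huv : u = v
      · exact Or.inl huv
      right
      intro x h1 h2
      have hlt : 0 < v - u := by have := lt_of_le_of_ne h huv; linarith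
      have := e ((x - u) / (v - u)) ⟨div_nonneg (by linarith) hlt.le, (div_le_one hlt).2 (by linarith)⟩
      rwa [div_mul_cancel₀ _ hlt.ne', add_sub_cancel] at this
  · rintro (e | e)
    · exact Or.inl e
    · right
      intro t ht
      exact e _ (by nlinarith [ht.1]) (by nlinarith [ht.2])

theorem TI.sub {f : C(ℝ, Y)} {U : Set Y} {u v u' v' : ℝ} (h : TI f U u v) (h1 : u ≤ u') (h2 : u' ≤ v')
    (h3 : v' ≤ v) : TI f U u' v' := by
  rw [TI_iff (h1.trans (h2.trans h3))] at h
  rw [TI_iff h2]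
  rcases h with h | h
  · left; linarith
  · right; intro x hx hx'; exact h x (by linarith) (by linarith)

theorem TI.of_match {f : C(ℝ, Y)} {U : Set Y} {a b u v u' v' : ℝ} (h : TI f U u v) (hM : Match f u v u' v')
    (hn : NCst f a b) (h1 : a ≤ u') (h2 : v' ≤ b) : TI f U u' v' := by
  have hle := hM.le
  rw [TI_iff hle.1] at h
  rw [TI_iff hle.2]
  rcases h with h | h
  · left
    by_contra hne
    obtain ⟨z, hz, hz'⟩ := hn u' v' h1 (lt_of_le_of_ne hle.2 hne) h2
    obtain ⟨y, hy, e⟩ := hM.symm.image hz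
    obtain ⟨y', hy', e'⟩ := hM.symm.image (x := u') ⟨le_rfl, hle.2⟩
    have : y = y' := by linarith [hy.1, hy.2, hy'.1, hy'.2]
    rw [e, e', this] at hz'
    exact hz' rfl
  · right
    intro x hx hx'
    obtain ⟨y, hy, e⟩ := hM.symm.image (x := x) ⟨hx, hx'⟩
    rw [e]; exact h y hy.1 hy.2

def prod4 (x x' y y' : ℝ) : ℝ := (x - y) * (x - y') * (x' - y) * (x' - y')

theorem prod4_swap1 (x x' y y' : ℝ) : prod4 x' x y y' = prod4 x x' y y' := by unfold prod4; ring
theorem prod4_swap2 (x x' y y' : ℝ) : prod4 x x' y' y = prod4 x x' y y' := by unfold prod4; ring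
theorem prod4_comm (x x' y y' : ℝ) : prod4 y y' x x' = prod4 x x' y y' := by unfold prod4; ring

theorem prod4_slide {x x' y y' z : ℝ} (h : 0 ≤ prod4 x x' y y') (hy : x ≠ y) (hy' : x ≠ y')
    (h1 : 0 ≤ (x - y) * (z - y)) (h2 : 0 ≤ (x - y') * (z - y')) : 0 ≤ prod4 z x' y y' := by
  unfold prod4 at *
  have hD : 0 < ((x - y) * (x - y')) ^ 2 := by
    have : (x - y) * (x - y') ≠ 0 := mul_ne_zero (sub_ne_zero.2 hy) (sub_ne_zero.2 hy')
    positivity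
  refine nonneg_of_mul_nonneg_right (a := ((x - y) * (x - y')) ^ 2) ?_ hD
  have := mul_nonneg (mul_nonneg h1 h2) h
  nlinarith [this]

variable {K : Type} [HasBar K] {a b p q : ℝ} {B : Set ℝ} {l r : K → ℝ} {f : C(ℝ, Y)} {U : Set Y}

def Tv (f : C(ℝ, Y)) (U : Set Y) (l r : K → ℝ) (k : K) : Prop :=
  TI f U (l k) (r k) ∧ TI f U (l (bar k)) (r (bar k))

theorem Tv.barr {k : K} (h : Tv f U l r k) : Tv f U l r (bar k) := by
  refine ⟨h.2, ?_⟩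
  rw [bar_bar]; exact h.1

theorem Tv.of_bar {k : K} (h : Tv f U l r (HasBar.bar k)) : Tv f U l r k := by
  have := h.barr; rwa [bar_bar] at this

structure PairOK (f : C(ℝ, Y)) (U : Set Y) (l r : K → ℝ) : Prop where
  mt : ∀ k, Tv f U l r k ∨ Match f (l k) (r k) (l (bar k)) (r (bar k))
  nc : ∀ k m, m ≠ k → m ≠ bar k → Tv f U l r k ∨ Tv f U l r m ∨
    0 ≤ prod4 (l k) (l (bar k)) (l m) (l (bar m))

theorem bar_eq_iff {k m : K} : bar k = m ↔ k = bar m :=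
  ⟨fun h => by rw [← h, bar_bar], fun h => by rw [h, bar_bar]⟩

theorem PairOK.of_rep (S : Set K) (hS : ∀ k, k ∈ S ∨ bar k ∈ S)
    (mt : ∀ k ∈ S, Tv f U l r k ∨ Match f (l k) (r k) (l (bar k)) (r (bar k)))
    (nc : ∀ k ∈ S, ∀ m ∈ S, m ≠ k → m ≠ bar k → Tv f U l r k ∨ Tv f U l r m ∨
      0 ≤ prod4 (l k) (l (bar k)) (l m) (l (bar m))) : PairOK f U l r := by
  constructor
  · intro k
    rcases hS k with h | h
    · exact mt k h
    · rcases mt _ h with h1 | h1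
      · exact Or.inl h1.of_bar
      · right; rw [bar_bar] at h1; exact h1.symm
  · have key : ∀ k ∈ S, ∀ m, m ≠ k → m ≠ bar k → Tv f U l r k ∨ Tv f U l r m ∨
      0 ≤ prod4 (l k) (l (bar k)) (l m) (l (bar m)) := by
      intro k hk m h1 h2
      rcases hS m with h | h
      · exact nc k hk m h h1 h2
      · rcases nc k hk _ h (fun e => h2 (bar_eq_iff.1 e)) (fun e => h1 (by simpa [bar_bar] using congrArg bar e)) with h3 | h3 | h3
        · exact Or.inl h3
        · exact Or.inr (Or.inl h3.of_bar)
        · rw [bar_bar, prod4_swap2] at h3; exact Or.inr (Or.inr h3)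
    intro k m h1 h2
    rcases hS k with h | h
    · exact key k h m h1 h2
    · rcases key _ h m h2 (by rwa [bar_bar]) with h3 | h3 | h3
      · exact Or.inl h3.of_bar
      · exact Or.inr (Or.inl h3)
      · rw [bar_bar, prod4_swap1] at h3; exact Or.inr (Or.inr h3)

theorem PairOK.nd (hO : PairOK f U l r) (hn : NCst f a b) (hP : IPart a b p q B l r) {k : K}
    (hk : ¬ Tv f U l r k) : l k < r k ∧ l (bar k) < r (bar k) := by
  have hM := (hO.mt k).resolve_left hk
  by_contra hc
  apply hk
  rw [not_and_or] at hc
  rcases hc with hc | hc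
  · have e : TI f U (l k) (r k) := Or.inl (le_antisymm (hP.hle k) (not_lt.1 hc))
    exact ⟨e, e.of_match hM hn (hP.ha _) (hP.hb _)⟩
  · have e : TI f U (l (HasBar.bar k)) (r (HasBar.bar k)) := Or.inl (le_antisymm (hP.hle _) (not_lt.1 hc))
    exact ⟨e.of_match hM.symm hn (hP.ha _) (hP.hb _), e⟩

theorem IPart.pos {K : Type} {a b p q : ℝ} {B : Set ℝ} {l r : K → ℝ} (hP : IPart a b p q B l r) {k m : K} (h : k ≠ m) (hk : l k < r k) (hm : l m < r m) :
    r k ≤ l m ∨ r m ≤ l k := by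
  rcases hP.dis k m h with d | d | d | d
  · exact absurd d hk.ne
  · exact absurd d hm.ne
  · exact Or.inl d
  · exact Or.inr d

theorem Tv.congr {l' r' : K → ℝ} {k : K} (h1 : l' k = l k) (h2 : r' k = r k) (h3 : l' (bar k) = l (bar k))
    (h4 : r' (bar k) = r (bar k)) : Tv f U l' r' k ↔ Tv f U l r k := by
  unfold Tv; rw [h1, h2, h3, h4]

theorem PairOK.of_one (hO : PairOK f U l r) {l' r' : K → ℝ} {k : K}
    (e : ∀ j, j ≠ k → j ≠ bar k → l' j = l j ∧ r' j = r j)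
    (mk : Tv f U l' r' k) : PairOK f U l' r' := by
  have hb : ∀ j, j ≠ k → j ≠ bar k → bar j ≠ k ∧ bar j ≠ bar k := by
    intro j h1 h2
    refine ⟨fun h => h2 (bar_eq_iff.1 h), fun h => h1 (by simpa [bar_bar] using congrArg bar h)⟩
  have hT : ∀ j, j ≠ k → j ≠ bar k → (Tv f U l' r' j ↔ Tv f U l r j) := by
    intro j h1 h2
    obtain ⟨h3, h4⟩ := hb j h1 h2
    exact Tv.congr (e j h1 h2).1 (e j h1 h2).2 (e _ h3 h4).1 (e _ h3 h4).2
  have hTk : ∀ j, j = k ∨ j = bar k → Tv f U l' r' j := by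
    rintro j (rfl | rfl)
    · exact mk
    · exact mk.barr
  constructor
  · intro j
    by_cases hj : j = k ∨ j = bar k
    · exact Or.inl (hTk j hj)
    · push Not at hj
      obtain ⟨h3, h4⟩ := hb j hj.1 hj.2
      rw [hT j hj.1 hj.2, (e j hj.1 hj.2).1, (e j hj.1 hj.2).2, (e _ h3 h4).1, (e _ h3 h4).2]
      exact hO.mt j
  · intro i j hij hij'
    by_cases hj : j = k ∨ j = bar k
    · exact Or.inr (Or.inl (hTk j hj))
    by_cases hi : i = k ∨ i = bar k
    · exact Or.inl (hTk i hi)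
    push Not at hi hj
    obtain ⟨h3, h4⟩ := hb j hj.1 hj.2
    obtain ⟨h5, h6⟩ := hb i hi.1 hi.2
    rw [hT j hj.1 hj.2, hT i hi.1 hi.2, (e j hj.1 hj.2).1, (e _ h3 h4).1, (e i hi.1 hi.2).1, (e _ h5 h6).1]
    exact hO.nc i j hij hij'

theorem PairOK.of_two (hO : PairOK f U l r) {l' r' : K → ℝ} {k s : K} (hsk : s ≠ k) (hsk' : s ≠ bar k)
    (e : ∀ j, j ≠ k → j ≠ bar k → j ≠ s → j ≠ bar s → l' j = l j ∧ r' j = r j)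
    (mk : Tv f U l' r' k ∨ Match f (l' k) (r' k) (l' (bar k)) (r' (bar k)))
    (ms : Tv f U l' r' s ∨ Match f (l' s) (r' s) (l' (bar s)) (r' (bar s)))
    (ks : Tv f U l' r' k ∨ Tv f U l' r' s ∨ 0 ≤ prod4 (l' k) (l' (bar k)) (l' s) (l' (bar s)))
    (kj : ∀ j, j ≠ k → j ≠ bar k → j ≠ s → j ≠ bar s → ¬ Tv f U l r j →
      Tv f U l' r' k ∨ 0 ≤ prod4 (l' k) (l' (bar k)) (l j) (l (bar j)))
    (sj : ∀ j, j ≠ k → j ≠ bar k → j ≠ s → j ≠ bar s → ¬ Tv f U l r j →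
      Tv f U l' r' s ∨ 0 ≤ prod4 (l' s) (l' (bar s)) (l j) (l (bar j))) : PairOK f U l' r' := by
  have hb : ∀ j k : K, j ≠ k → j ≠ bar k → bar j ≠ k ∧ bar j ≠ bar k := by
    intro j k h1 h2
    refine ⟨fun h => h2 (bar_eq_iff.1 h), fun h => h1 (by simpa [bar_bar] using congrArg bar h)⟩
  have eb : ∀ j, j ≠ k → j ≠ bar k → j ≠ s → j ≠ bar s → l' (bar j) = l (bar j) ∧ r' (bar j) = r (bar j) := by
    intro j h1 h2 h3 h4
    exact e _ (hb j k h1 h2).1 (hb j k h1 h2).2 (hb j s h3 h4).1 (hb j s h3 h4).2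
  have hT : ∀ j, j ≠ k → j ≠ bar k → j ≠ s → j ≠ bar s → (Tv f U l' r' j ↔ Tv f U l r j) := by
    intro j h1 h2 h3 h4
    exact Tv.congr (e j h1 h2 h3 h4).1 (e j h1 h2 h3 h4).2 (eb j h1 h2 h3 h4).1 (eb j h1 h2 h3 h4).2
  have kj' : ∀ j, j ≠ k → j ≠ bar k → j ≠ s → j ≠ bar s → Tv f U l' r' k ∨ Tv f U l' r' j ∨
      0 ≤ prod4 (l' k) (l' (bar k)) (l' j) (l' (bar j)) := by
    intro j h1 h2 h3 h4
    rw [hT j h1 h2 h3 h4, (e j h1 h2 h3 h4).1, (eb j h1 h2 h3 h4).1]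
    by_cases h : Tv f U l r j
    · exact Or.inr (Or.inl h)
    · rcases kj j h1 h2 h3 h4 h with h | h
      · exact Or.inl h
      · exact Or.inr (Or.inr h)
  have sj' : ∀ j, j ≠ k → j ≠ bar k → j ≠ s → j ≠ bar s → Tv f U l' r' s ∨ Tv f U l' r' j ∨
      0 ≤ prod4 (l' s) (l' (bar s)) (l' j) (l' (bar j)) := by
    intro j h1 h2 h3 h4
    rw [hT j h1 h2 h3 h4, (e j h1 h2 h3 h4).1, (eb j h1 h2 h3 h4).1]
    by_cases h : Tv f U l r j
    · exact Or.inr (Or.inl h)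
    · rcases sj j h1 h2 h3 h4 h with h | h
      · exact Or.inl h
      · exact Or.inr (Or.inr h)
  have sw : ∀ i j, (Tv f U l' r' i ∨ Tv f U l' r' j ∨ 0 ≤ prod4 (l' i) (l' (bar i)) (l' j) (l' (bar j))) →
     (Tv f U l' r' j ∨ Tv f U l' r' i ∨ 0 ≤ prod4 (l' j) (l' (bar j)) (l' i) (l' (bar i))) := by
    intro i j h
    rw [prod4_comm]; tauto
  have hcase : ∀ j, j ≠ bar k → j ≠ bar s → j = k ∨ j = s ∨ (j ≠ k ∧ j ≠ bar k ∧ j ≠ s ∧ j ≠ bar s) := by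
    intro j; tauto
  refine PairOK.of_rep {j | j ≠ bar k ∧ j ≠ bar s} ?_ ?_ ?_
  · intro j
    by_contra hc
    simp only [Set.mem_ofPred_eq, not_or, not_and_or, not_not] at hc
    rcases hc with ⟨h1 | h1, h2 | h2⟩
    · rw [h1, bar_bar] at h2; exact bar_ne k h2.symm
    · rw [h1, bar_bar] at h2; exact hsk' (bar_eq_iff.1 h2.symm)
    · rw [h1, bar_bar] at h2; exact hsk' h2
    · rw [h1, bar_bar] at h2; exact bar_ne s h2.symm
  · rintro j ⟨h1, h2⟩
    rcases hcase j h1 h2 with rfl | rfl | ⟨h1, h2, h3, h4⟩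
    · exact mk
    · exact ms
    · rw [hT j h1 h2 h3 h4, (e j h1 h2 h3 h4).1, (eb j h1 h2 h3 h4).1, (e j h1 h2 h3 h4).2, (eb j h1 h2 h3 h4).2]
      exact hO.mt j
  · rintro i ⟨g1, g2⟩ j ⟨g3, g4⟩ hij hij'
    rcases hcase i g1 g2 with rfl | rfl | ⟨h1, h2, h5, h6⟩ <;>
      rcases hcase j g3 g4 with rfl | rfl | ⟨h3, h4, h7, h8⟩
    · exact absurd rfl hij
    · exact ks
    · exact kj' j h3 h4 h7 h8
    · exact sw _ _ ks
    · exact absurd rfl hij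
    · exact sj' j h3 h4 h7 h8
    · exact sw _ _ (kj' i h1 h2 h5 h6)
    · exact sw _ _ (sj' i h1 h2 h5 h6)
    · rw [hT i h1 h2 h5 h6, (e i h1 h2 h5 h6).1, (eb i h1 h2 h5 h6).1,
        hT j h3 h4 h7 h8, (e j h3 h4 h7 h8).1, (eb j h3 h4 h7 h8).1]
      exact hO.nc i j hij hij'

end pairs
end

noncomputable section

section cutrem
open HasBar

variable {Y : Type*} [TopologicalSpace Y]
variable {K : Type} [HasBar K] {a b p q : ℝ} {B : Set ℝ} {l r : K → ℝ} {f : C(ℝ, Y)} {U : Set Y}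

theorem slide_fact {x z u v j w : ℝ} (h1 : u = x) (hz : u ≤ z ∧ z ≤ v) (huv : u < v) (hj : j < w)
    (h : v ≤ j ∨ w ≤ u) : x ≠ j ∧ 0 ≤ (x - j) * (z - j) := by
  subst h1
  rcases h with h | h
  · exact ⟨by linarith, mul_nonneg_of_nonpos_of_nonpos (by linarith) (by linarith)⟩
  · exact ⟨by intro e; linarith, mul_nonneg (by linarith) (by linarith)⟩

theorem cut_pair [Finite K] (hab : a < b) (hn : NCst f a b) (hP : IPart a b p q B l r) (hO : PairOK f U l r)
    {s k : K} {y : ℝ} (hs : l s = r s) (hs' : l (bar s) = r (bar s)) (hy1 : l k < y) (hy2 : y < r k) :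
    ∃ l' r' : K → ℝ, IPart a b p q (insert y B) l' r' ∧ PairOK f U l' r' ∧ l' k = l k ∧ r' k = y ∧
      l' s = y ∧ r' s = r k ∧
      (∀ j, j ≠ k → j ≠ bar k → j ≠ s → j ≠ bar s → l' j = l j ∧ r' j = r j) ∧
      (Tv f U l r k → l' (bar k) = l (bar k) ∧ r' (bar k) = r (bar k)) := by
  classical
  have hk : l k < r k := hy1.trans hy2
  have n1 : s ≠ k := by rintro rfl; linarith
  have n2 : bar s ≠ k := by rintro rfl; linarith
  have n3 : s ≠ bar k := fun e => n2 (by rw [e, bar_bar])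
  have n4 : bar s ≠ bar k := fun e => n1 (by simpa [bar_bar] using congrArg bar e)
  have n5 : bar k ≠ k := bar_ne k
  have n6 : bar s ≠ s := bar_ne s
  obtain ⟨z, hz, hzc⟩ : ∃ z, (l (bar k) ≤ z ∧ z ≤ r (bar k)) ∧ ((Tv f U l r k ∧ z = l (bar k)) ∨
      (¬ Tv f U l r k ∧ Match f (l k) y z (r (bar k)) ∧ Match f y (r k) (l (bar k)) z)) := by
    by_cases hT : Tv f U l r k
    · exact ⟨l (bar k), ⟨le_rfl, hP.hle _⟩, Or.inl ⟨hT, rfl⟩⟩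
    · obtain ⟨z, hz, h1, h2⟩ := ((hO.mt k).resolve_left hT).cut (m := y) ⟨hy1.le, hy2.le⟩
      exact ⟨z, hz, Or.inr ⟨hT, h1, h2⟩⟩
  let l1 := Function.update l s y
  let r1 := Function.update (Function.update r k y) s (r k)
  have P1 : IPart a b p q (insert y B) l1 r1 := by
    refine hP.split hab (m := k) (s := s) (y := y) (Ne.symm n1) hs ⟨hy1.le, hy2.le⟩ ?_ ?_ ?_ ?_ ?_ ?_ ?_
    · simp [l1, n1.symm]
    · simp [r1, n1.symm]
    · simp [l1]
    · simp [r1]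
    · intro j h1 h2; simp [l1, h2]
    · intro j h1 h2; simp [r1, h1, h2]
    · rintro x (rfl | hx)
      · exact Or.inr ⟨rfl, hy1, hy2⟩
      · exact Or.inl hx
  let l2 := Function.update (Function.update l1 (bar k) z) (bar s) (l (bar k))
  let r2 := Function.update r1 (bar s) z
  have eL : l1 (bar k) = l (bar k) := by simp [l1, n3.symm]
  have eR : r1 (bar k) = r (bar k) := by simp [r1, n3.symm, n5]
  have P2 : IPart a b p q (insert y B) l2 r2 := by
    refine P1.split2 hab (m := bar k) (s := bar s) (y := z) (Ne.symm n4) ?_ ?_ ?_ ?_ ?_ ?_ ?_ ?_ ?_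
    · simp [l1, r1, n6, n2, hs']
    · rw [eL, eR]; exact hz
    · simp [l2, n4.symm]
    · simp [r2, n4.symm]
    · simp [l2, eL]
    · simp [r2]
    · intro j h1 h2; simp [l2, h1, h2]
    · intro j h1 h2; simp [r2, h2]
    · intro x hx; exact Or.inl hx
  have v1 : l2 k = l k := by simp [l2, l1, n2.symm, n5.symm, n1.symm]
  have v2 : r2 k = y := by simp [r2, r1, n2.symm, n1.symm]
  have v3 : l2 s = y := by simp [l2, l1, n6.symm, n3]
  have v4 : r2 s = r k := by simp [r2, r1, n6.symm]
  have v5 : l2 (bar k) = z := by simp [l2, n4.symm]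
  have v6 : r2 (bar k) = r (bar k) := by simp [r2, n4.symm, eR]
  have v7 : l2 (bar s) = l (bar k) := by simp [l2]
  have v8 : r2 (bar s) = z := by simp [r2]
  have v9 : ∀ j, j ≠ k → j ≠ bar k → j ≠ s → j ≠ bar s → l2 j = l j ∧ r2 j = r j := by
    intro j h1 h2 h3 h4
    simp [l2, r2, l1, r1, h1, h2, h3, h4]
  clear_value l2 r2
  refine ⟨l2, r2, P2, ?_, v1, v2, v3, v4, v9, ?_⟩
  · have hTk : Tv f U l r k → Tv f U l2 r2 k ∧ Tv f U l2 r2 s := by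
      intro hT
      unfold Tv
      rw [v1, v2, v3, v4, v5, v6, v7, v8]
      exact ⟨⟨hT.1.sub le_rfl hy1.le hy2.le, hT.2.sub hz.1 hz.2 le_rfl⟩,
        ⟨hT.1.sub hy1.le hy2.le le_rfl, hT.2.sub le_rfl hz.1 hz.2⟩⟩
    refine hO.of_two n1 n3 v9 ?_ ?_ ?_ ?_ ?_
    · rcases hzc with ⟨hT, _⟩ | ⟨hT, h1, h2⟩
      · exact Or.inl (hTk hT).1
      · rw [v1, v2, v5, v6]; exact Or.inr h1
    · rcases hzc with ⟨hT, _⟩ | ⟨hT, h1, h2⟩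
      · exact Or.inl (hTk hT).2
      · rw [v3, v4, v7, v8]; exact Or.inr h2
    · rcases hzc with ⟨hT, _⟩ | ⟨hT, h1, h2⟩
      · exact Or.inl (hTk hT).1
      · right; right
        rw [v1, v3, v5, v7]
        obtain ⟨nd1, nd2⟩ := hO.nd hn hP hT
        unfold prod4
        rcases hP.pos (Ne.symm n5) nd1 nd2 with d | d
        · have e1 : 0 ≤ (l k - y) * (l k - l (bar k)) :=
            mul_nonneg_of_nonpos_of_nonpos (by linarith) (by linarith)
          have e2 : 0 ≤ (z - y) * (z - l (bar k)) := mul_nonneg (by linarith [hz.1]) (by linarith [hz.1])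
          have := mul_nonneg e1 e2
          linarith
        · have e1 : 0 ≤ (y - l k) * (l k - l (bar k)) :=
            mul_nonneg (by linarith) (by linarith)
          have e2 : 0 ≤ (y - z) * (z - l (bar k)) := mul_nonneg (by linarith [hz.2]) (by linarith [hz.1])
          have := mul_nonneg e1 e2
          linarith
    · intro j j1 j2 j3 j4 hj
      rcases hzc with ⟨hT, _⟩ | ⟨hT, h1, h2⟩
      · exact Or.inl (hTk hT).1
      right
      obtain ⟨nd1, nd2⟩ := hO.nd hn hP hT
      obtain ⟨nd3, nd4⟩ := hO.nd hn hP hj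
      have hO1 := ((hO.nc k j j1 j2).resolve_left hT).resolve_left hj
      rw [v1, v5, prod4_swap1]
      rw [← prod4_swap1] at hO1
      have hb1 : bar j ≠ bar k := fun e => j1 (by simpa [bar_bar] using congrArg bar e)
      obtain ⟨s1, s2⟩ := slide_fact rfl hz nd2 nd3 (hP.pos (Ne.symm j2) nd2 nd3)
      obtain ⟨s3, s4⟩ := slide_fact rfl hz nd2 nd4 (hP.pos (Ne.symm hb1) nd2 nd4)
      exact prod4_slide hO1 s1 s3 s2 s4
    · intro j j1 j2 j3 j4 hj
      rcases hzc with ⟨hT, _⟩ | ⟨hT, h1, h2⟩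
      · exact Or.inl (hTk hT).2
      right
      obtain ⟨nd1, nd2⟩ := hO.nd hn hP hT
      obtain ⟨nd3, nd4⟩ := hO.nd hn hP hj
      have hO1 := ((hO.nc k j j1 j2).resolve_left hT).resolve_left hj
      rw [v3, v7]
      have hb1 : bar j ≠ k := fun e => j2 (bar_eq_iff.1 e)
      obtain ⟨s1, s2⟩ := slide_fact rfl (⟨hy1.le, hy2.le⟩ : l k ≤ y ∧ y ≤ r k) nd1 nd3 (hP.pos (Ne.symm j1) nd1 nd3)
      obtain ⟨s3, s4⟩ := slide_fact rfl (⟨hy1.le, hy2.le⟩ : l k ≤ y ∧ y ≤ r k) nd1 nd4 (hP.pos (Ne.symm hb1) nd1 nd4)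
      exact prod4_slide hO1 s1 s3 s2 s4
  · intro hT
    rcases hzc with ⟨_, rfl⟩ | ⟨hT', _⟩
    · exact ⟨v5, v6⟩
    · exact absurd hT hT'

theorem remove_pair [Finite K] (hn : NCst f a b) (hP : IPart a b p q B l r) (hO : PairOK f U l r)
    {k m : K} (hpq : p ≤ q) (hk : r k = p) (hm : l m = q) (hk' : l k < r k) (hm' : l m < r m)
    (hM : Match f (l k) (r k) (l m) (r m)) :
    ∃ l' r' : K → ℝ, IPart a b (l k) (r m) B l' r' ∧ PairOK f U l' r' ∧
      ∃ s, l' s = r' s ∧ l' (bar s) = r' (bar s) := by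
  classical
  have nmk : m ≠ k := by rintro rfl; linarith
  let l1 := Function.update l m (r m)
  let r1 := Function.update r k (l k)
  have P1 : IPart a b (l k) (r m) B l1 r1 := by
    refine hP.shrink hpq hk hm hk' hm' ?_ ?_ ?_ ?_ ?_ ?_
    · simp [l1, nmk.symm]
    · simp [r1]
    · simp [l1]
    · simp [r1, nmk]
    · intro j h1 h2; simp [l1, h2]
    · intro j h1 h2; simp [r1, h1]
  by_cases hmk : m = bar k
  · have d1 : l1 k = r1 k := by simp [l1, r1, nmk.symm]
    have d2 : l1 (bar k) = r1 (bar k) := by rw [← hmk]; simp [l1, r1, nmk]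
    refine ⟨l1, r1, P1, hO.of_one (k := k) ?_ ⟨Or.inl d1, Or.inl d2⟩, k, d1, d2⟩
    intro j h1 h2
    rw [← hmk] at h2
    simp [l1, r1, h1, h2]
  · have n1 : bar m ≠ k := fun e => hmk (bar_eq_iff.1 e)
    have n2 : bar m ≠ m := bar_ne m
    have n3 : bar k ≠ k := bar_ne k
    have n4 : bar k ≠ bar m := fun e => nmk (by simpa [bar_bar] using congrArg bar e.symm)
    let τ := Equiv.swap k (bar m)
    have P2 := P1.perm τ
    have v1 : (l1 ∘ τ) k = l (bar m) := by simp [l1, τ, n2]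
    have v2 : (r1 ∘ τ) k = r (bar m) := by simp [r1, τ, n1]
    have v3 : (l1 ∘ τ) (bar k) = l (bar k) := by
      simp [l1, τ, Equiv.swap_apply_of_ne_of_ne n3 n4, Ne.symm hmk]
    have v4 : (r1 ∘ τ) (bar k) = r (bar k) := by
      simp [r1, τ, Equiv.swap_apply_of_ne_of_ne n3 n4, n3]
    have v5 : (l1 ∘ τ) m = (r1 ∘ τ) m := by
      simp [l1, r1, τ, Equiv.swap_apply_of_ne_of_ne nmk n2.symm, nmk]
    have v6 : (l1 ∘ τ) (bar m) = (r1 ∘ τ) (bar m) := by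
      simp [l1, r1, τ, nmk.symm]
    have v7 : ∀ j, j ≠ k → j ≠ bar k → j ≠ m → j ≠ bar m → (l1 ∘ τ) j = l j ∧ (r1 ∘ τ) j = r j := by
      intro j h1 h2 h3 h4
      simp [l1, r1, τ, Equiv.swap_apply_of_ne_of_ne h1 h4, h1, h3]
    generalize l1 ∘ τ = l2 at *
    generalize r1 ∘ τ = r2 at *
    have hTm : Tv f U l2 r2 m := ⟨Or.inl v5, Or.inl v6⟩
    have hA := hP.ha
    have hB := hP.hb
    -- triviality of new pair
    have hTnew : Tv f U l r k ∨ Tv f U l r m → Tv f U l2 r2 k := by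
      intro h
      have key : TI f U (l k) (r k) ∧ TI f U (l m) (r m) := by
        rcases h with h | h
        · exact ⟨h.1, h.1.of_match hM hn (hA _) (hB _)⟩
        · exact ⟨h.1.of_match hM.symm hn (hA _) (hB _), h.1⟩
      unfold Tv
      rw [v1, v2, v3, v4]
      constructor
      · rcases hO.mt m with h | h
        · exact h.2
        · exact key.2.of_match h hn (hA _) (hB _)
      · rcases hO.mt k with h | h
        · exact h.2
        · exact key.1.of_match h hn (hA _) (hB _)
    by_cases hT : Tv f U l r k ∨ Tv f U l r m
    · have := hTnew hT
      exact ⟨l2, r2, P2, hO.of_two nmk hmk v7 (Or.inl this) (Or.inl hTm) (Or.inl this)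
        (fun _ _ _ _ _ _ => Or.inl this) (fun _ _ _ _ _ _ => Or.inl hTm), m, v5, v6⟩
    push Not at hT
    refine ⟨l2, r2, P2, hO.of_two nmk hmk v7 (Or.inr ?_) (Or.inl hTm) (Or.inr (Or.inl hTm))
        ?_ (fun _ _ _ _ _ _ => Or.inl hTm), m, v5, v6⟩
    · rw [v1, v2, v3, v4]
      exact Match.comp3 hn ((hO.mt m).resolve_left hT.2).symm hM.symm ((hO.mt k).resolve_left hT.1)
        (hA _) (hB _) (hA _) (hB _) (hA _) (hB _) (hA _) (hB _)
    · intro j j1 j2 j3 j4 hj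
      right
      obtain ⟨nd3, nd4⟩ := hO.nd hn hP hj
      have h1 := ((hO.nc k j j1 j2).resolve_left hT.1).resolve_left hj
      have h2 := ((hO.nc m j j3 j4).resolve_left hT.2).resolve_left hj
      have key : ∀ i, i ≠ k → i ≠ m → l i < r i → 0 < (l k - l i) * (l m - l i) := by
        intro i i1 i2 hi
        rcases hP.pos i1 hi hk' with d | d
        · exact mul_pos (by linarith) (by linarith)
        · rcases hP.hole i with e | e | e
          · linarith
          · linarith
          · rcases hP.pos i2 hi hm' with d' | d'
            · linarith
            · exact mul_pos_of_neg_of_neg (by linarith) (by linarith)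
      have k1 := key j j1 j3 nd3
      have k2 := key (bar j) (fun e => j2 (bar_eq_iff.1 e)) (fun e => j4 (bar_eq_iff.1 e)) nd4
      rw [v1, v3]
      have h3 := mul_nonneg h1 h2
      have k3 := mul_pos k1 k2
      unfold prod4 at *
      refine nonneg_of_mul_nonneg_right (le_of_le_of_eq h3 ?_) k3
      ring

end cutrem
end

noncomputable section

section valid
open HasBar

variable {Y : Type*} [TopologicalSpace Y]
variable {a b p q : ℝ} {B : Set ℝ} {f : C(ℝ, Y)} {U : Set Y}

def Valid (f : C(ℝ, Y)) (U : Set Y) (a b p q : ℝ) (B : Set ℝ) : Prop :=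
  ∃ (K : Type) (_ : Finite K) (_ : HasBar K) (l r : K → ℝ), IPart a b p q B l r ∧ PairOK f U l r

instance sumBar {K : Type} [HasBar K] : HasBar (K ⊕ Bool) where
  bar := Sum.map bar not
  bar_bar k := by rcases k with k | k <;> simp [bar_bar]
  bar_ne k := by rcases k with k | k <;> simp [bar_ne]

theorem Valid.spare (hab : a ≤ b) (h : Valid f U a b p q B) :
    ∃ (K : Type) (_ : Finite K) (_ : HasBar K) (l r : K → ℝ), IPart a b p q B l r ∧ PairOK f U l r ∧
      ∃ s, l s = r s ∧ l (bar s) = r (bar s) := by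
  obtain ⟨K, _, _, l, r, hP, hO⟩ := h
  let l' : K ⊕ Bool → ℝ := Sum.elim l (fun _ => a)
  let r' : K ⊕ Bool → ℝ := Sum.elim r (fun _ => a)
  refine ⟨K ⊕ Bool, inferInstance, inferInstance, l', r', ?_, ?_, Sum.inr true, rfl, rfl⟩
  · refine ⟨?_, ?_, ?_, ?_, ?_, ?_, ?_⟩
    · rintro (k | k)
      · exact hP.ha k
      · exact le_rfl
    · rintro (k | k)
      · exact hP.hle k
      · exact le_rfl
    · rintro (k | k)
      · exact hP.hb k
      · exact hab
    · rintro (k | k) (m | m) hkm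
      · exact hP.dis k m (fun e => hkm (by rw [e]))
      · right; left; rfl
      · left; rfl
      · left; rfl
    · rintro (k | k)
      · exact hP.hole k
      · left; rfl
    · intro x hx hx'
      rcases hP.cov x hx hx' with d | ⟨k, d⟩
      · exact Or.inl d
      · exact Or.inr ⟨Sum.inl k, d⟩
    · rintro x hx (k | k)
      · exact hP.bps x hx k
      · left; rfl
  · have hT : ∀ k : Bool, Tv f U l' r' (Sum.inr k) := fun k => ⟨Or.inl rfl, Or.inl rfl⟩
    constructor
    · rintro (k | k)
      · exact hO.mt k
      · exact Or.inl (hT k)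
    · rintro (k | k) (m | m) h1 h2
      · exact hO.nc k m (fun e => h1 (by rw [e])) (fun e => h2 (by rw [e]; rfl))
      · exact Or.inr (Or.inl (hT m))
      · exact Or.inl (hT k)
      · exact Or.inl (hT k)

theorem Valid.addBp (hab : a < b) (hn : NCst f a b) (h : Valid f U a b p q B) (y : ℝ) :
    Valid f U a b p q (insert y B) := by
  obtain ⟨K, i1, i2, l, r, hP, hO, s, hs, hs'⟩ := h.spare hab.le
  by_cases hk : ∃ k, l k < y ∧ y < r k
  · obtain ⟨k, h1, h2⟩ := hk
    obtain ⟨l', r', P', O', -⟩ := cut_pair hab hn hP hO hs hs' h1 h2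
    exact ⟨K, i1, i2, l', r', P', O'⟩
  · push Not at hk
    refine ⟨K, i1, i2, l, r, { hP with bps := ?_ }, hO⟩
    rintro x (rfl | hx) k
    · right
      rcases lt_or_ge (l k) x with d | d
      · left; exact hk k d
      · right; exact d
    · exact hP.bps x hx k

theorem Valid.to_left (hab : a < b) (h : Valid f U a b p p B) : Valid f U a b a a B := by
  obtain ⟨K, i1, i2, l, r, hP, hO⟩ := h
  exact ⟨K, i1, i2, l, r, hP.to_left hab, hO⟩

theorem Valid.to_bp (hab : a < b) (hn : NCst f a b) (h : Valid f U a b p p B) (c : ℝ) :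
    Valid f U a b c c B := by
  obtain ⟨K, i1, i2, l, r, hP, hO⟩ := h.addBp hab hn c
  exact ⟨K, i1, i2, l, r, (hP.to_bp hab (Set.mem_insert c B)).monoB (Set.subset_insert _ _), hO⟩

theorem Valid.monoB (h : Valid f U a b p q B) {B' : Set ℝ} (hB : B' ⊆ B) : Valid f U a b p q B' := by
  obtain ⟨K, i1, i2, l, r, hP, hO⟩ := h
  exact ⟨K, i1, i2, l, r, hP.monoB hB, hO⟩

theorem prod4_push {κ : ℝ → ℝ} (hm : Monotone κ) {x x' y y' : ℝ} (h : 0 ≤ prod4 x x' y y') :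
    0 ≤ prod4 (κ x) (κ x') (κ y) (κ y') := by
  have key : ∀ x y, ∃ s, 0 ≤ s ∧ κ x - κ y = s * (x - y) := by
    intro x y
    rcases lt_trichotomy x y with d | d | d
    · refine ⟨(κ x - κ y) / (x - y), ?_, ?_⟩
      · have := hm d.le; exact div_nonneg_of_nonpos (by linarith) (by linarith)
      · rw [div_mul_cancel₀]; linarith
    · exact ⟨0, le_rfl, by rw [d]; simp⟩
    · refine ⟨(κ x - κ y) / (x - y), ?_, ?_⟩
      · have := hm d.le; exact div_nonneg (by linarith) (by linarith)
      · rw [div_mul_cancel₀]; linarith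
  unfold prod4 at *
  obtain ⟨s1, h1, e1⟩ := key x y
  obtain ⟨s2, h2, e2⟩ := key x y'
  obtain ⟨s3, h3, e3⟩ := key x' y
  obtain ⟨s4, h4, e4⟩ := key x' y'
  rw [e1, e2, e3, e4]
  have := mul_nonneg (mul_nonneg (mul_nonneg h1 h2) (mul_nonneg h3 h4)) h
  refine le_of_le_of_eq this ?_
  ring

theorem Valid.push (hab : a ≤ b) (h : Valid f U a b p q B) (f' : C(ℝ, Y)) (κ : ℝ → ℝ) (hκ : Continuous κ)
    (hm : Monotone κ) (hf : ∀ x, a ≤ x → x ≤ b → (x ≤ p ∨ q ≤ x) → f' (κ x) = f x)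
    (hn : NCst f a b ∨ p = q) : Valid f' U (κ a) (κ b) (κ p) (κ q) (κ '' B) := by
  obtain ⟨K, i1, i2, l, r, hP, hO⟩ := h
  refine ⟨K, i1, i2, κ ∘ l, κ ∘ r, hP.push hm hκ hab, ?_⟩
  have hoff : ∀ k, l k < r k → ∀ x ∈ Set.Icc (l k) (r k), f' (κ x) = f x := by
    intro k hk x hx
    refine hf x ((hP.ha k).trans hx.1) (hx.2.trans (hP.hb k)) ?_
    rcases hP.hole k with d | d | d
    · linarith
    · left; exact hx.2.trans d
    · right; exact d.trans hx.1
  have hoff' : ∀ k, ¬ Tv f U l r k → ∀ x ∈ Set.Icc (l k) (r k), f' (κ x) = f x := by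
    intro k hk
    rcases hn with hn | hn
    · exact hoff k (hO.nd hn hP hk).1
    · intro x hx
      refine hf x ((hP.ha k).trans hx.1) (hx.2.trans (hP.hb k)) ?_
      rw [hn]; exact le_total _ _
  have hTI : ∀ k, TI f U (l k) (r k) → TI f' U (κ (l k)) (κ (r k)) := by
    intro k hk
    rcases (hP.hle k).eq_or_lt with e | e
    · left; rw [e]
    · rw [TI_iff e.le] at hk
      rw [TI_iff (hm e.le)]
      right
      intro y h1 h2
      obtain ⟨x, hx, rfl⟩ := intermediate_value_Icc e.le hκ.continuousOn ⟨h1, h2⟩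
      rw [hoff k e x hx]
      rcases hk with hk | hk
      · linarith
      · exact hk x hx.1 hx.2
  have hT : ∀ k, Tv f U l r k → Tv f' U (κ ∘ l) (κ ∘ r) k := fun k h => ⟨hTI _ h.1, hTI _ h.2⟩
  constructor
  · intro k
    by_cases hk : Tv f U l r k
    · exact Or.inl (hT k hk)
    · exact Or.inr (((hO.mt k).resolve_left hk).push κ hκ hm (hoff' k hk)
        (hoff' _ (fun h => hk h.of_bar)))
  · intro k m h1 h2
    rcases hO.nc k m h1 h2 with d | d | d
    · exact Or.inl (hT k d)
    · exact Or.inr (Or.inl (hT m d))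
    · exact Or.inr (Or.inr (prod4_push hm d))

section closed
variable {Ω : Type*} [TopologicalSpace Ω]

theorem clOr {P Q : Ω → Prop} (h1 : IsClosed {x | P x}) (h2 : IsClosed {x | Q x}) : IsClosed {x | P x ∨ Q x} := by
  have := h1.union h2
  convert this using 1
  ext x; simp
theorem clAnd {P Q : Ω → Prop} (h1 : IsClosed {x | P x}) (h2 : IsClosed {x | Q x}) : IsClosed {x | P x ∧ Q x} := by
  have := h1.inter h2
  convert this using 1
  ext x; simp
theorem clAll {ι : Sort*} {P : ι → Ω → Prop} (h : ∀ i, IsClosed {x | P i x}) : IsClosed {x | ∀ i, P i x} := by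
  have := isClosed_iInter h
  convert this using 1
  ext x; simp
theorem clEx {ι : Type*} [Finite ι] {P : ι → Ω → Prop} (h : ∀ i, IsClosed {x | P i x}) :
    IsClosed {x | ∃ i, P i x} := by
  have := isClosed_iUnion_of_finite h
  convert this using 1
  ext x; simp

theorem clTI (hU : IsClosed U) {L R : Ω → ℝ} (hL : Continuous L) (hR : Continuous R) :
    IsClosed {x | TI f U (L x) (R x)} := by
  refine clOr (isClosed_eq hL hR) (clAll fun t => clAll fun _ => ?_)
  exact hU.preimage (f.continuous.comp (hL.add (continuous_const.mul (hR.sub hL))))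

theorem clPart {K : Type} [Finite K] {L R : K → Ω → ℝ} {P Q : Ω → ℝ} (hL : ∀ k, Continuous (L k))
    (hR : ∀ k, Continuous (R k)) (hP : Continuous P) (hQ : Continuous Q) (a b : ℝ) (B : Set ℝ) :
    IsClosed {x | IPart a b (P x) (Q x) B (fun k => L k x) (fun k => R k x)} := by
  have e : ∀ x, IPart a b (P x) (Q x) B (fun k => L k x) (fun k => R k x) ↔
      ((∀ k, a ≤ L k x) ∧ (∀ k, L k x ≤ R k x) ∧ (∀ k, R k x ≤ b) ∧
       (∀ k m, k ≠ m → L k x = R k x ∨ L m x = R m x ∨ R k x ≤ L m x ∨ R m x ≤ L k x) ∧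
       (∀ k, L k x = R k x ∨ R k x ≤ P x ∨ Q x ≤ L k x) ∧
       (∀ y, a ≤ y → y ≤ b → (P x ≤ y ∧ y ≤ Q x) ∨ ∃ k, L k x ≤ y ∧ y ≤ R k x) ∧
       (∀ y ∈ B, ∀ k, L k x = R k x ∨ R k x ≤ y ∨ y ≤ L k x)) :=
    fun x => ⟨fun ⟨h1, h2, h3, h4, h5, h6, h7⟩ => ⟨h1, h2, h3, h4, h5, h6, h7⟩,
      fun ⟨h1, h2, h3, h4, h5, h6, h7⟩ => ⟨h1, h2, h3, h4, h5, h6, h7⟩⟩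
  simp only [e]
  have c : ∀ y : ℝ, Continuous fun _ : Ω => y := fun y => continuous_const
  refine clAnd (clAll fun k => isClosed_le (c _) (hL k)) (clAnd (clAll fun k => isClosed_le (hL k) (hR k))
    (clAnd (clAll fun k => isClosed_le (hR k) (c _)) (clAnd ?_ (clAnd ?_ (clAnd ?_ ?_)))))
  · exact clAll fun k => clAll fun m => clAll fun _ => clOr (isClosed_eq (hL k) (hR k)) (clOr
      (isClosed_eq (hL m) (hR m)) (clOr (isClosed_le (hR k) (hL m)) (isClosed_le (hR m) (hL k))))
  · exact clAll fun k => clOr (isClosed_eq (hL k) (hR k)) (clOr (isClosed_le (hR k) hP) (isClosed_le hQ (hL k)))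
  · exact clAll fun y => clAll fun _ => clAll fun _ => clOr (clAnd (isClosed_le hP (c y)) (isClosed_le (c y) hQ))
      (clEx fun k => clAnd (isClosed_le (hL k) (c y)) (isClosed_le (c y) (hR k)))
  · exact clAll fun y => clAll fun _ => clAll fun k => clOr (isClosed_eq (hL k) (hR k)) (clOr
      (isClosed_le (hR k) (c y)) (isClosed_le (c y) (hL k)))

theorem clPair [T2Space Y] (hU : IsClosed U) {K : Type} [HasBar K] {L R : K → Ω → ℝ} (hL : ∀ k, Continuous (L k))
    (hR : ∀ k, Continuous (R k)) (a b : ℝ) :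
    IsClosed {x | (∀ k, L k x ∈ Set.Icc a b ∧ R k x ∈ Set.Icc a b) ∧ PairOK f U (fun k => L k x) (fun k => R k x)} := by
  have e : ∀ x, ((∀ k, L k x ∈ Set.Icc a b ∧ R k x ∈ Set.Icc a b) ∧ PairOK f U (fun k => L k x) (fun k => R k x)) ↔
     ((∀ k, L k x ∈ Set.Icc a b ∧ R k x ∈ Set.Icc a b) ∧
      (∀ k, (TI f U (L k x) (R k x) ∧ TI f U (L (bar k) x) (R (bar k) x)) ∨
        (L k x, R k x, L (bar k) x, R (bar k) x) ∈ {v : ℝ × ℝ × ℝ × ℝ | (v.1 ∈ Set.Icc a b ∧ v.2.1 ∈ Set.Icc a b ∧ v.2.2.1 ∈ Set.Icc a b ∧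
      v.2.2.2 ∈ Set.Icc a b) ∧ Match f v.1 v.2.1 v.2.2.1 v.2.2.2}) ∧
      (∀ k m, m ≠ k → m ≠ bar k → (TI f U (L k x) (R k x) ∧ TI f U (L (bar k) x) (R (bar k) x)) ∨
        (TI f U (L m x) (R m x) ∧ TI f U (L (bar m) x) (R (bar m) x)) ∨
        0 ≤ prod4 (L k x) (L (bar k) x) (L m x) (L (bar m) x))) := by
    intro x
    constructor
    · rintro ⟨h0, h1, h2⟩
      exact ⟨h0, fun k => (h1 k).imp id fun h => ⟨⟨(h0 k).1, (h0 k).2, (h0 _).1, (h0 _).2⟩, h⟩, h2⟩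
    · rintro ⟨h0, h1, h2⟩
      exact ⟨h0, ⟨fun k => (h1 k).imp id fun h => h.2, h2⟩⟩
  simp only [e]
  have c : ∀ y : ℝ, Continuous fun _ : Ω => y := fun y => continuous_const
  have hT : ∀ k, IsClosed {x | TI f U (L k x) (R k x) ∧ TI f U (L (bar k) x) (R (bar k) x)} := fun k =>
    clAnd (clTI hU (hL _) (hR _)) (clTI hU (hL _) (hR _))
  refine clAnd (clAll fun k => clAnd ?_ ?_) (clAnd ?_ ?_)
  · exact isClosed_Icc.preimage (hL k)
  · exact isClosed_Icc.preimage (hR k)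
  · refine clAll fun k => clOr (hT k) ?_
    exact (Match.isCompact f a b).isClosed.preimage
      ((hL k).prodMk ((hR k).prodMk ((hL _).prodMk (hR _))))
  · refine clAll fun k => clAll fun m => clAll fun _ => clAll fun _ => clOr (hT k) (clOr (hT m) ?_)
    refine isClosed_le (c 0) ?_
    unfold prod4
    exact ((((hL k).sub (hL m)).mul ((hL k).sub (hL _))).mul ((hL _).sub (hL m))).mul ((hL _).sub (hL _))

end closed
end valid
end

noncomputable section

section cancel
open HasBar
variable {Y : Type*} [TopologicalSpace Y]
variable {a b : ℝ} {B : Set ℝ} {f : C(ℝ, Y)} {U : Set Y}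

theorem anti_image_sub {g : ℝ → ℝ} {ps c u v : ℝ} (hg : StrictAntiOn g (Set.Icc ps c))
    (him : g '' Set.Icc ps c = Set.Icc u v) {x1 x2 : ℝ} (h1 : x1 ∈ Set.Icc ps c) (h2 : x2 ∈ Set.Icc ps c)
    (h12 : x1 ≤ x2) : g '' Set.Icc x1 x2 = Set.Icc (g x2) (g x1) := by
  have hc : ContinuousOn g (Set.Icc x1 x2) :=
    (antitoneOn_continuousOn hg.antitoneOn him).mono (Set.Icc_subset_Icc h1.1 h2.2)
  apply Set.Subset.antisymm
  · rintro _ ⟨x, hx, rfl⟩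
    have hx' : x ∈ Set.Icc ps c := ⟨h1.1.trans hx.1, hx.2.trans h2.2⟩
    exact ⟨hg.antitoneOn hx' h2 hx.2, hg.antitoneOn h1 hx' hx.1⟩
  · exact intermediate_value_Icc' h12 hc

theorem Valid.cancel [PathConnectedSpace Y] [T2Space Y] (hab : a < b) (hn : NCst f a b) (hU : IsClosed U)
    {c ps qs : ℝ} (h1 : a ≤ ps) (h2 : ps ≤ c) (h3 : c ≤ qs) (h4 : qs ≤ b) (hr : Red f c qs) {g : ℝ → ℝ}
    (hg : StrictAntiOn g (Set.Icc ps c)) (him : g '' Set.Icc ps c = Set.Icc c qs)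
    (hfg : ∀ x ∈ Set.Icc ps c, f (g x) = f x) (hV : Valid f U a b c c B) : Valid f U a b ps qs ∅ := by
  have hgc := antitoneOn_continuousOn hg.antitoneOn him
  have mps : ps ∈ Set.Icc ps c := ⟨le_rfl, h2⟩
  have mc : c ∈ Set.Icc ps c := ⟨h2, le_rfl⟩
  have hgps : g ps = qs := by
    have e1 : g ps ∈ Set.Icc c qs := him ▸ ⟨ps, mps, rfl⟩
    have e2 : qs ∈ g '' Set.Icc ps c := him ▸ ⟨h3, le_rfl⟩
    obtain ⟨x, hx, e⟩ := e2
    exact le_antisymm e1.2 (e ▸ hg.antitoneOn mps hx hx.1)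
  have hgcc : g c = c := by
    have e1 : g c ∈ Set.Icc c qs := him ▸ ⟨c, mc, rfl⟩
    have e2 : c ∈ g '' Set.Icc ps c := him ▸ ⟨le_rfl, h3⟩
    obtain ⟨x, hx, e⟩ := e2
    have e3 := hg.antitoneOn hx mc hx.2
    rw [e] at e3
    exact le_antisymm e3 e1.1
  have hgm : ∀ x ∈ Set.Icc ps c, g x ∈ Set.Icc c qs := fun x hx => him ▸ ⟨x, hx, rfl⟩
  have hMg : ∀ x1 x2, x1 ∈ Set.Icc ps c → x2 ∈ Set.Icc ps c → x1 ≤ x2 → Match f x1 x2 (g x2) (g x1) := by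
    intro x1 x2 m1 m2 h12
    have hsub : Set.Icc x1 x2 ⊆ Set.Icc ps c := Set.Icc_subset_Icc m1.1 m2.2
    exact Match.of_anti h12 g (hg.antitoneOn.mono hsub) (anti_image_sub hg him m1 m2 h12)
      (fun x hx => hfg x (hsub hx))
  let G : ℝ → ℝ := fun x => g (max ps (min x c))
  have hGc : Continuous G := by
    apply hgc.comp_continuous (by fun_prop)
    intro x
    exact ⟨le_max_left _ _, max_le h2 (min_le_right _ _)⟩
  have hG : ∀ x ∈ Set.Icc ps c, G x = g x := by
    intro x hx
    simp only [G]
    rw [min_eq_left hx.2, max_eq_right hx.1]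
  obtain ⟨K, i1, i2, l0, r0, P0, O0, s0, hs0, hs0'⟩ := ((hV.addBp hab hn ps).addBp hab hn qs).spare hab.le
  have P0' : IPart a b c c {ps, qs} l0 r0 := P0.monoB (by
    rintro x (rfl | rfl)
    · exact Set.mem_insert_of_mem _ (Set.mem_insert _ _)
    · exact Set.mem_insert _ _)
  let Ω := (K → ℝ) × (K → ℝ) × ℝ
  let S : Set Ω := {w | (w.2.2 ∈ Set.Icc ps c ∧ ∃ s, w.1 s = w.2.1 s ∧ w.1 (bar s) = w.2.1 (bar s)) ∧
    IPart a b w.2.2 (G w.2.2) {ps, qs} (fun k => w.1 k) (fun k => w.2.1 k) ∧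
    ((∀ k, w.1 k ∈ Set.Icc a b ∧ w.2.1 k ∈ Set.Icc a b) ∧ PairOK f U (fun k => w.1 k) (fun k => w.2.1 k))}
  have cL : ∀ k, Continuous fun w : Ω => w.1 k := fun k => (continuous_apply k).comp continuous_fst
  have cR : ∀ k, Continuous fun w : Ω => w.2.1 k := fun k =>
    (continuous_apply k).comp (continuous_fst.comp continuous_snd)
  have cP : Continuous fun w : Ω => w.2.2 := continuous_snd.comp continuous_snd
  have hSc : IsClosed S := by
    refine clAnd (clAnd (isClosed_Icc.preimage cP) (clEx fun s => clAnd (isClosed_eq (cL _) (cR _))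
      (isClosed_eq (cL _) (cR _)))) (clAnd ?_ ?_)
    · exact clPart cL cR cP (hGc.comp cP) a b _
    · exact clPair hU cL cR a b
  have hScpt : IsCompact S := by
    have hb : IsCompact ((Set.univ.pi fun _ => Set.Icc a b) ×ˢ (Set.univ.pi fun _ => Set.Icc a b) ×ˢ
      Set.Icc ps c : Set Ω) := (isCompact_univ_pi fun _ => isCompact_Icc).prod
        ((isCompact_univ_pi fun _ => isCompact_Icc).prod isCompact_Icc)
    refine hb.of_isClosed_subset hSc ?_
    rintro w ⟨⟨hw, -⟩, -, hw2, -⟩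
    exact ⟨fun k _ => (hw2 k).1, fun k _ => (hw2 k).2, hw⟩
  have hin : ∀ (l r : K → ℝ) (p : ℝ), p ∈ Set.Icc ps c → (∃ s, l s = r s ∧ l (bar s) = r (bar s)) →
      IPart a b p (g p) {ps, qs} l r → PairOK f U l r → (l, r, p) ∈ S := by
    intro l r p hp hs hP hO
    refine ⟨⟨hp, hs⟩, ?_, fun k => ⟨⟨hP.ha k, (hP.hle k).trans (hP.hb k)⟩, (hP.ha k).trans (hP.hle k), hP.hb k⟩, hO⟩
    show IPart a b p (G p) _ _ _
    rw [hG p hp]; exact hP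
  have hne : S.Nonempty := ⟨(l0, r0, c), hin l0 r0 c mc ⟨s0, hs0, hs0'⟩ (by rw [hgcc]; exact P0') O0⟩
  obtain ⟨⟨l, r, p⟩, hmem, hmin⟩ := hScpt.exists_isMinOn hne cP.continuousOn
  obtain ⟨⟨hp, s, hs, hs'⟩, hP, -, hO⟩ := hmem
  simp only at hp hs hs' hP hO
  rw [hG p hp] at hP
  rcases hp.1.eq_or_lt with e | hlt
  · refine ⟨K, i1, i2, l, r, ?_, hO⟩
    rw [← e, hgps] at hP
    exact hP.monoB (Set.empty_subset _)
  exfalso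
  have hmin' : ∀ (l' r' : K → ℝ) (p' : ℝ), p' ∈ Set.Icc ps c → (∃ s, l' s = r' s ∧ l' (bar s) = r' (bar s)) →
      ∀ q' B', q' = g p' → ({ps, qs} : Set ℝ) ⊆ B' →
      IPart a b p' q' B' l' r' → PairOK f U l' r' → p ≤ p' := by
    intro l' r' p' h1 h2 q' B' h3 h3' h4 h5
    subst h3
    exact hmin (hin l' r' p' h1 h2 (h4.monoB h3') h5)
  have hqm := hgm p hp
  have hqlt : g p < qs := hgps ▸ hg mps hp hlt
  have hpq : p ≤ g p := hp.2.trans hqm.1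
  -- the interval to the left of the hole
  obtain ⟨k, hk1, hk2⟩ : ∃ k, l k < p ∧ p ≤ r k := cover_left (u := a) (by linarith) (fun x hx hx' => by
    rcases hP.cov x hx.le (by linarith) with d | d
    · linarith [d.1]
    · exact d)
  have hkp : r k = p := by
    rcases hP.hole k with d | d | d
    · linarith
    · linarith
    · linarith
  have hkps : ps ≤ l k := by
    rcases hP.bps ps (by simp) k with d | d | d
    · linarith
    · linarith
    · exact d
  obtain ⟨m, hm1, hm2⟩ : ∃ m, l m ≤ g p ∧ g p < r m := cover_right (u := b) (by linarith) (fun x hx hx' => by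
    rcases hP.cov x (by linarith) (by linarith) with d | d
    · linarith [d.2]
    · exact d)
  have hmq : l m = g p := by
    rcases hP.hole m with d | d | d
    · linarith
    · linarith
    · linarith
  have hmqs : r m ≤ qs := by
    rcases hP.bps qs (by simp) m with d | d | d
    · linarith
    · exact d
    · linarith
  have hkm : k ≠ m := by rintro rfl; linarith
  have hlk : l k ∈ Set.Icc ps c := ⟨hkps, by linarith [hp.2]⟩
  have hforce : m = bar k → ¬ Tv f U l r k → g (l k) = r m := by
    intro e hT
    have M1 := (hO.mt k).resolve_left hT
    rw [← e, hkp, hmq] at M1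
    have M2 := hMg (l k) p hlk hp (by linarith)
    have c1 := M1.cl_eq
    have c2 := M2.cl_eq
    have e1 := M1.ends_eq.1
    have e2 := M2.ends_eq.1
    have c3 : cl f (g p) (r m) = cl f (g p) (g (l k)) := mul_left_cancel (c1.trans c2.symm)
    have hgk := hgm _ hlk
    rcases lt_trichotomy (g (l k)) (r m) with d | d | d
    · exfalso
      refine hr _ _ hgk.1 d hmqs (e2.symm.trans e1) ?_
      rw [← cl_mul f (g (l k)) (g p) (r m), c3, cl_mul, cl_self]
    · exact d
    · exfalso
      refine hr _ _ (by linarith [hqm.1]) d hgk.2 (e1.symm.trans e2) ?_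
      rw [← cl_mul f (r m) (g p) (g (l k)), ← c3, cl_mul, cl_self]
  have nmd : m ≠ s ∧ m ≠ bar s := by
    constructor <;> rintro rfl <;> linarith
  have nkd : k ≠ s ∧ k ≠ bar s := by
    constructor <;> rintro rfl <;> linarith
  rcases lt_trichotomy (g (l k)) (r m) with d | d | d
  · -- cut `m`
    have hy1 : l m < g (l k) := by rw [hmq]; exact hg hlk hp hk1
    obtain ⟨l', r', P', O', v1, v2, v3, v4, v5, v6⟩ := cut_pair hab hn hP hO hs hs' hy1 d
    have vk : l' k = l k ∧ r' k = r k := by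
      by_cases hmk : k = bar m
      · by_cases hT : Tv f U l r k
        · rw [hmk] at hT ⊢
          exact v6 hT.of_bar
        · exact absurd (hforce (bar_eq_iff.1 hmk.symm) hT) d.ne
      · exact v5 k hkm hmk nkd.1 nkd.2
    obtain ⟨l2, r2, P2, O2, sp⟩ := remove_pair hn P' O' (k := k) (m := m) hpq (by rw [vk.2, hkp])
      (by rw [v1, hmq]) (by rw [vk.1, vk.2, hkp]; exact hk1) (by rw [v1, v2]; exact hy1)
      (by rw [vk.1, vk.2, v1, v2, hmq, hkp]; exact hMg _ _ hlk hp hk1.le)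
    have := hmin' l2 r2 (l k) hlk sp _ _ rfl (Set.subset_insert (g (l k)) _) (by rw [vk.1, v2] at P2; exact P2) O2
    linarith
  · obtain ⟨l2, r2, P2, O2, sp⟩ := remove_pair hn hP hO (k := k) (m := m) hpq hkp hmq (by linarith) (by linarith)
      (by rw [hkp, hmq, ← d]; exact hMg _ _ hlk hp hk1.le)
    have := hmin' l2 r2 (l k) hlk sp _ _ d.symm (Set.Subset.refl _) P2 O2
    linarith
  · obtain ⟨y, hy, hye⟩ : r m ∈ g '' Set.Icc ps c := him ▸ ⟨by linarith [hqm.1], hmqs⟩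
    have hy1 : l k < y := by
      rw [← hye] at d
      exact (hg.lt_iff_gt hy hlk).1 d
    have hy2 : y < p := by
      rw [← hye] at hm2
      exact (hg.lt_iff_gt hp hy).1 hm2
    obtain ⟨l', r', P', O', v1, v2, v3, v4, v5, v6⟩ := cut_pair hab hn hP hO hs hs' hy1 (by rw [hkp]; exact hy2)
    have vm : l' m = l m ∧ r' m = r m := by
      by_cases hmk : m = bar k
      · by_cases hT : Tv f U l r k
        · rw [hmk]
          exact v6 hT
        · exact absurd (hforce hmk hT) d.ne'
      · exact v5 m hkm.symm hmk nmd.1 nmd.2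
    obtain ⟨l2, r2, P2, O2, sp⟩ := remove_pair hn P' O' (k := s) (m := m) hpq (by rw [v4, hkp])
      (by rw [vm.1, hmq]) (by rw [v3, v4, hkp]; exact hy2) (by rw [vm.1, vm.2]; linarith)
      (by rw [vm.1, vm.2, v3, v4, hmq, hkp, ← hye]; exact hMg _ _ hy hp hy2.le)
    have := hmin' l2 r2 y hy sp _ _ hye.symm (Set.subset_insert y _) (by rw [v3, vm.2] at P2; exact P2) O2
    linarith

end cancel
end

noncomputable section

section merge
variable {Y : Type*} [TopologicalSpace Y]

def clps (f : C(ℝ, Y)) (p q : ℝ) (h : f p = f q) : C(ℝ, Y) where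
  toFun x := if x ≤ p then f x else f (x + (q - p))
  continuous_toFun := by
    apply Continuous.if_le f.continuous (by fun_prop) continuous_id continuous_const
    intro x hx
    have hx' : x = p := hx
    rw [hx', h]; congr 1; ring

def clpk (p q x : ℝ) : ℝ := min x p + max (x - q) 0

theorem clpk_cont (p q : ℝ) : Continuous (clpk p q) := by unfold clpk; fun_prop

theorem clpk_mono (p q : ℝ) : Monotone (clpk p q) := by
  intro x y h
  exact add_le_add (min_le_min h le_rfl) (max_le_max (by linarith) le_rfl)

theorem clpk_left {p q x : ℝ} (hpq : p ≤ q) (h : x ≤ p) : clpk p q x = x := by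
  unfold clpk; rw [min_eq_left h, max_eq_right (by linarith)]; ring

theorem clpk_right {p q x : ℝ} (hpq : p ≤ q) (h : q ≤ x) : clpk p q x = p + (x - q) := by
  unfold clpk; rw [min_eq_right (by linarith), max_eq_left (by linarith)]

theorem clpk_mid {p q x : ℝ} (h1 : p ≤ x) (h : x ≤ q) : clpk p q x = p := by
  unfold clpk; rw [min_eq_right (by linarith), max_eq_right (by linarith)]; ring

theorem clps_eq {f : C(ℝ, Y)} {p q : ℝ} (hpq : p ≤ q) (h : f p = f q) {x : ℝ} (hx : x ≤ p ∨ q ≤ x) :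
    clps f p q h (clpk p q x) = f x := by
  rcases hx with hx | hx
  · rw [clpk_left hpq hx]; simp [clps, hx]
  · rw [clpk_right hpq hx]
    rcases hx.eq_or_lt with e | e
    · subst e; simp [clps, h]
    · have : ¬ (p + (x - q) ≤ p) := by linarith
      simp only [clps, ContinuousMap.coe_mk, this, if_false]
      congr 1; ring

variable [PathConnectedSpace Y]

theorem cl_push {f f' : C(ℝ, Y)} {κ : ℝ → ℝ} {u v : ℝ} (hκ : Continuous κ) (huv : u ≤ v)
    (h : ∀ x, u ≤ x → x ≤ v → f' (κ x) = f x) : cl f u v = cl f' (κ u) (κ v) :=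
  cl_reparam f f' κ u v hκ.continuousOn (fun x hx => by
    rw [Set.uIcc_of_le huv] at hx
    exact (h x hx.1 hx.2).symm)

theorem Red.push {f f' : C(ℝ, Y)} {κ : ℝ → ℝ} {u v : ℝ} (hr : Red f u v) (hκ : Continuous κ) (hm : Monotone κ)
    (huv : u ≤ v) (h : ∀ x, u ≤ x → x ≤ v → f' (κ x) = f x) : Red f' (κ u) (κ v) := by
  intro s t h1 h2 h3 h4 h5
  obtain ⟨x, hx, rfl⟩ := intermediate_value_Icc huv hκ.continuousOn ⟨h1, h2.le.trans h3⟩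
  obtain ⟨y, hy, rfl⟩ := intermediate_value_Icc huv hκ.continuousOn ⟨h1.trans h2.le, h3⟩
  have hxy : x < y := by
    by_contra hc
    exact absurd (hm (not_lt.1 hc)) (not_le.2 h2)
  rw [h x hx.1 hx.2, h y hy.1 hy.2] at h4
  refine hr x y hx.1 hxy hy.2 h4 ?_
  rw [cl_push hκ hxy.le (fun z h1 h2 => h z (hx.1.trans h1) (h2.trans hy.2))]
  exact h5

theorem NCst_of_blocks {f : C(ℝ, Y)} {s : ℕ → ℝ} (n : ℕ) 
    (hr : ∀ i < n, Red f (s i) (s (i+1))) : NCst f (s 0) (s n) := by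
  classical
  intro x y hx hxy hy
  have hex : ∃ i, x < s i := ⟨n, by linarith⟩
  have hi := Nat.find_spec hex
  have hmin := fun j => Nat.find_min hex (m := j)
  have hin : Nat.find hex ≤ n := Nat.find_min' hex (by linarith)
  obtain ⟨i, hi'⟩ : ∃ i, Nat.find hex = i + 1 := by
    rcases h0 : Nat.find hex with _ | i
    · rw [h0] at hi; linarith
    · exact ⟨i, rfl⟩
  rw [hi'] at hi hmin hin
  have hsi : s i ≤ x := not_lt.1 (hmin i (by omega))
  obtain ⟨z, hz, hne⟩ := (hr i (by omega)).exists_ne hsi (x2 := min y (s (i+1))) (lt_min hxy hi) (min_le_right _ _)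
  exact ⟨z, ⟨hz.1.le, hz.2.trans (min_le_left _ _)⟩, hne⟩

/-- pass 1: remove the constant blocks -/
theorem pass1 {U : Set Y} (γ : Gp Y) (x0 x1 : Y) (n : ℕ) (f : C(ℝ, Y)) (s : ℕ → ℝ) (hs : Monotone s)
    (hb : ∀ i < n, Red f (s i) (s (i+1)) ∨ ∀ x, s i ≤ x → x ≤ s (i+1) → f x = f (s i))
    (hV : Valid f U (s 0) (s n) (s 0) (s 0) ∅) (hγ : cl f (s 0) (s n) = γ) (h0 : f (s 0) = x0) (h1 : f (s n) = x1) :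
    ∃ (f : C(ℝ, Y)) (s : ℕ → ℝ), Monotone s ∧ (∀ i < n, Red f (s i) (s (i+1))) ∧
      Valid f U (s 0) (s n) (s 0) (s 0) ∅ ∧ cl f (s 0) (s n) = γ ∧ f (s 0) = x0 ∧ f (s n) = x1 := by
  have key : ∀ j ≤ n, ∃ (f : C(ℝ, Y)) (s : ℕ → ℝ), Monotone s ∧ (∀ i < j, Red f (s i) (s (i+1))) ∧
      (∀ i < n, Red f (s i) (s (i+1)) ∨ ∀ x, s i ≤ x → x ≤ s (i+1) → f x = f (s i)) ∧
      Valid f U (s 0) (s n) (s 0) (s 0) ∅ ∧ cl f (s 0) (s n) = γ ∧ f (s 0) = x0 ∧ f (s n) = x1 := by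
    intro j
    induction j with
    | zero => intro _; exact ⟨f, s, hs, by simp, hb, hV, hγ, h0, h1⟩
    | succ j ih =>
      intro hj
      obtain ⟨f, s, hs, hr, hb, hV, hγ, h0, h1⟩ := ih (by omega)
      rcases hb j (by omega) with hj' | hc
      · refine ⟨f, s, hs, ?_, hb, hV, hγ, h0, h1⟩
        intro i hi
        rcases Nat.lt_succ_iff_lt_or_eq.1 hi with h | h
        · exact hr i h
        · rw [h]; exact hj'
      · have hpq : s j ≤ s (j+1) := hs (Nat.le_succ j)
        have he : f (s j) = f (s (j+1)) := (hc _ hpq le_rfl).symm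
        let κ := clpk (s j) (s (j+1))
        let f' := clps f (s j) (s (j+1)) he
        have hκ : Continuous κ := clpk_cont _ _
        have hm : Monotone κ := clpk_mono _ _
        have hall : ∀ x, f' (κ x) = f x := by
          intro x
          by_cases hx : x ≤ s j ∨ s (j+1) ≤ x
          · exact clps_eq hpq he hx
          · push Not at hx
            simp only [κ]
            rw [clpk_mid hx.1.le hx.2.le, hc x hx.1.le hx.2.le]
            have := clps_eq hpq he (x := s j) (Or.inl le_rfl)
            rwa [clpk_left hpq le_rfl] at this
        have hred : ∀ i, Red f (s i) (s (i+1)) → Red f' (κ (s i)) (κ (s (i+1))) := fun i h =>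
          h.push hκ hm (hs (Nat.le_succ i)) (fun x _ _ => hall x)
        refine ⟨f', κ ∘ s, hm.comp hs, ?_, ?_, ?_, ?_, ?_, ?_⟩
        · intro i hi
          rcases Nat.lt_succ_iff_lt_or_eq.1 hi with h | h
          · exact hred i (hr i h)
          · rw [h]
            have : κ (s (j+1)) = κ (s j) := by
              simp only [κ]; rw [clpk_mid hpq le_rfl, clpk_mid le_rfl hpq]
            intro u v h1 h2 h3
            simp only [Function.comp] at h1 h3
            linarith
        · intro i hi
          rcases hb i hi with h | h
          · exact Or.inl (hred i h)
          · right
            intro y h1 h2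
            obtain ⟨x, hx, rfl⟩ := intermediate_value_Icc (hs (Nat.le_succ i)) hκ.continuousOn ⟨h1, h2⟩
            simp only [Function.comp]
            rw [hall, hall]; exact h x hx.1 hx.2
        · have := hV.push (hs (Nat.zero_le n)) f' κ hκ hm (fun x _ _ _ => hall x) (Or.inr rfl)
          rwa [Set.image_empty] at this
        · rw [← hγ]
          exact (cl_push hκ (hs (Nat.zero_le n)) (fun x _ _ => hall x)).symm
        · rw [← h0]; exact hall _
        · rw [← h1]; exact hall _
  obtain ⟨f, s, h1, h2, -, h3⟩ := key n le_rfl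
  exact ⟨f, s, h1, h2, h3⟩

theorem Match.refl_pt {Y : Type*} [TopologicalSpace Y] (f : C(ℝ, Y)) (c : ℝ) : Match f c c c c :=
  Match.of_anti le_rfl id (fun x hx y hy _ => by simp at hx hy; simp [hx, hy]) (by simp) (fun _ _ => rfl)

theorem exists_max_match [T2Space Y] (f : C(ℝ, Y)) {A c D : ℝ} (h1 : A ≤ c) (h2 : c ≤ D) :
    ∃ p q, A ≤ p ∧ p ≤ c ∧ c ≤ q ∧ q ≤ D ∧ Match f p c c q ∧
      ∀ u v, A ≤ u → u ≤ c → c ≤ v → v ≤ D → Match f u c c v → p - q ≤ u - v := by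
  let S : Set (ℝ × ℝ × ℝ × ℝ) := {v | (v.1 ∈ Set.Icc A D ∧ v.2.1 ∈ Set.Icc A D ∧ v.2.2.1 ∈ Set.Icc A D ∧
      v.2.2.2 ∈ Set.Icc A D) ∧ Match f v.1 v.2.1 v.2.2.1 v.2.2.2} ∩ {v | v.2.1 = c ∧ v.2.2.1 = c}
  have hS : IsCompact S := (Match.isCompact f A D).inter_right
    (clAnd (isClosed_eq (by fun_prop) continuous_const) (isClosed_eq (by fun_prop) continuous_const))
  have hne : S.Nonempty := ⟨(c, c, c, c), ⟨⟨⟨h1, h2⟩, ⟨h1, h2⟩, ⟨h1, h2⟩, ⟨h1, h2⟩⟩, Match.refl_pt f c⟩, rfl, rfl⟩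
  obtain ⟨⟨p, c', c'', q⟩, ⟨⟨⟨m1, -, -, m2⟩, hM⟩, e1, e2⟩, hmin⟩ := hS.exists_isMinOn hne
    (f := fun v => v.1 - v.2.2.2) (by fun_prop)
  simp only at e1 e2 hM m1 m2
  subst e1 e2
  have hle := hM.le
  refine ⟨p, q, m1.1, hle.1, hle.2, m2.2, hM, ?_⟩
  intro u v hu hu' hv hv' hM'
  exact hmin (a := (u, c'', c'', v)) ⟨⟨⟨⟨hu, hu'.trans h2⟩, ⟨h1, h2⟩, ⟨h1, h2⟩, ⟨h1.trans hv, hv'⟩⟩, hM'⟩, rfl, rfl⟩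

end merge
end

noncomputable section

section pass2

theorem anti_ends {g : ℝ → ℝ} {p c u v : ℝ} (hpc : p ≤ c) (huv : u ≤ v) (hg : AntitoneOn g (Set.Icc p c))
    (him : g '' Set.Icc p c = Set.Icc u v) : g p = v ∧ g c = u := by
  have mp : p ∈ Set.Icc p c := ⟨le_rfl, hpc⟩
  have mc : c ∈ Set.Icc p c := ⟨hpc, le_rfl⟩
  have e1 : g p ∈ Set.Icc u v := him ▸ ⟨p, mp, rfl⟩
  have e2 : g c ∈ Set.Icc u v := him ▸ ⟨c, mc, rfl⟩
  have e3 : v ∈ g '' Set.Icc p c := him ▸ ⟨huv, le_rfl⟩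
  have e4 : u ∈ g '' Set.Icc p c := him ▸ ⟨le_rfl, huv⟩
  obtain ⟨x, hx, hxv⟩ := e3
  obtain ⟨y, hy, hyv⟩ := e4
  constructor
  · apply le_antisymm e1.2; rw [← hxv]; exact hg mp hx hx.1
  · refine le_antisymm ?_ e2.1; rw [← hyv]; exact hg hy mc hy.2

def glu {Y : Type*} [TopologicalSpace Y] (f β : C(ℝ, Y)) (b : ℝ) (h : f b = β 1) : C(ℝ, Y) where
  toFun x := if x ≤ b then f x else β (1 - (x - b))
  continuous_toFun := by
    apply Continuous.if_le f.continuous (by fun_prop) continuous_id continuous_const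
    intro x hx
    have hx' : x = b := hx
    rw [hx', h]; congr 1; ring

variable (X : Set (ℝ × ℝ)) [PathConnectedSpace X]

theorem base_case (hX : interior X = ∅) (β : C(ℝ, X)) (hβ : Red β 0 1) {U : Set X} {f : C(ℝ, X)} {a b : ℝ}
    (hab : a < b) (hr : Red f a b) (hV : Valid f U a b a a ∅) (hcl : cl f a b = cl β 0 1)
    (h0 : f a = β 0) (h1 : f b = β 1) : Valid β U 0 1 0 0 ∅ := by
  let F := glu f β b h1
  have Fl : ∀ x, x ≤ b → F x = f x := fun x hx => by simp [F, glu, hx]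
  have Fr : ∀ x, b ≤ x → F x = β (1 - (x - b)) := fun x hx => by
    rcases hx.eq_or_lt with e | e
    · subst e; rw [Fl _ le_rfl, h1]; congr 1; ring
    · simp [F, glu, not_le.2 e]
  have clL : ∀ s t, s ≤ t → t ≤ b → cl F s t = cl f s t := fun s t hst ht =>
    cl_congr _ _ _ _ (fun x hx => by rw [Set.uIcc_of_le hst] at hx; exact Fl x (hx.2.trans ht))
  have clR : ∀ s t, s ≤ t → b ≤ s → cl F s t = cl β (1 - (s - b)) (1 - (t - b)) := fun s t hst ht =>
    cl_reparam F β (fun x => 1 - (x - b)) s t (by fun_prop)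
      (fun x hx => by rw [Set.uIcc_of_le hst] at hx; exact Fr x (ht.trans hx.1))
  obtain ⟨g, hg, him, hfg⟩ := fold_theorem X hX F (p := a) (c := b) (q := b + 1) hab.le (by linarith)
    (by rw [Fl a hab.le, Fr _ (by linarith), h0]; congr 1; ring)
    (by
      rw [← cl_mul F a b, clL a b hab.le le_rfl, clR b (b+1) (by linarith) le_rfl, hcl]
      have e1 : 1 - (b - b) = 1 := by ring
      have e2 : 1 - (b + 1 - b) = 0 := by ring
      rw [e1, e2, cl_mul, cl_self])
    (by
      intro s t h1 h2 h3 h4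
      rw [clL s t h2.le h3]
      rw [Fl s (by linarith), Fl t h3] at h4
      exact hr s t h1 h2 h3 h4)
    (by
      intro s t h1 h2 h3 h4
      rw [clR s t h2.le h1, cl_inv, Ne, inv_eq_one]
      rw [Fr s h1, Fr t (by linarith)] at h4
      exact hβ _ _ (by linarith) (by linarith) (by linarith) h4.symm)
  obtain ⟨ga, gb⟩ := anti_ends hab.le (by linarith) hg.antitoneOn him
  have hgc := antitoneOn_continuousOn hg.antitoneOn him
  let κ : ℝ → ℝ := fun x => b + 1 - g (max a (min x b))
  have hmem : ∀ x, max a (min x b) ∈ Set.Icc a b := fun x => ⟨le_max_left _ _, max_le hab.le (min_le_right _ _)⟩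
  have hκ : Continuous κ := by
    have : Continuous fun x : ℝ => g (max a (min x b)) := hgc.comp_continuous (by fun_prop) hmem
    exact continuous_const.sub this
  have hm : Monotone κ := by
    intro x y hxy
    have := hg.antitoneOn (hmem x) (hmem y) (max_le_max le_rfl (min_le_min hxy le_rfl))
    simp only [κ]; linarith
  have hκx : ∀ x, a ≤ x → x ≤ b → κ x = b + 1 - g x := fun x h1 h2 => by
    simp only [κ]; rw [min_eq_left h2, max_eq_right h1]
  have := hV.push hab.le β κ hκ hm (fun x h1 h2 _ => by
    rw [hκx x h1 h2, ← Fl x h2, ← hfg x ⟨h1, h2⟩]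
    have hgx : g x ∈ Set.Icc b (b+1) := him ▸ ⟨x, ⟨h1, h2⟩, rfl⟩
    rw [Fr _ hgx.1]; congr 1; ring) (Or.inr rfl)
  rw [Set.image_empty, hκx a le_rfl hab.le, hκx b hab.le le_rfl, ga, gb] at this
  convert this using 1 <;> ring

theorem pass2 (hX : interior X = ∅) (β : C(ℝ, X)) (hβ : Red β 0 1) {U : Set X} (hU : IsClosed U)
    (h1 : cl β 0 1 ≠ 1) (n : ℕ) : ∀ (f : C(ℝ, X)) (s : ℕ → ℝ), Monotone s → (∀ i < n, Red f (s i) (s (i+1))) →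
      Valid f U (s 0) (s n) (s 0) (s 0) ∅ → cl f (s 0) (s n) = cl β 0 1 → f (s 0) = β 0 → f (s n) = β 1 →
      Valid β U 0 1 0 0 ∅ := by
  induction n with
  | zero => intro f s _ _ _ hc; rw [cl_self] at hc; exact absurd hc.symm h1
  | succ n ih =>
    intro f s hs hr hV hc h0 he
    have lt_of : ∀ (f : C(ℝ, X)) (a b : ℝ), a ≤ b → cl f a b = cl β 0 1 → a < b := by
      intro f a b hab hc
      rcases hab.eq_or_lt with e | e
      · subst e; rw [cl_self] at hc; exact absurd hc.symm h1
      · exact e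
    have hab := lt_of f _ _ (hs (Nat.zero_le (n+1))) hc
    rcases n with _ | n
    · exact base_case X hX β hβ hab (hr 0 (by omega)) hV hc h0 he
    · have hn : NCst f (s 0) (s (n+1+1)) := NCst_of_blocks (n+1+1) hr
      have hA : s n ≤ s (n+1) := hs (by omega)
      have hD : s (n+1) ≤ s (n+1+1) := hs (by omega)
      have h0n : s 0 ≤ s n := hs (by omega)
      obtain ⟨p, q, hp1, hp2, hq1, hq2, hM, hmax⟩ := exists_max_match f hA hD
      obtain ⟨g, hg, him, hfg⟩ := hM.homeo hn (by linarith) hD (by linarith) hq2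
      have hr1 := hr n (by omega)
      have hr2 := hr (n+1) (by omega)
      have hV2 := (hV.to_bp hab hn (s (n+1))).cancel hab hn hU (by linarith) hp2 hq1 hq2
        (hr2.mono le_rfl hq2) hg him hfg
      have hpq : p ≤ q := hp2.trans hq1
      have hfpq : f p = f q := hM.ends_eq.1
      have hclpq : cl f p q = 1 := by rw [← cl_mul f p (s (n+1)), hM.cl_eq]
      let κ := clpk p q
      let f' := clps f p q hfpq
      have hκ : Continuous κ := clpk_cont p q
      have hm : Monotone κ := clpk_mono p q
      have hf' : ∀ x, (x ≤ p ∨ q ≤ x) → f' (κ x) = f x := fun x hx => clps_eq hpq hfpq hx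
      have κl : ∀ x, x ≤ p → κ x = x := fun x hx => clpk_left hpq hx
      have κr : ∀ x, q ≤ x → κ x = p + (x - q) := fun x hx => clpk_right hpq hx
      have κq : κ q = p := by rw [κr q le_rfl]; ring
      have κp : κ p = p := κl p le_rfl
      have clx : ∀ u v, u ≤ p → q ≤ v → cl f' (κ u) (κ v) = cl f u v := by
        intro u v hu hv
        have e1 := cl_push (f := f) (f' := f') hκ hu (fun x _ h => hf' x (Or.inl h))
        have e2 := cl_push (f := f) (f' := f') hκ hv (fun x h _ => hf' x (Or.inr h))
        rw [κp] at e1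
        rw [κq] at e2
        rw [← cl_mul f' (κ u) p, ← e1, ← e2, ← cl_mul f u p v, ← cl_mul f p q v, hclpq, one_mul]
      have hV3 := hV2.push hab.le f' κ hκ hm (fun x _ _ h => hf' x h) (Or.inl hn)
      rw [κq, κp, Set.image_empty] at hV3
      have hcl' : cl f' (κ (s 0)) (κ (s (n+1+1))) = cl β 0 1 := by
        rw [clx _ _ (by linarith) hq2, hc]
      have hab' := lt_of f' _ _ (hm hab.le) hcl'
      have hV4 := hV3.to_left hab'
      let s' : ℕ → ℝ := fun i => if i ≤ n then κ (s i) else κ (s (n+1+1))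
      have s0 : s' 0 = κ (s 0) := by simp [s']
      have s1 : s' (n+1) = κ (s (n+1+1)) := by simp [s']
      refine ih f' s' ?_ ?_ (by rw [s0, s1]; exact hV4) (by rw [s0, s1]; exact hcl')
        (by rw [s0, hf' _ (Or.inl (by linarith)), h0]) (by rw [s1, hf' _ (Or.inr hq2), he])
      · apply monotone_nat_of_le_succ
        intro i
        by_cases hi : i + 1 ≤ n
        · simp only [s', hi, show i ≤ n by omega, if_true]; exact hm (hs (by omega))
        · by_cases hi' : i ≤ n
          · simp only [s', hi, hi', if_true, if_false]; exact hm (hs (by omega))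
          · simp only [s', hi, hi', if_false]; exact le_rfl
      · intro i hi
        by_cases hin : i + 1 ≤ n
        · simp only [s', hin, show i ≤ n by omega, if_true]
          have : s (i+1) ≤ s n := hs hin
          exact (hr i (by omega)).push hκ hm (hs (by omega)) (fun x _ h => hf' x (Or.inl (by linarith)))
        · have : i = n := by omega
          subst this
          rw [s1]
          have : s' i = κ (s i) := by simp [s']
          rw [this]
          intro u v hu huv hv hfe hce
          have R1 := (hr1.mono le_rfl hp2).push (f' := f') hκ hm hp1 (fun x _ h => hf' x (Or.inl h))
          have R2 := (hr2.mono hq1 le_rfl).push (f' := f') hκ hm hq2 (fun x h _ => hf' x (Or.inr h))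
          rw [κp] at R1
          rw [κq] at R2
          by_cases hvp : v ≤ p
          · exact R1 u v hu huv hvp hfe hce
          by_cases hup : p ≤ u
          · exact R2 u v hup huv hv hfe hce
          push Not at hvp hup
          have eu := κl u hup.le
          have ev : κ (v - p + q) = v := by rw [κr _ (by linarith)]; ring
          have hfe' : f u = f (v - p + q) := by
            rw [← hf' u (Or.inl hup.le), ← hf' (v - p + q) (Or.inr (by linarith)), eu, ev]; exact hfe
          have hce' : cl f u (v - p + q) = 1 := by
            rw [← clx u _ hup.le (by linarith), eu, ev]; exact hce
          have hu' : s i ≤ u := by rw [κl _ hp1] at hu; exact hu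
          have hv' : v - p + q ≤ s (i+1+1) := by rw [κr _ hq2] at hv; linarith
          obtain ⟨g, hg, him, hfg⟩ := fold_theorem X hX f (p := u) (c := s (i+1)) (q := v - p + q)
            (by linarith) (by linarith) hfe' hce' (hr1.mono hu' le_rfl) (hr2.mono le_rfl hv')
          have := hmax u (v - p + q) hu' (by linarith) (by linarith) hv'
            (Match.of_anti (by linarith) g hg.antitoneOn him hfg)
          linarith

end pass2
end

noncomputable section

section initial
open HasBar
variable {Y : Type*} [TopologicalSpace Y]

/-- extension of a path to the real line -/
def extR {a b : ℝ} (hab : a ≤ b) (α : C(Set.Icc a b, Y)) : C(ℝ, Y) :=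
  ⟨fun x => α (Set.projIcc a b hab x), α.continuous.comp continuous_projIcc⟩

theorem extR_apply {a b : ℝ} (hab : a ≤ b) (α : C(Set.Icc a b, Y)) (x : Set.Icc a b) :
    extR hab α x = α x := by simp [extR]

theorem red_iff [PathConnectedSpace Y] {c d : ℝ} (g : C(Set.Icc c d, Y)) (f : C(ℝ, Y)) (h : ∀ u : Set.Icc c d, g u = f u) :
    (∀ (s t : Set.Icc c d) (hst : (s : ℝ) < (t : ℝ)) (he : g s = g t),
    ¬ ((subPath g s t hst.le).cast rfl he).Homotopic (Path.refl (g s))) ↔ Red f c d := by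
  have key : ∀ (s t : Set.Icc c d) (hst : (s : ℝ) < (t : ℝ)) (he : g s = g t),
    ((subPath g s t hst.le).cast rfl he).Homotopic (Path.refl (g s)) ↔ cl f s t = 1 := by
    intro s t hst he
    rw [← kl_eq_iff, kl_refl]
    have : kl ((subPath g s t hst.le).cast rfl he) = cl f s t := by
      apply kl_congr
      intro u
      simp only [Path.cast_coe, Path.map_coe, Function.comp, lin_apply]
      simp only [subPath, Path.coe_mk_mk]
      rw [h]
      congr 1
      simp only
      ring
    rw [this]
  constructor
  · intro H s t h1 h2 h3 h4
    have hs : s ∈ Set.Icc c d := ⟨h1, by linarith⟩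
    have ht : t ∈ Set.Icc c d := ⟨by linarith, h3⟩
    have he : g ⟨s, hs⟩ = g ⟨t, ht⟩ := by rw [h, h]; exact h4
    have := H ⟨s, hs⟩ ⟨t, ht⟩ h2 he
    rwa [key _ _ h2] at this
  · intro H s t hst he
    rw [key _ _ hst]
    refine H s t s.2.1 hst t.2.2 ?_
    rw [← h, ← h]; exact he

theorem match_of_equiv {c d c' d' : ℝ} (hcd : c ≤ d) (f : C(ℝ, Y)) (g : C(Set.Icc c d, Y)) (g' : C(Set.Icc c' d', Y))
    (hg : ∀ u : Set.Icc c d, g u = f u) (hg' : ∀ u : Set.Icc c' d', g' u = f u)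
    (h : PathEquivOn g (reverseIcc g')) : Match f c d c' d' := by
  obtain ⟨γ, hγ, hE⟩ := h
  have ev : ∀ u : Set.Icc c d, f u = f (c' + d' - γ u) := by
    intro u
    rw [← hg, hE]
    simp only [reverseIcc, ContinuousMap.coe_mk]
    rw [hg']
  have pr : ∀ x (hx : x ∈ Set.Icc c d), Set.projIcc c d hcd x = ⟨x, hx⟩ := fun x hx => Set.projIcc_of_mem hcd hx
  refine Match.of_anti hcd (fun x => c' + d' - γ (Set.projIcc c d hcd x)) ?_ ?_ ?_
  · intro x hx y hy hxy
    have := hγ.monotone (Set.monotone_projIcc hcd hxy)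
    have : (γ (Set.projIcc c d hcd x) : ℝ) ≤ γ (Set.projIcc c d hcd y) := this
    simp only
    linarith
  · ext y
    constructor
    · rintro ⟨x, hx, rfl⟩
      have := (γ (Set.projIcc c d hcd x)).2
      exact ⟨by linarith [this.2], by linarith [this.1]⟩
    · intro hy
      let z : Set.Icc c' d' := ⟨c' + d' - y, by linarith [hy.2], by linarith [hy.1]⟩
      refine ⟨γ.symm z, (γ.symm z).2, ?_⟩
      simp only
      rw [Set.projIcc_val, Homeomorph.apply_symm_apply]
      simp only [z]; ring
  · intro x hx
    rw [pr x hx]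
    exact (ev ⟨x, hx⟩).symm

theorem prod4_sgn {x x' y y' X X' Z Z' : ℝ} (h1 : 0 < (x - y) * (X - Z)) (h2 : 0 < (x - y') * (X - Z'))
    (h3 : 0 < (x' - y) * (X' - Z)) (h4 : 0 < (x' - y') * (X' - Z')) (h : 0 ≤ prod4 X X' Z Z') :
    0 ≤ prod4 x x' y y' := by
  have : 0 < prod4 x x' y y' * prod4 X X' Z Z' := by
    have := mul_pos (mul_pos h1 h2) (mul_pos h3 h4)
    refine lt_of_lt_of_eq this ?_
    unfold prod4; ring
  rcases h.eq_or_lt with e | e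
  · rw [← e] at this; simp at this
  · exact (pos_of_mul_pos_left this e.le).le

instance pairBar {n : ℕ} : HasBar (Fin n × Bool) where
  bar k := (k.1, !k.2)
  bar_bar k := by simp
  bar_ne k := by intro h; have := congrArg Prod.snd h; simp at this

theorem initial [PathConnectedSpace Y] [T2Space Y] {a b : ℝ} (hab : a ≤ b) (α : C(Set.Icc a b, Y)) (U : Set Y)
    (h : HasCancellation hab α U) : ∃ (U' : Set Y) (n : ℕ) (s : ℕ → ℝ), U' ⊆ U ∧ IsClosed U' ∧ s 0 = a ∧ s n = b ∧
      Monotone s ∧ 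
      (∀ i < n, Red (extR hab α) (s i) (s (i+1)) ∨ ∀ x, s i ≤ x → x ≤ s (i+1) → (extR hab α) x = (extR hab α) (s i)) ∧
      Valid (extR hab α) U' (s 0) (s n) (s 0) (s 0) ∅ := by
  classical
  obtain ⟨n, t, C, Cb, R, φ, S, ep, t0, tn, tlt, hun, d1, d2, d3, hφ, hS, hred, hRU, hE, hdis⟩ := h
  set f := extR hab α with hf
  have hres : ∀ c d (u : Set.Icc c d), resIcc α hab c d u = f u := fun c d u => rfl
  let s : ℕ → ℝ := fun i => t (min i n)
  have hs : Monotone s := by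
    apply monotone_nat_of_le_succ
    intro i
    by_cases hi : i < n
    · simp only [s]; rw [min_eq_left hi.le, min_eq_left (by omega : i + 1 ≤ n)]; exact (tlt i hi).le
    · simp only [s]; rw [min_eq_right (by omega), min_eq_right (by omega)]
  have st : ∀ i ≤ n, s i = t i := fun i hi => by simp only [s]; rw [min_eq_left hi]
  have s0 : s 0 = a := by rw [st 0 (by omega), t0]
  have sn : s n = b := by rw [st n le_rfl, tn]
  have slt : ∀ i < n, s i < s (i+1) := fun i hi => by
    rw [st i hi.le, st (i+1) hi]; exact tlt i hi
  have tF : ∀ i : Fin n, t i.1 = s i.1 ∧ t (i.1+1) = s (i.1+1) := fun i =>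
    ⟨(st _ i.2.le).symm, (st _ i.2).symm⟩
  simp only [(tF _).1, (tF _).2] at hS
  replace hred : ∀ i : Fin n, IsReducedOn (resIcc α hab (s i.1) (s (i.1+1))) := fun i => by
    rw [← (tF i).1, ← (tF i).2]; exact hred i
  replace hRU : ∀ i ∈ R, ∀ x ∈ Set.Icc (s i.1) (s (i.1+1)), f x ∈ U := fun i hi x hx => by
    rw [← (tF i).1, ← (tF i).2] at hx; exact hRU i hi ⟨x, hx⟩
  replace hE : ∀ i ∈ C, PathEquivOn (resIcc α hab (s i.1) (s (i.1+1)))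
      (reverseIcc (resIcc α hab (s (φ i).1) (s ((φ i).1+1)))) := fun i hi => by
    rw [← (tF i).1, ← (tF i).2, ← (tF (φ i)).1, ← (tF (φ i)).2]; exact hE i hi
  let U' : Set Y := ⋃ i : R, f '' Set.Icc (s i.1.1) (s (i.1.1+1))
  have hU' : IsClosed U' := by
    apply isClosed_iUnion_of_finite
    intro i
    exact (isCompact_Icc.image f.continuous).isClosed
  refine ⟨U', n, s, ?_, hU', s0, sn, hs, ?_, ?_⟩
  · intro y hy
    obtain ⟨i, x, hx, rfl⟩ := Set.mem_iUnion.1 hy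
    exact hRU i i.2 x hx
  · intro i hi
    rcases hred ⟨i, hi⟩ with ⟨c, hc⟩ | hr
    · right
      intro x h1 h2
      exact (hc ⟨x, h1, h2⟩).trans (hc ⟨s i, le_rfl, h1.trans h2⟩).symm
    · left
      exact (red_iff _ f (hres _ _)).1 hr
  · -- the index function
    let e : Fin n × Bool → Option (Fin n) := fun k =>
      if k.2 = false then (if k.1 ∈ Cb then none else some k.1) else (if k.1 ∈ C then some (φ k.1) else none)
    let l : Fin n × Bool → ℝ := fun k => (e k).elim a (fun i => s i.1)
    let r : Fin n × Bool → ℝ := fun k => (e k).elim a (fun i => s (i.1+1))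
    have hcase : ∀ k, (e k = none ∧ l k = a ∧ r k = a) ∨ ∃ i : Fin n, e k = some i ∧ l k = s i.1 ∧ r k = s (i.1+1) := by
      intro k
      rcases he : e k with _ | i
      · left; simp [l, r, he]
      · right; exact ⟨i, rfl, by simp [l, he], by simp [r, he]⟩
    have CnCb : ∀ i, i ∈ C → i ∉ Cb := fun i h h' => Set.disjoint_left.1 d1 h h'
    have CnR : ∀ i, i ∈ C → i ∉ R := fun i h h' => Set.disjoint_left.1 d2 h h'
    have RnCb : ∀ i, i ∈ R → i ∉ Cb := fun i h h' => Set.disjoint_left.1 d3 h' h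
    have cases3 : ∀ i, i ∈ C ∨ i ∈ Cb ∨ i ∈ R := by
      intro i
      have : i ∈ C ∪ Cb ∪ R := hun ▸ Set.mem_univ i
      rcases this with (h | h) | h <;> tauto
    have einj : ∀ k m i, e k = some i → e m = some i → k = m := by
      rintro ⟨k, k2⟩ ⟨m, m2⟩ i hk hm
      have := fun x (hx : x ∈ C) => hφ.mapsTo hx
      cases k2 <;> cases m2 <;> simp [e] at hk hm
      · rw [hk.2, hm.2]
      · rw [← hm.2] at hk; exact absurd (hk.2 ▸ this m hm.1) hk.1
      · rw [← hk.2] at hm; exact absurd (hm.2 ▸ this k hk.1) hm.1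
      · rw [hφ.injOn hk.1 hm.1 (hk.2.trans hm.2.symm)]
    have esurj : ∀ i, ∃ k, e k = some i := by
      intro i
      by_cases hi : i ∈ Cb
      · obtain ⟨j, hj, rfl⟩ := hφ.surjOn hi
        exact ⟨(j, true), by simp [e, hj]⟩
      · exact ⟨(i, false), by simp [e, hi]⟩
    have as : ∀ i, a ≤ s i := fun i => s0 ▸ hs (Nat.zero_le i)
    refine ⟨Fin n × Bool, inferInstance, inferInstance, l, r, ?_, ?_⟩
    · rw [s0, sn]
      refine ⟨?_, ?_, ?_, ?_, ?_, ?_, ?_⟩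
      · intro k
        rcases hcase k with ⟨-, h1, -⟩ | ⟨i, -, h1, -⟩
        · rw [h1]
        · rw [h1]; exact as _
      · intro k
        rcases hcase k with ⟨-, h1, h2⟩ | ⟨i, -, h1, h2⟩
        · rw [h1, h2]
        · rw [h1, h2]; exact hs (by omega)
      · intro k
        rcases hcase k with ⟨-, h1, h2⟩ | ⟨i, -, h1, h2⟩
        · rw [h2]; exact hab
        · rw [h2, ← sn]; exact hs i.2
      · intro k m hkm
        rcases hcase k with ⟨-, h1, h2⟩ | ⟨i, e1, h1, h2⟩
        · left; rw [h1, h2]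
        rcases hcase m with ⟨-, h3, h4⟩ | ⟨j, e2, h3, h4⟩
        · right; left; rw [h3, h4]
        right; right
        rw [h1, h2, h3, h4]
        have : i ≠ j := fun h => hkm (einj k m i e1 (h ▸ e2))
        rcases lt_or_gt_of_ne this with d | d
        · left; exact hs d
        · right; exact hs d
      · intro k
        rcases hcase k with ⟨-, h1, h2⟩ | ⟨i, e1, h1, h2⟩
        · left; rw [h1, h2]
        · right; right; rw [h1]; exact as _
      · intro x h1 h2
        rcases h1.eq_or_lt with rfl | h1
        · exact Or.inl ⟨le_rfl, le_rfl⟩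
        right
        have hex : ∃ i, x ≤ s i := ⟨n, sn ▸ h2⟩
        have hi := Nat.find_spec hex
        have hmin := fun j => Nat.find_min hex (m := j)
        have hin : Nat.find hex ≤ n := Nat.find_min' hex (sn ▸ h2)
        obtain ⟨i, hi'⟩ : ∃ i, Nat.find hex = i + 1 := by
          rcases h0 : Nat.find hex with _ | i
          · rw [h0, s0] at hi; linarith
          · exact ⟨i, rfl⟩
        rw [hi'] at hi hmin hin
        obtain ⟨k, hk⟩ := esurj ⟨i, hin⟩
        refine ⟨k, ?_, ?_⟩
        · simp only [l, hk, Option.elim]; exact (not_le.1 (hmin i (by omega))).le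
        · simp only [r, hk, Option.elim]; exact hi
      · intro x hx; exact absurd hx (Set.notMem_empty x)
    · have triv : ∀ i, i ∉ C → Tv f U' l r (i, false) := by
        intro i hi
        have h2 : TI f U' (l (i, true)) (r (i, true)) := by left; simp [l, r, e, hi]
        refine ⟨?_, h2⟩
        rcases cases3 i with h | h | h
        · exact absurd h hi
        · left; simp [l, r, e, h]
        · have e1 : l (i, false) = s i.1 := by simp [l, e, RnCb i h]
          have e2 : r (i, false) = s (i.1+1) := by simp [r, e, RnCb i h]
          rw [e1, e2, TI_iff (hs (by omega))]
          right
          intro x h1 h2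
          exact Set.mem_iUnion.2 ⟨⟨i, h⟩, x, ⟨h1, h2⟩, rfl⟩
      have lC : ∀ i, i ∈ C → l (i, false) = s i.1 ∧ r (i, false) = s (i.1+1) ∧ l (i, true) = s (φ i).1 ∧ r (i, true) = s ((φ i).1+1) := by
        intro i hi
        simp [l, r, e, hi, CnCb i hi]
      apply PairOK.of_rep {k | k.2 = false}
      · rintro ⟨i, b⟩
        cases b
        · left; rfl
        · right; rfl
      · rintro ⟨i, b⟩ hb
        have hb : b = false := hb
        subst hb
        by_cases hi : i ∈ C
        · right
          obtain ⟨e1, e2, e3, e4⟩ := lC i hi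
          have : bar (i, false) = (i, true) := rfl
          rw [this, e1, e2, e3, e4]
          exact match_of_equiv (hs (by omega)) f _ _ (hres _ _) (hres _ _) (hE i hi)
        · exact Or.inl (triv i hi)
      · rintro ⟨i, b⟩ hb ⟨j, b'⟩ hb' hne -
        have hb : b = false := hb
        have hb' : b' = false := hb'
        subst hb hb'
        by_cases hi : i ∈ C
        swap
        · exact Or.inl (triv i hi)
        by_cases hj : j ∈ C
        swap
        · exact Or.inr (Or.inl (triv j hj))
        right; right
        obtain ⟨e1, -, e3, -⟩ := lC i hi
        obtain ⟨e1', -, e3', -⟩ := lC j hj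
        have x1 : bar (i, false) = (i, true) := rfl
        have x2 : bar (j, false) = (j, true) := rfl
        rw [x1, x2, e1, e3, e1', e3']
        have hij : i ≠ j := by rintro rfl; exact hne rfl
        have sep : ∀ (i j : Fin n) (x y : ℝ), i ≠ j → x ∈ Set.Ioo (s i.1) (s (i.1+1)) → y ∈ Set.Ioo (s j.1) (s (j.1+1)) →
            0 < (s i.1 - s j.1) * (x - y) := by
          intro i j x y hij hx hy
          rcases lt_or_gt_of_ne hij with d | d
          · have h1 : s (i.1+1) ≤ s j.1 := hs d
            exact mul_pos_of_neg_of_neg (by linarith [hx.1, hx.2]) (by linarith [hx.2, hy.1])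
          · have h1 : s (j.1+1) ≤ s i.1 := hs d
            exact mul_pos (by linarith [hy.1, hy.2]) (by linarith [hy.2, hx.1])
        obtain ⟨⟨pi, -, hpi⟩, up1, hep1, hi1, hi2⟩ := hS i hi
        obtain ⟨⟨pj, -, hpj⟩, up2, hep2, hj1, hj2⟩ := hS j hj
        have prei : IsPreconnected (S i) := hpi ▸ isPreconnected_range pi.continuous
        have prej : IsPreconnected (S j) := hpj ▸ isPreconnected_range pj.continuous
        have cli : IsClosed (S i) := hpi ▸ (isCompact_range pi.continuous).isClosed
        have clj : IsClosed (S j) := hpj ▸ (isCompact_range pj.continuous).isClosed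
        have m1 : ((ep i).1.1, (0:ℝ)) ∈ S i := by
          have : (ep i).1.2 = 0 := hi1.2
          rw [← this, hpi]; exact ⟨0, pi.source⟩
        have m2 : ((ep i).2.1, (0:ℝ)) ∈ S i := by
          have : (ep i).2.2 = 0 := hi2.2
          rw [← this, hpi]; exact ⟨1, pi.target⟩
        have m3 : ((ep j).1.1, (0:ℝ)) ∈ S j := by
          have : (ep j).1.2 = 0 := hj1.2
          rw [← this, hpj]; exact ⟨0, pj.source⟩
        have m4 : ((ep j).2.1, (0:ℝ)) ∈ S j := by
          have : (ep j).2.2 = 0 := hj2.2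
          rw [← this, hpj]; exact ⟨1, pj.target⟩
        have cr := crossing (S i) (S j) prei prej cli clj up1 up2 (hdis i hi j hj hij) m1 m2 m3 m4
        refine prod4_sgn (sep _ _ _ _ hij hi1.1 hj1.1) (sep _ _ _ _ ?_ hi1.1 hj2.1) (sep _ _ _ _ ?_ hi2.1 hj1.1)
          (sep _ _ _ _ ?_ hi2.1 hj2.1) cr
        · intro h; exact CnCb i hi (h ▸ hφ.mapsTo hj)
        · intro h; exact CnCb j hj (h ▸ hφ.mapsTo hi)
        · intro h; exact hij (hφ.injOn hi hj h)

end initial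
end

noncomputable section

section final
open HasBar

theorem IPart.sort {K : Type} [Finite K] {a b : ℝ} {B : Set ℝ} {l r : K → ℝ} (hab : a < b) (h : IPart a b a a B l r) :
    ∃ (n : ℕ) (t : ℕ → ℝ) (κ : Fin n → K), t 0 = a ∧ t n = b ∧ (∀ i, i < n → t i < t (i+1)) ∧
      (∀ i : Fin n, l (κ i) = t i.1 ∧ r (κ i) = t (i.1+1)) ∧ ∀ k, l k < r k → ∃ i, κ i = k := by
  classical
  have := Fintype.ofFinite K
  let F : Finset ℝ := (Finset.univ.filter (fun k => l k < r k)).image l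
  have memF : ∀ y, y ∈ F ↔ ∃ k, l k < r k ∧ l k = y := by intro y; simp [F]
  let n := F.card
  let e : Fin n ↪o ℝ := F.orderEmbOfFin rfl
  have emem : ∀ i, e i ∈ F := fun i => F.orderEmbOfFin_mem rfl i
  have esurj : ∀ y ∈ F, ∃ i, e i = y := by
    intro y hy
    have : y ∈ Set.range e := by rw [Finset.range_orderEmbOfFin]; exact hy
    exact this
  choose κ hκ1 hκ2 using fun i => (memF _).1 (emem i)
  have covx : ∀ x, a < x → x ≤ b → ∃ k, l k ≤ x ∧ x ≤ r k ∧ l k < r k := by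
    intro x h1 h2
    rcases h.cov_nd hab x h1.le h2 with hh | hh
    · linarith [hh.1, hh.2]
    · exact hh
  have hn : 0 < n := by
    obtain ⟨k, -, -, hk⟩ := covx b hab le_rfl
    exact Finset.card_pos.2 ⟨l k, (memF _).2 ⟨k, hk, rfl⟩⟩
  let t : ℕ → ℝ := fun i => if hi : i < n then e ⟨i, hi⟩ else b
  have tl : ∀ i : Fin n, t i.1 = e i := fun i => by simp [t]
  have tn : t n = b := by simp [t]
  have key : ∀ m, l m < r m → ∀ i : Fin n, l m < t (i.1+1) → l m ≤ e i := by
    intro m hm i hlt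
    obtain ⟨j, hj⟩ := esurj (l m) ((memF _).2 ⟨m, hm, rfl⟩)
    rw [← hj] at hlt ⊢
    apply e.monotone
    by_contra hc
    push Not at hc
    by_cases hi : i.1 + 1 < n
    · have : t (i.1+1) = e ⟨i.1+1, hi⟩ := tl ⟨i.1+1, hi⟩
      rw [this] at hlt
      have := e.lt_iff_lt.1 hlt
      have h1 : j.1 < i.1+1 := this
      have h2 : i.1 < j.1 := hc
      omega
    · have h2 : i.1 < j.1 := hc
      have := j.2
      omega
  have hr : ∀ i : Fin n, r (κ i) ≤ t (i.1+1) := by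
    intro i
    by_cases hi : i.1 + 1 < n
    · have e1 : t (i.1+1) = e ⟨i.1+1, hi⟩ := tl ⟨i.1+1, hi⟩
      rw [e1, ← hκ2]
      have hlt : e i < e ⟨i.1+1, hi⟩ := e.lt_iff_lt.2 (by show i.1 < i.1 + 1; omega)
      rw [← hκ2 i, ← hκ2 ⟨i.1+1, hi⟩] at hlt
      rcases h.pos (k := κ i) (m := κ ⟨i.1+1, hi⟩) (by intro hh; rw [← hh] at hlt; exact lt_irrefl _ hlt) (hκ1 _) (hκ1 _) with d | d
      · exact d
      · have := hκ1 ⟨i.1+1, hi⟩; linarith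
    · have : t (i.1+1) = b := by simp [t, hi]
      rw [this]; exact h.hb _
  have hr' : ∀ i : Fin n, r (κ i) = t (i.1+1) := by
    intro i
    by_contra hne
    have hlt : r (κ i) < t (i.1+1) := lt_of_le_of_ne (hr i) hne
    have htb : t (i.1+1) ≤ b := by
      by_cases hi : i.1 + 1 < n
      · have e1 : t (i.1+1) = e ⟨i.1+1, hi⟩ := tl ⟨i.1+1, hi⟩
        rw [e1, ← hκ2]; exact (h.hle _).trans (h.hb _)
      · have : t (i.1+1) = b := by simp [t, hi]
        rw [this]
    have ha := h.ha (κ i)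
    have hk := hκ1 i
    obtain ⟨m, h1, h2, h3⟩ := covx ((r (κ i) + t (i.1+1)) / 2) (by linarith) (by linarith)
    have h4 := key m h3 i (by linarith)
    rw [← hκ2] at h4
    have hmk : m ≠ κ i := by rintro rfl; linarith
    rcases h.pos hmk h3 hk with d | d <;> linarith
  refine ⟨n, t, κ, ?_, tn, ?_, ?_, ?_⟩
  · rw [tl ⟨0, hn⟩]
    refine le_antisymm ?_ (by rw [← hκ2]; exact h.ha _)
    by_contra hc
    push Not at hc
    have hb : e ⟨0, hn⟩ ≤ b := by rw [← hκ2]; exact (h.hle _).trans (h.hb _)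
    obtain ⟨m, h1, h2, h3⟩ := covx ((a + e ⟨0, hn⟩) / 2) (by linarith) (by linarith)
    obtain ⟨j, hj⟩ := esurj (l m) ((memF _).2 ⟨m, h3, rfl⟩)
    have : e ⟨0, hn⟩ ≤ e j := e.monotone (Fin.mk_le_of_le_val (Nat.zero_le _))
    linarith
  · intro i hi
    have h1 := hr' ⟨i, hi⟩
    have h2 := hκ1 ⟨i, hi⟩
    rw [hκ2, h1, ← tl] at h2
    exact h2
  · intro i
    exact ⟨by rw [hκ2, tl], hr' i⟩
  · intro k hk
    obtain ⟨i, hi⟩ := esurj (l k) ((memF _).2 ⟨k, hk, rfl⟩)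
    refine ⟨i, ?_⟩
    by_contra hne
    have h1 := hκ1 i
    have h2 := hκ2 i
    rcases h.pos hne h1 hk with d | d <;> linarith

/-- parabolic arcs -/
def parc (x y : ℝ) : Path ((x, 0) : ℝ × ℝ) (y, 0) where
  toFun u := (x + u * (y - x), (u * (y - x)) * ((1 - u) * (y - x)))
  continuous_toFun := by fun_prop
  source' := by simp
  target' := by simp

theorem parc_range {x y : ℝ} {z : ℝ × ℝ} (hxy : x < y) (hz : z ∈ Set.range (parc x y)) :
    x ≤ z.1 ∧ z.1 ≤ y ∧ z.2 = (z.1 - x) * (y - z.1) := by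
  obtain ⟨u, rfl⟩ := hz
  have h0 := u.2.1
  have h1 := u.2.2
  simp only [parc, Path.coe_mk_mk]
  refine ⟨?_, ?_, by ring⟩ <;> nlinarith

theorem parc_inj {x y : ℝ} (hxy : x < y) : Function.Injective (parc x y) := by
  intro u v h
  have := congrArg Prod.fst h
  simp only [parc, Path.coe_mk_mk] at this
  apply Subtype.ext
  have h2 : (u : ℝ) * (y - x) = v * (y - x) := by linarith
  exact mul_right_cancel₀ (by linarith) h2

theorem parc_disj {x y x' y' : ℝ} (hxy : x < y) (hxy' : x' < y') (h1 : x ≠ x') (h2 : x ≠ y') (h3 : y ≠ x') (h4 : y ≠ y')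
    (h : 0 ≤ prod4 x y x' y') : Disjoint (Set.range (parc x y)) (Set.range (parc x' y')) := by
  have A : ∀ {x y x' y' : ℝ}, x < y → x' < y' → x < x' → y ≠ x' → y ≠ y' → 0 ≤ prod4 x y x' y' → 
      ∀ s, x ≤ s → s ≤ y → x' ≤ s → s ≤ y' → (s - x) * (y - s) = (s - x') * (y' - s) → False := by
    intro x y x' y' hxy hxy' h1 h3 h4 h s s1 s2 s3 s4 he
    rcases lt_or_gt_of_ne h4 with d | d
    · have hx'y : x' < y := lt_of_le_of_ne (s3.trans s2) (Ne.symm h3)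
      have p1 : 0 < (x' - x) * (y' - x) := mul_pos (by linarith) (by linarith)
      have p2 : 0 < (y - x') * (y' - y) := mul_pos (by linarith) (by linarith)
      have := mul_pos p1 p2
      unfold prod4 at h
      nlinarith
    · have : (s - x') * (y' - s) < (s - x) * (y - s) := 
        mul_lt_mul'' (by linarith) (by linarith) (by linarith) (by linarith)
      linarith
  rw [Set.disjoint_left]
  intro z hz hz'
  obtain ⟨a1, a2, a3⟩ := parc_range hxy hz
  obtain ⟨b1, b2, b3⟩ := parc_range hxy' hz'
  rcases lt_or_gt_of_ne h1 with d | d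
  · exact A hxy hxy' d h3 h4 h z.1 a1 a2 b1 b2 (a3 ▸ b3)
  · exact A hxy' hxy d h2.symm h4.symm (by rw [prod4_comm]; exact h) z.1 b1 b2 a1 a2 (b3 ▸ a3)

variable {Y : Type*} [TopologicalSpace Y]

theorem equiv_of_anti {c d c' d' : ℝ} (f : C(ℝ, Y)) (g : C(Set.Icc c d, Y)) (g' : C(Set.Icc c' d', Y))
    (hg : ∀ u : Set.Icc c d, g u = f u) (hg' : ∀ u : Set.Icc c' d', g' u = f u) {k : ℝ → ℝ}
    (hk : StrictAntiOn k (Set.Icc c d)) (him : k '' Set.Icc c d = Set.Icc c' d')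
    (hf : ∀ x ∈ Set.Icc c d, f (k x) = f x) : PathEquivOn g (reverseIcc g') := by
  have mem : ∀ u : Set.Icc c d, k u ∈ Set.Icc c' d' := fun u => him ▸ ⟨u, u.2, rfl⟩
  let γ : Set.Icc c d → Set.Icc c' d' := fun u => ⟨c' + d' - k u, by linarith [(mem u).2], by linarith [(mem u).1]⟩
  have hγ : StrictMono γ := by
    intro u v huv
    have := hk u.2 v.2 huv
    show c' + d' - k u < c' + d' - k v
    linarith
  have hs : Function.Surjective γ := by
    intro w
    have : c' + d' - w.1 ∈ k '' Set.Icc c d := by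
      rw [him]; exact ⟨by linarith [w.2.2], by linarith [w.2.1]⟩
    obtain ⟨x, hx, he⟩ := this
    refine ⟨⟨x, hx⟩, Subtype.ext ?_⟩
    simp only [γ]; rw [he]; ring
  let o := StrictMono.orderIsoOfSurjective γ hγ hs
  refine ⟨o.toHomeomorph, fun u v huv => hγ huv, ?_⟩
  intro u
  rw [hg, ← hf u u.2]
  simp only [reverseIcc, ContinuousMap.coe_mk]
  rw [hg']
  congr 1
  have : (o.toHomeomorph u : ℝ) = c' + d' - k u := rfl
  simp only [this]; ring

theorem final_conv [PathConnectedSpace Y] {a b : ℝ} (hab : a < b) (β : C(Set.Icc a b, Y)) {U U' : Set Y} (hU : U' ⊆ U)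
    (hr : Red (extR hab.le β) a b) (hV : Valid (extR hab.le β) U' a b a a ∅) : HasCancellation hab.le β U := by
  classical
  obtain ⟨K, _, _, l, r, hP, hO⟩ := hV
  set f := extR hab.le β with hf
  have hres : ∀ c d (u : Set.Icc c d), resIcc β hab.le c d u = f u := fun c d u => rfl
  have hn : NCst f a b := by
    intro x y h1 h2 h3
    obtain ⟨z, hz, hne⟩ := hr.exists_ne h1 h2 h3
    exact ⟨z, ⟨hz.1.le, hz.2⟩, hne⟩
  obtain ⟨n, t, κ, t0, tn, tlt, hκ, hsurj⟩ := hP.sort hab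
  have κinj : Function.Injective κ := by
    intro i j hij
    have h1 := (hκ i).1
    rw [hij, (hκ j).1] at h1
    by_contra hne
    have hm : ∀ i j : ℕ, i < j → j ≤ n → t i < t j := by
      intro i j hij
      induction j, hij using Nat.le_induction with
      | base => intro h; exact tlt i h
      | succ j hj ih => intro h; exact (ih (by omega)).trans (tlt j h)
    rcases lt_or_gt_of_ne hne with d | d
    · exact absurd h1.symm (hm i j d j.2.le).ne
    · exact absurd h1 (hm j i d i.2.le).ne
  have ta : ∀ i : Fin n, a ≤ t i.1 := fun i => (hκ i).1 ▸ hP.ha _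
  have tb : ∀ i : Fin n, t (i.1+1) ≤ b := fun i => (hκ i).2 ▸ hP.hb _
  let T : Fin n → Prop := fun i => Tv f U' l r (κ i)
  have hφ : ∀ i, ∃ j, ¬ T i → κ j = bar (κ i) := by
    intro i
    by_cases hi : T i
    · exact ⟨i, fun h => absurd hi h⟩
    · obtain ⟨j, hj⟩ := hsurj _ (hO.nd hn hP hi).2
      exact ⟨j, fun _ => hj⟩
  choose φ hφ using hφ
  have Tφ : ∀ i, ¬ T i → ¬ T (φ i) := by
    intro i hi h
    have h : Tv f U' l r (κ (φ i)) := h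
    rw [hφ i hi] at h
    exact hi (by have := h.barr; rwa [bar_bar] at this)
  have φφ : ∀ i, ¬ T i → φ (φ i) = i := by
    intro i hi
    apply κinj
    rw [hφ _ (Tφ i hi), hφ i hi, bar_bar]
  have φne : ∀ i, ¬ T i → φ i ≠ i := by
    intro i hi h
    have := hφ i hi
    rw [h] at this
    exact bar_ne _ this.symm
  let md : Fin n → ℝ := fun i => (t i.1 + t (i.1+1)) / 2
  have mdm : ∀ i, md i ∈ Set.Ioo (t i.1) (t (i.1+1)) := fun i => by
    have := tlt i.1 i.2
    constructor <;> simp only [md] <;> linarith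
  have tm : ∀ i j : Fin n, i < j → t (i.1+1) ≤ t j.1 := by
    intro i j hij
    have hij : i.1 + 1 ≤ j.1 := hij
    have : ∀ k, i.1 + 1 ≤ k → k ≤ n → t (i.1+1) ≤ t k := by
      intro k hk
      induction k, hk using Nat.le_induction with
      | base => intro _; exact le_rfl
      | succ k hk ih => intro h; exact (ih (by omega)).trans (tlt k h).le
    exact this _ hij j.2.le
  have mdlt : ∀ i j : Fin n, i < j → md i < md j := fun i j h => by
    linarith [(mdm i).2, (mdm j).1, tm i j h]
  have mdne : ∀ i j : Fin n, i ≠ j → md i ≠ md j := fun i j h => by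
    rcases lt_or_gt_of_ne h with d | d
    · exact (mdlt i j d).ne
    · exact (mdlt j i d).ne'
  have sep : ∀ i j : Fin n, i ≠ j → 0 < (md i - md j) * (t i.1 - t j.1) := by
    intro i j h
    have := tlt i.1 i.2
    have := tlt j.1 j.2
    rcases lt_or_gt_of_ne h with d | d
    · have := tm i j d
      have := mdlt i j d
      exact mul_pos_of_neg_of_neg (by linarith) (by linarith)
    · have := tm j i d
      have := mdlt j i d
      exact mul_pos (by linarith) (by linarith)
  refine ⟨n, t, {i | ¬ T i ∧ i < φ i}, {i | ¬ T i ∧ φ i < i}, {i | T i}, φ, fun i => Set.range (parc (md i) (md (φ i))),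
    fun i => ((md i, 0), (md (φ i), 0)), t0, tn, tlt, ?_, ?_, ?_, ?_, ?_, ?_, ?_, ?_, ?_, ?_⟩
  · ext i
    simp only [Set.mem_union, Set.mem_ofPred_eq, Set.mem_univ, iff_true]
    by_cases hi : T i
    · exact Or.inr hi
    · rcases lt_or_gt_of_ne (φne i hi) with d | d
      · exact Or.inl (Or.inr ⟨hi, d⟩)
      · exact Or.inl (Or.inl ⟨hi, d⟩)
  · exact Set.disjoint_left.2 fun i h h' => lt_asymm h.2 h'.2
  · exact Set.disjoint_left.2 fun i h h' => h.1 h'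
  · exact Set.disjoint_left.2 fun i h h' => h.1 h'
  · refine ⟨?_, ?_, ?_⟩
    · rintro i ⟨h1, h2⟩
      exact ⟨Tφ i h1, by rw [φφ i h1]; exact h2⟩
    · rintro i ⟨h1, h2⟩ j ⟨h3, h4⟩ he
      rw [← φφ i h1, he, φφ j h3]
    · rintro i ⟨h1, h2⟩
      exact ⟨φ i, ⟨Tφ i h1, by rw [φφ i h1]; exact h2⟩, φφ i h1⟩
  · rintro i ⟨h1, h2⟩
    have hlt := mdlt _ _ h2
    refine ⟨⟨parc _ _, parc_inj hlt, rfl⟩, ?_, ?_, ⟨mdm i, rfl⟩, ⟨mdm (φ i), rfl⟩⟩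
    · intro q hq
      obtain ⟨a1, a2, a3⟩ := parc_range hlt hq
      rw [a3]; exact mul_nonneg (by linarith) (by linarith)
    · ext q
      constructor
      · rintro ⟨hq, h0⟩
        obtain ⟨a1, a2, a3⟩ := parc_range hlt hq
        have h0 : q.2 = 0 := h0
        rw [h0] at a3
        rcases mul_eq_zero.1 a3.symm with d | d
        · left; exact Prod.ext (by simp only; linarith) h0
        · right; exact Prod.ext (by simp only; linarith) h0
      · rintro (rfl | rfl)
        · exact ⟨⟨0, (parc _ _).source⟩, rfl⟩
        · exact ⟨⟨1, (parc _ _).target⟩, rfl⟩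
  · intro i
    right
    exact (red_iff _ f (hres _ _)).2 (hr.mono (ta i) (tb i))
  · intro i hi u
    have h1 : TI f U' (l (κ i)) (r (κ i)) := hi.1
    rw [(hκ i).1, (hκ i).2, TI_iff (tlt i.1 i.2).le] at h1
    rcases h1 with h1 | h1
    · exact absurd h1 (tlt i.1 i.2).ne
    · exact hU (h1 u u.2.1 u.2.2)
  · rintro i ⟨h1, h2⟩
    have hM := (hO.mt (κ i)).resolve_left h1
    rw [← hφ i h1, (hκ i).1, (hκ i).2, (hκ (φ i)).1, (hκ (φ i)).2] at hM
    obtain ⟨k, hk, him, hfk⟩ := hM.homeo hn (ta i) (tb i) (ta _) (tb _)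
    exact equiv_of_anti f _ _ (hres _ _) (hres _ _) hk him hfk
  · rintro i ⟨h1, h2⟩ j ⟨h3, h4⟩ hij
    have hij2 : i ≠ φ j := by rintro rfl; rw [φφ j h3] at h2; exact lt_asymm h2 h4
    have hij3 : φ i ≠ j := by rintro rfl; rw [φφ i h1] at h4; exact lt_asymm h2 h4
    have hij4 : φ i ≠ φ j := by intro h; apply hij; rw [← φφ i h1, h, φφ j h3]
    refine parc_disj (mdlt _ _ h2) (mdlt _ _ h4) (mdne _ _ hij) (mdne _ _ hij2) (mdne _ _ hij3) (mdne _ _ hij4) ?_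
    have hnc := ((hO.nc (κ i) (κ j) (fun h => hij (κinj h).symm)
      (fun h => hij3 (κinj (by rw [hφ i h1, h])))).resolve_left h1).resolve_left h3
    rw [← hφ i h1, ← hφ j h3, (hκ _).1, (hκ _).1, (hκ _).1, (hκ _).1] at hnc
    exact prod4_sgn (sep _ _ hij) (sep _ _ hij2) (sep _ _ hij3) (sep _ _ hij4) hnc

end final
end

/-- Let `X ⊆ ℝ²` be path-connected with empty interior (hence
one-dimensional), with basepoint `x₀ ∈ X`, and let `U ⊆ X`. Let `α : ([a,b],{a,b}) → (X,x₀)`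
be a loop with `1 ≠ [α] ∈ π₁(X,x₀)`. If `α` has a cancellation relative to `U` and `β` is a
reduced loop based at `x₀` that is path-homotopic to `α`, then `β` has a cancellation
relative to `U`. -/
theorem statement8 (X : Set (ℝ × ℝ)) (hX : IsPathConnected X) (hdim : interior X = ∅)
    (x₀ : ↥X) (U : Set ↥X) {a b : ℝ} (hab : a ≤ b) (α : C(Set.Icc a b, ↥X))
    (ha : α ⟨a, Set.left_mem_Icc.mpr hab⟩ = x₀) (hb : α ⟨b, Set.right_mem_Icc.mpr hab⟩ = x₀)
    (β : Path x₀ x₀) (hβred : IsReducedOn β.toContinuousMap)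
    (hβα : ((toPathIcc hab α).cast ha.symm hb.symm).Homotopic β)
    (hess : ¬ β.Homotopic (Path.refl x₀))
    (hcanc : HasCancellation hab α U) :
    HasCancellation zero_le_one β.toContinuousMap U := by
  have : PathConnectedSpace ↥X := isPathConnected_iff_pathConnectedSpace.1 hX
  have h01 : (0:ℝ) < 1 := zero_lt_one
  let g : C(Set.Icc (0:ℝ) 1, ↥X) := β.toContinuousMap
  let βe := extR h01.le g
  have hg : ∀ u : Set.Icc (0:ℝ) 1, g u = βe u := fun u => (extR_apply h01.le g u).symm
  have hkl : kl β = cl βe 0 1 := by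
    apply kl_congr
    intro u
    rw [Path.map_coe, Function.comp, lin_apply]
    have : (0:ℝ) + u * (1 - 0) = u := by ring
    rw [this, ← hg u]; rfl
  have hne : cl βe 0 1 ≠ 1 := by
    rw [← hkl]
    intro h
    apply hess
    rw [← kl_eq_iff, kl_refl, h]
  have hβe : Red βe 0 1 := by
    rcases hβred with ⟨c, hc⟩ | hr
    · exfalso
      apply hess
      have : β = Path.refl x₀ := by
        apply Path.ext
        funext u
        have h1 : β u = c := hc u
        have h2 : β 0 = c := hc 0
        rw [h1, ← h2, β.source]; rfl
      rw [this]
    · exact (red_iff g βe hg).1 hr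
  obtain ⟨U', n, s, hUU, hUc, s0, sn, hs, hbl, hV⟩ := initial hab α U hcanc
  have e0 : extR hab α (s 0) = x₀ := by rw [s0, ← ha]; exact extR_apply hab α ⟨a, _⟩
  have e1 : extR hab α (s n) = x₀ := by rw [sn, ← hb]; exact extR_apply hab α ⟨b, _⟩
  have hcl : cl (extR hab α) (s 0) (s n) = cl βe 0 1 := by
    rw [← hkl, ← (kl_eq_iff _ _).2 hβα, s0, sn]
    symm
    apply kl_congr
    intro u
    rw [Path.map_coe, Function.comp, lin_apply, Path.cast_coe]
    have hmem : a + u * (b - a) ∈ Set.Icc a b := by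
      have := u.2.1; have := u.2.2
      constructor <;> nlinarith
    rw [extR_apply hab α ⟨_, hmem⟩]
    simp only [toPathIcc, subPath, Path.coe_mk_mk]
    congr 2
    ring
  obtain ⟨f', s', hs', hr', hV', hcl', h0', h1'⟩ := pass1 _ _ _ n _ s hs hbl hV hcl e0 e1
  have b0 : βe 0 = x₀ := by
    have := hg ⟨0, by simp⟩
    rw [← this]; exact β.source
  have b1 : βe 1 = x₀ := by
    have := hg ⟨1, by simp⟩
    rw [← this]; exact β.target
  have hfin := pass2 X hdim βe hβe hUc hne n f' s' hs' hr' hV' hcl' (h0'.trans b0.symm) (h1'.trans b1.symm)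
  exact final_conv h01 g hUU hβe hfin

end
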